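/- Under the same assumptions on V, if u_a minimizes E_a under ‖u‖₂² = 1 for 0 ≤ a < a*, then there exists K > 0 independent of a such that K (a*-a)^{-2/(p+2)} ≤ ∫_{ℝ²} |u_a|⁴ dx ≤ K^{-1} (a*-a)^{-2/(p+2)}. -/

import Mathlib

open MeasureTheory Real Filter

noncomputable section

abbrev E2 : Type := EuclideanSpace ℝ (Fin 2)

/-- squared norm of the gradient -/
def gradSq (u : E2 → ℝ) (x : E2) : ℝ := ‖fderiv ℝ u x‖ ^ 2

/-- the Laplacian as the sum of second partial derivatives -/
def lap (u : E2 → ℝ) (x : E2) : ℝ :=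
  ∑ i : Fin 2, fderiv ℝ (fun y => fderiv ℝ u y (EuclideanSpace.single i 1)) x
      (EuclideanSpace.single i 1)

/-- membership in H¹(ℝ²) together with L⁴ (which follows by Sobolev embedding) -/
def IsH1 (u : E2 → ℝ) : Prop :=
  Differentiable ℝ u ∧ Integrable (fun x => u x ^ 2) ∧
    Integrable (gradSq u) ∧ Integrable (fun x => u x ^ 4)

/-- `Q` is the (unique) positive radial H¹ solution of `-ΔQ + Q - Q³ = 0` in ℝ² -/
def IsGroundState (Q : E2 → ℝ) : Prop :=
  ContDiff ℝ 2 Q ∧ (∀ x, 0 < Q x) ∧ (∀ x y : E2, ‖x‖ = ‖y‖ → Q x = Q y) ∧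
    IsH1 Q ∧ ∀ x, -lap Q x + Q x - Q x ^ 3 = 0

/-- the space 𝓗 : H¹ functions with finite potential energy -/
def InH (V : E2 → ℝ) (u : E2 → ℝ) : Prop :=
  IsH1 u ∧ Integrable (fun x => V x * u x ^ 2)

/-- the Gross–Pitaevskii functional -/
def Ea (V : E2 → ℝ) (a : ℝ) (u : E2 → ℝ) : ℝ :=
  (∫ x, gradSq u x) + (∫ x, V x * u x ^ 2) - a / 2 * (∫ x, u x ^ 4)

/-- a minimizer of the GP functional on the unit L² sphere of 𝓗 -/
def IsMinimizer (V : E2 → ℝ) (a : ℝ) (u : E2 → ℝ) : Prop :=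
  InH V u ∧ (∫ x, u x ^ 2) = 1 ∧
    ∀ v, InH V v → (∫ x, v x ^ 2) = 1 → Ea V a u ≤ Ea V a v

/-- the GP ground-state energy, with values in ℝ ∪ {±∞} -/
def gpE (V : E2 → ℝ) (a : ℝ) : EReal :=
  sInf {y : EReal | ∃ u, InH V u ∧ (∫ x, u x ^ 2) = 1 ∧ y = (Ea V a u : EReal)}

noncomputable section
open MeasureTheory Real Filter
open scoped Pointwise ENNReal
set_option linter.all false
set_option linter.deprecated false

lemma bm_one_compact (K L : Set ℝ) (hK : IsCompact K) (hL : IsCompact L)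
    (hKn : K.Nonempty) (hLn : L.Nonempty) : volume K + volume L ≤ volume (K + L) := by
  obtain ⟨k, hk, hkm⟩ := hK.exists_isGreatest hKn
  obtain ⟨l, hl, hlm⟩ := hL.exists_isLeast hLn
  have h1 : (fun x => x + l) '' K ∪ (fun y => k + y) '' L ⊆ K + L := by
    rintro z (⟨x, hx, rfl⟩ | ⟨y, hy, rfl⟩)
    · exact Set.add_mem_add hx hl
    · exact Set.add_mem_add hk hy
  refine le_trans ?_ (measure_mono h1)
  have hm1 : volume ((fun x => x + l) '' K) = volume K := by simp
  have hm2 : volume ((fun y => k + y) '' L) = volume L := by simp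
  have hd : AEDisjoint volume ((fun x => x + l) '' K) ((fun y => k + y) '' L) := by
    refine measure_mono_null (t := {k + l}) ?_ (by simp)
    rintro z ⟨⟨x, hx, rfl⟩, ⟨y, hy, hxy⟩⟩
    have a1 := hkm hx
    have a2 := hlm hy
    simp only [Set.mem_singleton_iff] at *
    linarith
  have hLc : IsCompact ((fun y => k + y) '' L) := hL.image (by fun_prop)
  rw [measure_union₀ hLc.measurableSet.nullMeasurableSet hd, hm1, hm2]

lemma bm_one (A B : Set ℝ) (hA : MeasurableSet A) (hB : MeasurableSet B)
    (hAn : A.Nonempty) (hBn : B.Nonempty) : volume A + volume B ≤ volume (A + B) := by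
  have key : ∀ (S : Set ℝ), MeasurableSet S → S.Nonempty → ∀ a < volume S,
      ∃ K ⊆ S, IsCompact K ∧ K.Nonempty ∧ a ≤ volume K := by
    intro S hS hSn a ha
    obtain ⟨K, hKS, hK, hlt⟩ := hS.exists_lt_isCompact ha
    refine ⟨K, hKS, hK, ?_, hlt.le⟩
    by_contra hne
    rw [Set.not_nonempty_iff_eq_empty] at hne
    simp [hne] at hlt
  have key2 : ∀ (S : Set ℝ), MeasurableSet S → S.Nonempty →
      volume S = ⨆ K : {K : Set ℝ // K ⊆ S ∧ IsCompact K ∧ K.Nonempty}, volume K.1 := by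
    intro S hS hSn
    apply le_antisymm
    · refine le_of_forall_lt fun a ha => ?_
      obtain ⟨b, hab, hb⟩ := exists_between ha
      obtain ⟨K, hKS, hK, hKn, hle⟩ := key S hS hSn b hb
      exact lt_of_lt_of_le hab (hle.trans (le_iSup (fun K : {K : Set ℝ // K ⊆ S ∧ IsCompact K ∧ K.Nonempty} => volume K.1) ⟨K, hKS, hK, hKn⟩))
    · exact iSup_le fun K => measure_mono K.2.1
  rw [key2 A hA hAn, key2 B hB hBn]
  obtain ⟨a, ha⟩ := hAn
  obtain ⟨b, hb⟩ := hBn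
  have : Nonempty {K : Set ℝ // K ⊆ A ∧ IsCompact K ∧ K.Nonempty} :=
    ⟨⟨{a}, by simpa using ha, isCompact_singleton, by simp⟩⟩
  have : Nonempty {K : Set ℝ // K ⊆ B ∧ IsCompact K ∧ K.Nonempty} :=
    ⟨⟨{b}, by simpa using hb, isCompact_singleton, by simp⟩⟩
  rw [ENNReal.iSup_add]
  refine iSup_le fun K => ?_
  rw [ENNReal.add_iSup]
  refine iSup_le fun L => ?_
  exact (bm_one_compact K.1 L.1 K.2.2.1 L.2.2.1 K.2.2.2 L.2.2.2).trans
    (measure_mono (Set.add_subset_add K.2.1 L.2.1))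

/-- layer cake for normalized functions -/
lemma layer_norm (α : ℝ → ℝ) (hm : Measurable α) (h0 : ∀ x, 0 ≤ α x) (c : ℝ) (hc : 0 < c) 
    (hle : ∀ x, α x ≤ c) :
    ∫⁻ x, ENNReal.ofReal (α x / c) = ∫⁻ t in Set.Ioo (0:ℝ) 1, volume {x | c * t < α x} := by
  rw [lintegral_eq_lintegral_meas_lt _ (Eventually.of_forall fun x => div_nonneg (h0 x) hc.le)
    (hm.div_const c).aemeasurable]
  have e : ∀ t : ℝ, {a | t < α a / c} = {x | c * t < α x} := by
    intro t; ext x; simp only [Set.mem_setOf_eq]; rw [lt_div_iff₀ hc, mul_comm]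
  simp_rw [e]
  rw [← Set.Ioo_union_Ici_eq_Ioi (show (0:ℝ) < 1 by norm_num)]
  have hz : ∫⁻ t in Set.Ici (1:ℝ), volume {x | c * t < α x} = 0 := by
    rw [← lintegral_zero (μ := volume.restrict (Set.Ici (1:ℝ)))]
    refine setLIntegral_congr_fun measurableSet_Ici ?_
    intro t ht
    have : {x | c * t < α x} = ∅ := by
      ext x; simp only [Set.mem_setOf_eq, Set.mem_empty_iff_false, iff_false, not_lt]
      have := hle x
      have h1 : (1:ℝ) ≤ t := ht
      nlinarith
    simp [this]
  rw [lintegral_union measurableSet_Ici, hz, add_zero]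
  rw [Set.disjoint_left]
  intro t ht ht'
  exact absurd ht.2 (not_lt.mpr ht')

lemma bm_two (A B : Set (ℝ × ℝ)) (hA : IsOpen A) (hB : IsOpen B) (hAn : A.Nonempty) (hBn : B.Nonempty)
    (hAb : Bornology.IsBounded A) (hBb : Bornology.IsBounded B) :
    √(volume A).toReal + √(volume B).toReal ≤ √(volume (A + B)).toReal := by
  have hABo : IsOpen (A + B) := hA.add_right
  have hABb : Bornology.IsBounded (A + B) := hAb.add hBb
  -- sections
  have sec : ∀ S : Set (ℝ × ℝ), IsOpen S → Bornology.IsBounded S → S.Nonempty →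
      ∃ α : ℝ → ℝ, Measurable α ∧ (∀ x, 0 ≤ α x) ∧ (∀ x, ENNReal.ofReal (α x) = volume (Prod.mk x ⁻¹' S)) ∧
        (volume S = ∫⁻ x, ENNReal.ofReal (α x)) ∧ volume S ≠ ∞ ∧
        ∃ c, 0 < c ∧ IsLUB (Set.range α) c := by
    intro S hS hSb hSn
    obtain ⟨R, hR⟩ := hSb.subset_closedBall 0
    have hfin : ∀ x, volume (Prod.mk x ⁻¹' S) ≤ ENNReal.ofReal (2 * R) := by
      intro x
      have : Prod.mk x ⁻¹' S ⊆ Metric.closedBall 0 R := by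
        intro y hy
        have := hR hy
        simp only [Metric.mem_closedBall, dist_zero_right, Prod.norm_def] at this ⊢
        exact (le_max_right _ _).trans this
      refine (measure_mono this).trans ?_
      rw [Real.volume_closedBall]
    have hmeas : Measurable fun x => volume (Prod.mk x ⁻¹' S) := measurable_measure_prodMk_left hS.measurableSet
    have e : ∀ x, ENNReal.ofReal ((volume (Prod.mk x ⁻¹' S)).toReal) = volume (Prod.mk x ⁻¹' S) := fun x =>
      ENNReal.ofReal_toReal (ne_top_of_le_ne_top ENNReal.ofReal_ne_top (hfin x))
    have hbdd : BddAbove (Set.range fun x => (volume (Prod.mk x ⁻¹' S)).toReal) := by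
      refine ⟨(ENNReal.ofReal (2*R)).toReal, ?_⟩
      rintro _ ⟨x, rfl⟩
      exact ENNReal.toReal_mono ENNReal.ofReal_ne_top (hfin x)
    refine ⟨fun x => (volume (Prod.mk x ⁻¹' S)).toReal, hmeas.ennreal_toReal, fun x => ENNReal.toReal_nonneg, e, ?_, 
      hSb.measure_lt_top.ne, _, ?_, isLUB_ciSup hbdd⟩
    · simp_rw [e]
      rw [Measure.volume_eq_prod, Measure.prod_apply hS.measurableSet]
    · obtain ⟨⟨x, y⟩, hxy⟩ := hSn
      refine lt_of_lt_of_le ?_ (le_ciSup hbdd x)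
      refine ENNReal.toReal_pos ?_ (ne_top_of_le_ne_top ENNReal.ofReal_ne_top (hfin x))
      have ho : IsOpen (Prod.mk x ⁻¹' S) := hS.preimage (by fun_prop)
      exact (ho.measure_pos volume ⟨y, hxy⟩).ne'
  obtain ⟨α, αm, α0, αv, αA, αf, a, ha, hla⟩ := sec A hA hAb hAn
  obtain ⟨β, βm, β0, βv, βA, βf, b, hb, hlb⟩ := sec B hB hBb hBn
  obtain ⟨γ, γm, γ0, γv, γA, γf, -⟩ := sec (A+B) hABo hABb (hAn.add hBn)
  -- superadditivity of sections
  have hsup : ∀ x y, 0 < α x → 0 < β y → α x + β y ≤ γ (x + y) := by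
    intro x y hx hy
    have ho1 : IsOpen (Prod.mk x ⁻¹' A) := hA.preimage (by fun_prop)
    have ho2 : IsOpen (Prod.mk y ⁻¹' B) := hB.preimage (by fun_prop)
    have n1 : (Prod.mk x ⁻¹' A).Nonempty := by
      by_contra hne
      rw [Set.not_nonempty_iff_eq_empty] at hne
      have := αv x
      rw [hne, measure_empty, ENNReal.ofReal_eq_zero] at this
      linarith
    have n2 : (Prod.mk y ⁻¹' B).Nonempty := by
      by_contra hne
      rw [Set.not_nonempty_iff_eq_empty] at hne
      have := βv y
      rw [hne, measure_empty, ENNReal.ofReal_eq_zero] at this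
      linarith
    have h1 := bm_one _ _ ho1.measurableSet ho2.measurableSet n1 n2
    have h2 : Prod.mk x ⁻¹' A + Prod.mk y ⁻¹' B ⊆ Prod.mk (x + y) ⁻¹' (A + B) := by
      rintro _ ⟨s, hs, t, ht, rfl⟩
      exact ⟨(x, s), hs, (y, t), ht, rfl⟩
    have h3 := h1.trans (measure_mono h2)
    rw [← αv, ← βv, ← γv, ← ENNReal.ofReal_add (α0 x) (β0 y)] at h3
    exact (ENNReal.ofReal_le_ofReal_iff (γ0 _)).1 h3
  -- main inequality
  have main : (∫⁻ x, ENNReal.ofReal (α x / a)) + (∫⁻ x, ENNReal.ofReal (β x / b)) ≤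
      ∫⁻ x, ENNReal.ofReal (γ x / (a + b)) := by
    rw [layer_norm α αm α0 a ha fun x => hla.1 ⟨x, rfl⟩, layer_norm β βm β0 b hb fun x => hlb.1 ⟨x, rfl⟩]
    rw [lintegral_eq_lintegral_meas_lt (f := fun x => γ x / (a + b)) volume (Eventually.of_forall fun x => div_nonneg (γ0 x) (by positivity))
      (γm.div_const _).aemeasurable]
    have hmm : Measurable fun t : ℝ => volume {x | a * t < α x} := by
      have : Antitone fun t : ℝ => volume {x | a * t < α x} := by
        intro s t hst
        refine measure_mono fun x hx => ?_
        simp only [Set.mem_setOf_eq] at *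
        nlinarith
      exact this.measurable
    rw [← lintegral_add_left hmm]
    refine (lintegral_mono' (Measure.restrict_mono Set.Ioo_subset_Ioi_self le_rfl) ?_ |>.trans' 
      (b := ∫⁻ t in Set.Ioo (0:ℝ) 1, volume {x | t < γ x / (a+b)}) ?_)
    · exact le_rfl
    refine setLIntegral_mono' measurableSet_Ioo ?_
    intro t ht
    have n1 : {x | a * t < α x}.Nonempty := by
      have : a * t < a := by nlinarith [ht.2]
      obtain ⟨_, ⟨x, rfl⟩, hx, -⟩ := hla.exists_between this
      exact ⟨x, hx⟩
    have n2 : {x | b * t < β x}.Nonempty := by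
      have : b * t < b := by nlinarith [ht.2]
      obtain ⟨_, ⟨x, rfl⟩, hx, -⟩ := hlb.exists_between this
      exact ⟨x, hx⟩
    refine (bm_one _ _ (measurableSet_lt measurable_const αm) (measurableSet_lt measurable_const βm) n1 n2).trans (measure_mono ?_)
    rintro _ ⟨x, hx, y, hy, rfl⟩
    simp only [Set.mem_setOf_eq] at *
    have p1 : 0 < a * t := mul_pos ha ht.1
    have p2 : 0 < b * t := mul_pos hb ht.1
    have := hsup x y (by linarith) (by linarith)
    rw [lt_div_iff₀ (by positivity)]
    nlinarith
  have conv : ∀ (α : ℝ → ℝ) (c : ℝ), 0 < c → Measurable α →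
      ∫⁻ x, ENNReal.ofReal (α x / c) = (∫⁻ x, ENNReal.ofReal (α x)) * ENNReal.ofReal c⁻¹ := by
    intro α c hc hm
    rw [← lintegral_mul_const _ hm.ennreal_ofReal]
    congr 1; ext x
    rw [div_eq_mul_inv, ENNReal.ofReal_mul' (by positivity)]
  rw [conv α a ha αm, conv β b hb βm, conv γ (a+b) (by positivity) γm, ← αA, ← βA, ← γA] at main
  have main2 := ENNReal.toReal_mono (by finiteness) main
  rw [ENNReal.toReal_add (by finiteness) (by finiteness)] at main2
  simp only [ENNReal.toReal_mul] at main2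
  rw [ENNReal.toReal_ofReal (by positivity), ENNReal.toReal_ofReal (by positivity), ENNReal.toReal_ofReal (by positivity)] at main2
  have hx0 : 0 ≤ (volume A).toReal := ENNReal.toReal_nonneg
  have hy0 : 0 ≤ (volume B).toReal := ENNReal.toReal_nonneg
  have hz0 : 0 ≤ (volume (A + B)).toReal := ENNReal.toReal_nonneg
  generalize (volume A).toReal = x at *
  generalize (volume B).toReal = y at *
  generalize (volume (A + B)).toReal = z at *
  apply Real.le_sqrt_of_sq_le
  have hs1 := Real.sq_sqrt hx0
  have hs2 := Real.sq_sqrt hy0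
  set s := √x
  set t := √y
  rw [← hs1, ← hs2] at main2
  have h3 : (s ^ 2 * a⁻¹ + t ^ 2 * b⁻¹) * (a + b) ≤ z := by
    have hab : 0 < a + b := by positivity
    calc _ ≤ z * (a + b)⁻¹ * (a + b) := by gcongr
      _ = z := by field_simp
  refine le_trans ?_ h3
  have h4 : (s ^ 2 * a⁻¹ + t ^ 2 * b⁻¹) * (a + b) - (s + t) ^ 2 = (s * b - t * a) ^ 2 / (a * b) := by
    field_simp
    ring
  have h5 : 0 ≤ (s * b - t * a) ^ 2 / (a * b) := by positivity
  linarith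


/-- the coordinates of the plane -/
def toPr (x : E2) : ℝ × ℝ := (x 0, x 1)

lemma toPr_mp : MeasurePreserving toPr (volume : Measure E2) volume := by
  have h1 := EuclideanSpace.volume_preserving_symm_measurableEquiv_toLp (Fin 2)
  have h2 := volume_preserving_finTwoArrow ℝ
  have h3 := h2.comp h1
  exact h3

lemma toPr_cont : Continuous toPr := by
  unfold toPr; fun_prop

lemma toPr_surj : Function.Surjective toPr := by
  rintro ⟨a, b⟩
  exact ⟨!₂[a, b], by simp [toPr]⟩

lemma toPr_inj : Function.Injective toPr := by
  intro x y hxy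
  simp only [toPr, Prod.mk.injEq] at hxy
  ext i; fin_cases i
  · exact hxy.1
  · exact hxy.2

lemma toPr_open : IsOpenMap toPr := by
  have e : toPr = (Homeomorph.finTwoArrow (X := ℝ)) ∘ (EuclideanSpace.equiv (Fin 2) ℝ) := by
    ext x <;> simp [toPr]
  rw [e]
  exact (Homeomorph.isOpenMap _).comp (ContinuousLinearEquiv.isOpenMap _)

lemma toPr_vol (S : Set E2) (hS : IsOpen S) : volume (toPr '' S) = volume S := by
  rw [← toPr_mp.measure_preimage (toPr_open S hS).measurableSet.nullMeasurableSet, toPr_inj.preimage_image]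

lemma toPr_bdd (S : Set E2) (hS : Bornology.IsBounded S) : Bornology.IsBounded (toPr '' S) := by
  obtain ⟨R, hR⟩ := hS.subset_closedBall 0
  exact (((isCompact_closedBall (0:E2) R).image toPr_cont).isBounded).subset (Set.image_mono hR)

lemma bm_E2 (A : Set E2) (hA : IsOpen A) (hAn : A.Nonempty) (hAb : Bornology.IsBounded A)
    (ρ : ℝ) (hρ : 0 < ρ) :
    √(volume A).toReal + √π * ρ ≤ √(volume (A + Metric.ball (0:E2) ρ)).toReal := by
  have h := bm_two (toPr '' A) (toPr '' Metric.ball 0 ρ) (toPr_open _ hA) (toPr_open _ Metric.isOpen_ball)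
    (hAn.image _) ((Metric.nonempty_ball.2 hρ).image _) (toPr_bdd _ hAb) (toPr_bdd _ Metric.isBounded_ball)
  have e : toPr '' A + toPr '' Metric.ball 0 ρ = toPr '' (A + Metric.ball 0 ρ) := by
    ext z
    constructor
    · rintro ⟨_, ⟨x, hx, rfl⟩, _, ⟨y, hy, rfl⟩, rfl⟩
      exact ⟨x + y, ⟨x, hx, y, hy, rfl⟩, by simp [toPr]⟩
    · rintro ⟨_, ⟨x, hx, y, hy, rfl⟩, rfl⟩
      exact ⟨toPr x, ⟨x, hx, rfl⟩, toPr y, ⟨y, hy, rfl⟩, by simp [toPr]⟩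
  rw [e, toPr_vol _ hA, toPr_vol _ Metric.isOpen_ball, toPr_vol _ hA.add_right] at h
  rw [EuclideanSpace.volume_ball_fin_two] at h
  have e2 : √(ENNReal.ofReal ρ ^ 2 * ENNReal.ofReal π).toReal = √π * ρ := by
    rw [ENNReal.toReal_mul, ENNReal.toReal_pow, ENNReal.toReal_ofReal hρ.le, ENNReal.toReal_ofReal pi_pos.le, mul_comm,
      Real.sqrt_mul pi_pos.le, Real.sqrt_sq hρ.le]
  first
  | rw [e2] at h; exact h
  | (convert h using 2; rw [← e2]; congr 2)

end

noncomputable section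
open MeasureTheory Real Filter
open scoped Pointwise ENNReal NNReal Topology
set_option linter.all false
set_option linter.deprecated false

/-- nice functions: nonnegative, Lipschitz, compactly supported -/
structure Nice (f : E2 → ℝ) (L : ℝ≥0) (R B : ℝ) : Prop where
  nn : ∀ x, 0 ≤ f x
  lip : LipschitzWith L f
  sup : ∀ x, R ≤ ‖x‖ → f x = 0
  bd : ∀ x, f x ≤ B

/-- radius of the ball with the measure of a superlevel set -/
def rad (f : E2 → ℝ) (t : ℝ) : ℝ := √(volume {x | t < f x}).toReal / √π

/-- decreasing rearrangement (profile) -/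
def hst (f : E2 → ℝ) (r : ℝ) : ℝ := sSup {t | 0 ≤ t ∧ |r| < rad f t}

lemma rad_nonneg (f : E2 → ℝ) (t : ℝ) : 0 ≤ rad f t := by unfold rad; positivity

section
variable {f : E2 → ℝ} {L : ℝ≥0} {R B : ℝ}

lemma Nice.isOpen (hf : Nice f L R B) (t : ℝ) : IsOpen {x | t < f x} :=
  isOpen_lt continuous_const hf.lip.continuous

lemma Nice.bdd (hf : Nice f L R B) {t : ℝ} (ht : 0 ≤ t) : Bornology.IsBounded {x | t < f x} := by
  refine (Metric.isBounded_ball (x := (0:E2)) (r := R)).subset ?_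
  intro x hx
  simp only [Set.mem_setOf_eq, Metric.mem_ball, dist_zero_right] at *
  by_contra hc
  have := hf.sup x (not_lt.mp hc)
  linarith

lemma Nice.fin (hf : Nice f L R B) {t : ℝ} (ht : 0 ≤ t) : volume {x | t < f x} ≠ ∞ :=
  (hf.bdd ht).measure_lt_top.ne

lemma Nice.vol_eq (hf : Nice f L R B) {t : ℝ} (ht : 0 ≤ t) :
    volume {x | t < f x} = volume (Metric.ball (0:E2) (rad f t)) := by
  have hpi : (0:ℝ) < √π := Real.sqrt_pos.2 pi_pos
  have e : volume (Metric.ball (0:E2) (rad f t)) = ENNReal.ofReal (rad f t) ^ 2 * ENNReal.ofReal π := by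
    rw [EuclideanSpace.volume_ball_fin_two]
  rw [e, ← ENNReal.ofReal_pow (rad_nonneg _ _), ← ENNReal.ofReal_mul (by positivity)]
  unfold rad
  rw [div_pow, Real.sq_sqrt ENNReal.toReal_nonneg, Real.sq_sqrt pi_pos.le, div_mul_cancel₀ _ pi_pos.ne',
    ENNReal.ofReal_toReal (hf.fin ht)]

lemma Nice.rad_anti (hf : Nice f L R B) {s t : ℝ} (hs : 0 ≤ s) (hst : s ≤ t) : rad f t ≤ rad f s := by
  unfold rad
  gcongr
  exact hf.fin hs

lemma Nice.rad_zero (hf : Nice f L R B) {t : ℝ} (ht : B ≤ t) : rad f t = 0 := by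
  have : {x | t < f x} = ∅ := by
    ext x; simp only [Set.mem_setOf_eq, Set.mem_empty_iff_false, iff_false, not_lt]
    exact (hf.bd x).trans ht
  simp [rad, this]

lemma Nice.rad_cont (hf : Nice f L R B) {r t : ℝ} (ht : 0 ≤ t) (h : r < rad f t) :
    ∃ t' > t, r < rad f t' := by
  have hu : {x | t < f x} = ⋃ n : ℕ, {x | t + 1 / ((n:ℝ) + 1) < f x} := by
    ext x
    simp only [Set.mem_setOf_eq, Set.mem_iUnion]
    constructor
    · intro hx
      obtain ⟨n, hn⟩ := exists_nat_one_div_lt (sub_pos.2 hx)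
      exact ⟨n, by linarith⟩
    · rintro ⟨n, hn⟩
      have : 0 < 1 / ((n:ℝ) + 1) := by positivity
      linarith
  have hmono : Monotone fun n : ℕ => {x | t + 1 / ((n:ℝ) + 1) < f x} := by
    intro n m hnm x hx
    simp only [Set.mem_setOf_eq] at *
    have : 1 / ((m:ℝ) + 1) ≤ 1 / ((n:ℝ) + 1) := by gcongr
    linarith
  have ht1 := tendsto_measure_iUnion_atTop (μ := volume) hmono
  rw [← hu] at ht1
  have ht2 := (ENNReal.tendsto_toReal (hf.fin ht)).comp ht1
  have ht3 : Tendsto (fun n : ℕ => rad f (t + 1 / ((n:ℝ) + 1))) atTop (𝓝 (rad f t)) := by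
    exact ((Real.continuous_sqrt.tendsto _).comp ht2).div_const _
  obtain ⟨n, hn⟩ := (ht3.eventually (lt_mem_nhds h)).exists
  refine ⟨_, ?_, hn⟩
  have : 0 < 1 / ((n:ℝ) + 1) := by positivity
  linarith

lemma Nice.hst_bdd (hf : Nice f L R B) (r : ℝ) : BddAbove {t | 0 ≤ t ∧ |r| < rad f t} := by
  refine ⟨B, ?_⟩
  rintro t ⟨ht, htr⟩
  by_contra hc
  rw [hf.rad_zero (not_le.mp hc).le] at htr
  exact absurd htr (not_lt.mpr (abs_nonneg r))

lemma Nice.lt_hst (hf : Nice f L R B) {r t : ℝ} (ht : 0 ≤ t) : t < hst f r ↔ |r| < rad f t := by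
  constructor
  · intro h
    have hne : {t | 0 ≤ t ∧ |r| < rad f t}.Nonempty := by
      by_contra hne
      rw [Set.not_nonempty_iff_eq_empty] at hne
      rw [hst, hne, Real.sSup_empty] at h
      linarith
    obtain ⟨t', ⟨h1, h2⟩, h3⟩ := exists_lt_of_lt_csSup hne h
    exact h2.trans_le (hf.rad_anti ht h3.le)
  · intro h
    obtain ⟨t', h1, h2⟩ := hf.rad_cont ht h
    exact h1.trans_le (le_csSup (hf.hst_bdd r) ⟨by linarith, h2⟩)

lemma hst_nonneg (f : E2 → ℝ) (r : ℝ) : 0 ≤ hst f r := Real.sSup_nonneg fun t ht => ht.1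

lemma hst_abs (f : E2 → ℝ) (r : ℝ) : hst f |r| = hst f r := by simp [hst]

lemma Nice.hst_le (hf : Nice f L R B) (hB : 0 ≤ B) (r : ℝ) : hst f r ≤ B := by
  by_contra hc
  have := (hf.lt_hst hB).1 (not_le.mp hc)
  rw [hf.rad_zero le_rfl] at this
  exact absurd this (not_lt.mpr (abs_nonneg r))

lemma Nice.rad_gap (hf : Nice f L R B) (hL : 0 < L) {s t : ℝ} (ht : 0 ≤ t) (hs : 0 < s) (hp : 0 < rad f (t + s)) :
    rad f (t + s) + s / L ≤ rad f t := by
  have hpi : (0:ℝ) < √π := Real.sqrt_pos.2 pi_pos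
  have hne : {x | t + s < f x}.Nonempty := by
    by_contra hne
    rw [Set.not_nonempty_iff_eq_empty] at hne
    simp [rad, hne] at hp
  have hL' : (0:ℝ) < L := hL
  have h := bm_E2 _ (hf.isOpen (t + s)) hne (hf.bdd (by linarith)) (s / L) (by positivity)
  have hsub : {x | t + s < f x} + Metric.ball (0:E2) (s / L) ⊆ {x | t < f x} := by
    rintro _ ⟨x, hx, y, hy, rfl⟩
    simp only [Set.mem_setOf_eq, Metric.mem_ball, dist_zero_right] at *
    have := hf.lip.dist_le_mul x (x + y)
    rw [dist_self_add_right, Real.dist_eq] at this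
    have h1 : (L:ℝ) * ‖y‖ < s := by rwa [lt_div_iff₀ hL', mul_comm] at hy
    have := abs_le.1 this
    linarith
  have h2 : √(volume ({x | t + s < f x} + Metric.ball (0:E2) (s / L))).toReal ≤ √(volume {x | t < f x}).toReal := by
    gcongr
    exact hf.fin ht
  unfold rad
  rw [div_add' _ _ _ hpi.ne', mul_comm (s / (L:ℝ))]
  gcongr
  linarith

lemma Nice.hst_lip (hf : Nice f L R B) (hL : 0 < L) : LipschitzWith L (hst f) := by
  have key : ∀ r r', 0 ≤ r → r ≤ r' → hst f r ≤ hst f r' + L * (r' - r) := by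
    intro r r' hr hrr
    by_contra hc
    push Not at hc
    have hL' : (0:ℝ) < L := hL
    have h1 := (hf.lt_hst (add_nonneg (hst_nonneg f r') (mul_nonneg hL'.le (sub_nonneg.2 hrr)))).1 hc
    rw [abs_of_nonneg hr] at h1
    rcases hrr.eq_or_lt with rfl | hlt
    · simp at hc
    have hs : 0 < L * (r' - r) := mul_pos hL' (by linarith)
    have h2 := hf.rad_gap hL (hst_nonneg f r') hs (by linarith)
    have h3 : L * (r' - r) / L = r' - r := by field_simp
    rw [h3] at h2
    have := (hf.lt_hst (r := r') (hst_nonneg f r')).2 (by rw [abs_of_nonneg (hr.trans hrr)]; linarith)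
    exact lt_irrefl _ this
  have anti : ∀ r r', 0 ≤ r → r ≤ r' → hst f r' ≤ hst f r := by
    intro r r' hr hrr
    by_contra hc
    push Not at hc
    have h1 := (hf.lt_hst (hst_nonneg f r)).1 hc
    rw [abs_of_nonneg (hr.trans hrr)] at h1
    have h2 := (hf.lt_hst (r := r) (hst_nonneg f r)).2 (by rw [abs_of_nonneg hr]; linarith)
    exact lt_irrefl _ h2
  refine LipschitzWith.of_le_add_mul L fun x y => ?_
  rw [← hst_abs f x, ← hst_abs f y, Real.dist_eq]
  have ha := abs_abs_sub_abs_le_abs_sub x y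
  have hL' : (0:ℝ) ≤ L := L.2
  rcases le_total |x| |y| with h | h
  · refine (key _ _ (abs_nonneg x) h).trans ?_
    gcongr
    rw [abs_le] at ha; linarith
  · have := anti _ _ (abs_nonneg y) h
    have : 0 ≤ L * |x - y| := by positivity
    linarith

lemma Nice.hst_anti (hf : Nice f L R B) : AntitoneOn (hst f) (Set.Ici 0) := by
  intro r hr r' _ hrr
  by_contra hc
  push Not at hc
  have hr : 0 ≤ r := hr
  have h1 := (hf.lt_hst (hst_nonneg f r)).1 hc
  rw [abs_of_nonneg (hr.trans hrr)] at h1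
  have h2 := (hf.lt_hst (r := r) (hst_nonneg f r)).2 (by rw [abs_of_nonneg hr]; linarith)
  exact lt_irrefl _ h2

lemma Nice.hst_supp (hf : Nice f L R B) (r : ℝ) (hr : rad f 0 ≤ r) : hst f r = 0 := by
  by_contra hc
  have h0 : 0 < hst f r := lt_of_le_of_ne (hst_nonneg f r) (Ne.symm hc)
  have := (hf.lt_hst le_rfl).1 h0
  rw [abs_of_nonneg ((rad_nonneg f 0).trans hr)] at this
  linarith

lemma Nice.star (hf : Nice f L R B) (hL : 0 < L) (hB : 0 ≤ B) :
    Nice (fun x => hst f ‖x‖) L (rad f 0) B where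
  nn x := hst_nonneg f _
  lip := by
    have h := (hf.hst_lip hL).comp (lipschitzWith_one_norm (E := E2))
    rw [mul_one] at h
    exact h
  sup x hx := hf.hst_supp _ hx
  bd x := hf.hst_le hB _

lemma Nice.equi (hf : Nice f L R B) {t : ℝ} (ht : 0 ≤ t) :
    volume {x : E2 | t < hst f ‖x‖} = volume {x | t < f x} := by
  rw [hf.vol_eq ht]
  congr 1
  ext x
  simp only [Set.mem_setOf_eq, Metric.mem_ball, dist_zero_right]
  rw [hf.lt_hst ht, abs_of_nonneg (norm_nonneg x)]

end

lemma lintegral_equi (f g : E2 → ℝ) (hf : Measurable f) (hg : Measurable g) (hf0 : ∀ x, 0 ≤ f x) (hg0 : ∀ x, 0 ≤ g x)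
    (h : ∀ t, 0 ≤ t → volume {x | t < f x} = volume {x | t < g x}) (k : ℕ) (hk : k ≠ 0) :
    ∫⁻ x, ENNReal.ofReal (f x ^ k) = ∫⁻ x, ENNReal.ofReal (g x ^ k) := by
  have key : ∀ (f : E2 → ℝ), Measurable f → (∀ x, 0 ≤ f x) → 
      ∫⁻ x, ENNReal.ofReal (f x ^ k) = ∫⁻ t in Set.Ioi (0:ℝ), volume {x | t ^ (1 / (k:ℝ)) < f x} := by
    intro f hf hf0
    rw [lintegral_eq_lintegral_meas_lt volume (Eventually.of_forall fun x => pow_nonneg (hf0 x) k) (hf.pow_const k).aemeasurable]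
    refine setLIntegral_congr_fun measurableSet_Ioi fun t ht => ?_
    have ht : 0 < t := ht
    congr 1
    ext x
    simp only [Set.mem_setOf_eq]
    have e : t = (t ^ (1 / (k:ℝ))) ^ k := by
      rw [one_div, Real.rpow_inv_natCast_pow ht.le hk]
    conv_lhs => rw [e]
    exact pow_lt_pow_iff_left₀ (by positivity) (hf0 x) hk
  rw [key f hf hf0, key g hg hg0]
  refine setLIntegral_congr_fun measurableSet_Ioi fun t ht => ?_
  have ht : 0 < t := ht
  exact h _ (by positivity)

end

noncomputable section
open MeasureTheory Real Filter
open scoped Pointwise ENNReal NNReal Topology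
set_option linter.all false
set_option linter.deprecated false

/-- sup-convolution -/
def supc (ε : ℝ) (f : E2 → ℝ) (x : E2) : ℝ := ⨆ z, (f (x + z) - ‖z‖ ^ 2 / (4 * ε))

section
variable {f : E2 → ℝ} {L : ℝ≥0} {R B : ℝ}

lemma Nice.supc_bdd (hf : Nice f L R B) {ε : ℝ} (hε : 0 < ε) (x : E2) :
    BddAbove (Set.range fun z => (f (x + z) - ‖z‖ ^ 2 / (4 * ε))) := by
  refine ⟨B, ?_⟩
  rintro _ ⟨z, rfl⟩
  have := hf.bd (x + z)
  have : 0 ≤ ‖z‖ ^ 2 / (4 * ε) := by positivity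
  simp only; linarith

lemma Nice.le_supc (hf : Nice f L R B) {ε : ℝ} (hε : 0 < ε) (x : E2) : f x ≤ supc ε f x := by
  have : f (x + 0) - ‖(0:E2)‖ ^ 2 / (4 * ε) ≤ supc ε f x := le_ciSup (hf.supc_bdd hε x) 0
  simpa using this

lemma Nice.supc_le (hf : Nice f L R B) {ε : ℝ} (hε : 0 < ε) (x : E2) : supc ε f x ≤ f x + ε * L ^ 2 := by
  refine ciSup_le fun z => ?_
  have := hf.lip.dist_le_mul (x + z) x
  rw [dist_self_add_left, Real.dist_eq] at this
  have h1 := (abs_le.1 this).2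
  have h2 : L * ‖z‖ - ‖z‖ ^ 2 / (4 * ε) ≤ ε * L ^ 2 := by
    have : ε * (L:ℝ) ^ 2 - (L * ‖z‖ - ‖z‖ ^ 2 / (4 * ε)) = (‖z‖ - 2 * ε * L) ^ 2 / (4 * ε) := by
      field_simp; ring
    have h3 : 0 ≤ (‖z‖ - 2 * ε * L) ^ 2 / (4 * ε) := by positivity
    linarith
  linarith

lemma Nice.supc_cont (hf : Nice f L R B) {ε : ℝ} (hε : 0 < ε) : Continuous (supc ε f) := by
  have : LipschitzWith L (supc ε f) := by
    refine LipschitzWith.of_le_add_mul L fun x y => ?_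
    refine ciSup_le fun z => ?_
    have h1 := le_ciSup (hf.supc_bdd hε y) z
    have h2 := hf.lip.dist_le_mul (x + z) (y + z)
    rw [dist_add_right, Real.dist_eq] at h2
    have h3 := (abs_le.1 h2).2
    change _ ≤ supc ε f y + _
    have h4 : f (y + z) - ‖z‖ ^ 2 / (4 * ε) ≤ supc ε f y := h1
    linarith
  exact this.continuous

lemma Nice.supc_supp (hf : Nice f L R B) {ε : ℝ} (hε : 0 < ε) (hε1 : ε ≤ 1) (hB : 0 ≤ B) (x : E2) (hx : R + 2 * √B ≤ ‖x‖) :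
    supc ε f x = 0 := by
  apply le_antisymm
  · refine ciSup_le fun z => ?_
    have h0 : 0 ≤ ‖z‖ ^ 2 / (4 * ε) := by positivity
    by_cases h : R ≤ ‖x + z‖
    · rw [hf.sup _ h]; linarith
    · push Not at h
      have h1 : ‖x‖ ≤ ‖x + z‖ + ‖z‖ := by
        have := norm_sub_le (x + z) z
        simpa using this
      have h2 : 2 * √B ≤ ‖z‖ := by linarith
      have h3 : 4 * B ≤ ‖z‖ ^ 2 := by
        have : (2 * √B) ^ 2 ≤ ‖z‖ ^ 2 := by gcongr
        rw [mul_pow, Real.sq_sqrt hB] at this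
        linarith
      have h4 : B ≤ ‖z‖ ^ 2 / (4 * ε) := by
        rw [le_div_iff₀ (by positivity)]
        nlinarith
      have := hf.bd (x + z)
      linarith
  · exact (hf.nn x).trans (hf.le_supc hε x)

lemma Nice.supc_level (hf : Nice f L R B) (hL : 0 < L) (hB : 0 ≤ B) {ε : ℝ} (hε : 0 < ε) (hε1 : ε ≤ 1) {t : ℝ} (ht : 0 ≤ t) :
    volume {x : E2 | t < supc ε (fun x => hst f ‖x‖) x} ≤ volume {x | t < supc ε f x} := by
  have hpi : (0:ℝ) < √π := Real.sqrt_pos.2 pi_pos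
  have hb : Bornology.IsBounded {x | t < supc ε f x} := by
    refine (Metric.isBounded_ball (x := (0:E2)) (r := R + 2 * √B)).subset ?_
    intro x hx
    simp only [Set.mem_setOf_eq, Metric.mem_ball, dist_zero_right] at *
    by_contra hc
    have := hf.supc_supp hε hε1 hB x (not_lt.mp hc)
    linarith
  have hfin : volume {x | t < supc ε f x} ≠ ∞ := hb.measure_lt_top.ne
  set v := (volume {x | t < supc ε f x}).toReal with hv
  have hsub : {x : E2 | t < supc ε (fun x => hst f ‖x‖) x} ⊆ Metric.ball 0 (√v / √π) := by
    intro x hx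
    simp only [Set.mem_setOf_eq, Metric.mem_ball, dist_zero_right] at *
    obtain ⟨z, hz⟩ := exists_lt_of_lt_ciSup hx
    set s := ‖z‖ ^ 2 / (4 * ε) with hs
    have hs0 : 0 ≤ s := by positivity
    have h1 : t + s < hst f ‖x + z‖ := by linarith
    rw [hf.lt_hst (by linarith), abs_of_nonneg (norm_nonneg _)] at h1
    have h2 : ‖x‖ ≤ ‖x + z‖ + ‖z‖ := by
      have := norm_sub_le (x + z) z
      simpa using this
    have h3 : rad f (t + s) + ‖z‖ ≤ √v / √π := by
      rcases (norm_nonneg z).eq_or_lt with h0 | hzp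
      · rw [← h0] at hs ⊢
        have : s = 0 := by rw [hs]; simp
        rw [this, add_zero, add_zero]
        unfold rad
        gcongr
        rw [hv]
        exact ENNReal.toReal_mono hfin (measure_mono fun x hx => lt_of_lt_of_le hx (hf.le_supc hε x))
      · have hne : {x | t + s < f x}.Nonempty := by
          by_contra hne
          rw [Set.not_nonempty_iff_eq_empty] at hne
          simp [rad, hne] at h1
          exact absurd h1 (not_lt.mpr (norm_nonneg _))
        have h := bm_E2 _ (hf.isOpen (t + s)) hne (hf.bdd (by linarith)) ‖z‖ hzp
        have hsub : {x | t + s < f x} + Metric.ball (0:E2) ‖z‖ ⊆ {x | t < supc ε f x} := by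
          rintro _ ⟨y, hy, w, hw, rfl⟩
          simp only [Set.mem_setOf_eq, Metric.mem_ball, dist_zero_right] at *
          have h5 : f (y + w + (-w)) - ‖-w‖ ^ 2 / (4 * ε) ≤ supc ε f (y + w) := le_ciSup (hf.supc_bdd hε (y + w)) (-w)
          rw [add_neg_cancel_right, norm_neg] at h5
          have h6 : ‖w‖ ^ 2 / (4 * ε) ≤ s := by rw [hs]; gcongr
          linarith
        have h2 : √(volume ({x | t + s < f x} + Metric.ball (0:E2) ‖z‖)).toReal ≤ √v := by
          rw [hv]
          gcongr
        unfold rad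
        rw [div_add' _ _ _ hpi.ne', mul_comm ‖z‖]
        gcongr
        linarith
    linarith
  refine (measure_mono hsub).trans ?_
  have e : volume (Metric.ball (0:E2) (√v / √π)) = ENNReal.ofReal (√v / √π) ^ 2 * ENNReal.ofReal π := by
    rw [EuclideanSpace.volume_ball_fin_two]
  rw [e, ← ENNReal.ofReal_pow (by positivity), ← ENNReal.ofReal_mul (by positivity)]
  rw [div_pow, Real.sq_sqrt ENNReal.toReal_nonneg, Real.sq_sqrt pi_pos.le, div_mul_cancel₀ _ pi_pos.ne',
    ENNReal.ofReal_toReal hfin]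

lemma Nice.int_fin (hf : Nice f L R B) : ∫⁻ x, ENNReal.ofReal (f x) ≠ ∞ := by
  have hc : HasCompactSupport f := HasCompactSupport.intro (isCompact_closedBall (0:E2) R) (by
    intro x hx
    apply hf.sup
    simp at hx; exact hx.le)
  have := (hf.lip.continuous.integrable_of_hasCompactSupport (μ := volume) hc).lintegral_lt_top
  exact this.ne

lemma Nice.supc_int (hf : Nice f L R B) (hL : 0 < L) (hB : 0 ≤ B) {ε : ℝ} (hε : 0 < ε) (hε1 : ε ≤ 1) :
    ∫⁻ x : E2, ENNReal.ofReal ((supc ε (fun x => hst f ‖x‖) x - hst f ‖x‖) / ε) ≤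
      ∫⁻ x, ENNReal.ofReal ((supc ε f x - f x) / ε) := by
  have hs := hf.star hL hB
  have key : ∀ {f : E2 → ℝ} {R : ℝ}, Nice f L R B → ∫⁻ x, ENNReal.ofReal ((supc ε f x - f x) / ε) = 
      ENNReal.ofReal (1 / ε) * ((∫⁻ x, ENNReal.ofReal (supc ε f x)) - (∫⁻ x, ENNReal.ofReal (f x))) := by
    intro f R hf
    rw [← lintegral_sub hf.lip.continuous.measurable.ennreal_ofReal hf.int_fin
      (Eventually.of_forall fun x => ENNReal.ofReal_le_ofReal (hf.le_supc hε x)), ← lintegral_const_mul]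
    · congr 1; ext x
      rw [← ENNReal.ofReal_sub _ (hf.nn x), ← ENNReal.ofReal_mul (by positivity)]
      congr 1; ring
    · exact (hf.supc_cont hε).measurable.ennreal_ofReal.sub hf.lip.continuous.measurable.ennreal_ofReal
  rw [key hf, key hs]
  have e1 := lintegral_equi _ _ hs.lip.continuous.measurable hf.lip.continuous.measurable hs.nn hf.nn
    (fun t ht => hf.equi ht) 1 one_ne_zero
  simp only [pow_one] at e1
  rw [e1]
  gcongr _ * (?_ - _)
  rw [lintegral_eq_lintegral_meas_lt volume (Eventually.of_forall fun x => (hs.nn x).trans (hs.le_supc hε x)) (hs.supc_cont hε).aemeasurable,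
    lintegral_eq_lintegral_meas_lt volume (Eventually.of_forall fun x => (hf.nn x).trans (hf.le_supc hε x)) (hf.supc_cont hε).aemeasurable]
  refine setLIntegral_mono' measurableSet_Ioi fun t ht => ?_
  exact hf.supc_level hL hB hε hε1 (le_of_lt ht)

lemma Nice.rearr (hf : Nice f L R B) (hL : 0 < L) (hB : 0 ≤ B) (g : E2 → ℝ) (hg0 : ∀ x, 0 ≤ g x)
    (hg : ∀ᵐ x, ∀ κ > g x, ∀ᶠ y in 𝓝 x, f y ≤ f x + κ * ‖y - x‖) :
    ∫⁻ x : E2, ENNReal.ofReal (deriv (hst f) ‖x‖ ^ 2) ≤ ∫⁻ x, ENNReal.ofReal (g x ^ 2) := by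
  have hs := hf.star hL hB
  set e : ℕ → ℝ := fun n => 1 / ((n:ℝ) + 1) with he
  have he0 : ∀ n, 0 < e n := fun n => by simp only [he]; positivity
  have he1 : ∀ n, e n ≤ 1 := fun n => by
    simp only [he]; rw [div_le_one (by positivity)]; linarith [(Nat.cast_nonneg n : (0:ℝ) ≤ n)]
  have het : Tendsto e atTop (𝓝 0) := tendsto_one_div_add_atTop_nhds_zero_nat
  -- left
  have hmeas : ∀ {f : E2 → ℝ} {R : ℝ}, Nice f L R B → ∀ n, Measurable fun x => ENNReal.ofReal ((supc (e n) f x - f x) / e n) := 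
    fun hf n => (((hf.supc_cont (he0 n)).measurable.sub hf.lip.continuous.measurable).div_const _).ennreal_ofReal
  have left : ∫⁻ x : E2, ENNReal.ofReal (deriv (hst f) ‖x‖ ^ 2) ≤ 
      liminf (fun n => ∫⁻ x : E2, ENNReal.ofReal ((supc (e n) (fun x => hst f ‖x‖) x - hst f ‖x‖) / e n)) atTop := by
    refine le_trans ?_ (lintegral_liminf_le (hmeas hs))
    refine lintegral_mono_ae ?_
    have h0 : ∀ᵐ x : E2, x ≠ 0 := by
      simp [ae_iff, Set.setOf_eq_eq_singleton]
    filter_upwards [h0] with x hx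
    by_cases hd : DifferentiableAt ℝ (hst f) ‖x‖
    swap
    · rw [deriv_zero_of_not_differentiableAt hd]; simp
    set d := deriv (hst f) ‖x‖ with hdd
    have hx' : 0 < ‖x‖ := norm_pos_iff.2 hx
    have hlow : ∀ n, (hst f (‖x‖ + e n * (2 * d)) - hst f ‖x‖) / e n - d ^ 2 ≤ (supc (e n) (fun x => hst f ‖x‖) x - hst f ‖x‖) / e n := by
      intro n
      have h1 := le_ciSup (hs.supc_bdd (he0 n) x) ((e n * (2 * d) / ‖x‖) • x)
      have h2 : ‖x + (e n * (2 * d) / ‖x‖) • x‖ = |‖x‖ + e n * (2 * d)| := by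
        have : x + (e n * (2 * d) / ‖x‖) • x = (1 + e n * (2 * d) / ‖x‖) • x := by rw [add_smul, one_smul]
        rw [this, norm_smul, Real.norm_eq_abs, ← abs_of_pos hx', ← abs_mul, abs_of_pos hx']
        congr 1
        field_simp
      have h3 : ‖(e n * (2 * d) / ‖x‖) • x‖ ^ 2 / (4 * e n) = e n * d ^ 2 := by
        rw [norm_smul, mul_pow, Real.norm_eq_abs, sq_abs]
        have := he0 n
        field_simp
        ring
      simp only [h2, h3, hst_abs] at h1
      change _ ≤ supc (e n) (fun x => hst f ‖x‖) x at h1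
      have hen := he0 n
      rw [sub_le_iff_le_add, ← sub_le_iff_le_add', ← sub_div]
      rw [div_le_iff₀ hen]
      linarith
    have hlim : Tendsto (fun n => (hst f (‖x‖ + e n * (2 * d)) - hst f ‖x‖) / e n - d ^ 2) atTop (𝓝 (d ^ 2)) := by
      have h1 : HasDerivAt (fun s => hst f (‖x‖ + s * (2 * d))) (d * (2 * d)) 0 := by
        have a1 : HasDerivAt (fun s : ℝ => ‖x‖ + s * (2 * d)) (2 * d) 0 := by
          simpa using ((hasDerivAt_id (0:ℝ)).mul_const (2 * d)).const_add ‖x‖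
        have a2 : HasDerivAt (hst f) d (‖x‖ + 0 * (2 * d)) := by rw [zero_mul, add_zero]; exact hd.hasDerivAt
        exact a2.comp (0:ℝ) a1
      have h2 := h1.tendsto_slope_zero
      have h3 : Tendsto e atTop (𝓝[≠] 0) := tendsto_nhdsWithin_iff.2 ⟨het, Eventually.of_forall fun n => (he0 n).ne'⟩
      have h4 := (h2.comp h3).sub_const (d ^ 2)
      have h5 : d * (2 * d) - d ^ 2 = d ^ 2 := by ring
      rw [h5] at h4
      refine h4.congr fun n => ?_
      simp only [Function.comp, smul_eq_mul, zero_add, zero_mul, add_zero]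
      ring
    have hlim2 := (ENNReal.continuous_ofReal.tendsto _).comp hlim
    rw [← hlim2.liminf_eq]
    refine liminf_le_liminf (Eventually.of_forall fun n => ?_)
    exact ENNReal.ofReal_le_ofReal (hlow n)
  refine left.trans ?_
  have mid : liminf (fun n => ∫⁻ x : E2, ENNReal.ofReal ((supc (e n) (fun x => hst f ‖x‖) x - hst f ‖x‖) / e n)) atTop ≤ 
      limsup (fun n => ∫⁻ x : E2, ENNReal.ofReal ((supc (e n) f x - f x) / e n)) atTop := by
    refine (liminf_le_liminf (Eventually.of_forall fun n => hf.supc_int hL hB (he0 n) (he1 n))).trans liminf_le_limsup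
  refine mid.trans ?_
  refine (limsup_lintegral_le ((Metric.closedBall (0:E2) (R + 2 * √B)).indicator fun _ => ENNReal.ofReal ((L:ℝ) ^ 2)) (hmeas hf) (fun n => Eventually.of_forall fun x => ?_) ?_).trans ?_
  · by_cases hx : x ∈ Metric.closedBall (0:E2) (R + 2 * √B)
    · rw [Set.indicator_of_mem hx]
      apply ENNReal.ofReal_le_ofReal
      rw [div_le_iff₀ (he0 n)]
      have := hf.supc_le (he0 n) x
      linarith
    · rw [Set.indicator_of_notMem hx]
      simp only [Metric.mem_closedBall, dist_zero_right, not_le] at hx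
      show ENNReal.ofReal ((supc (e n) f x - f x) / e n) ≤ 0
      rw [hf.supc_supp (he0 n) (he1 n) hB x hx.le]
      have := hf.nn x
      simp only [zero_sub, nonpos_iff_eq_zero, ENNReal.ofReal_eq_zero]
      exact div_nonpos_of_nonpos_of_nonneg (by linarith) (he0 n).le
  · rw [lintegral_indicator measurableSet_closedBall, setLIntegral_const]
    exact ENNReal.mul_ne_top ENNReal.ofReal_ne_top (isCompact_closedBall _ _).measure_lt_top.ne
  · refine lintegral_mono_ae ?_
    filter_upwards [hg] with x hx
    have hL' : (0:ℝ) < L := hL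
    have key : ∀ κ > g x, limsup (fun n => ENNReal.ofReal ((supc (e n) f x - f x) / e n)) atTop ≤ ENNReal.ofReal (κ ^ 2) := by
      intro κ hκ
      refine limsup_le_of_le (by isBoundedDefault) ?_
      obtain ⟨δ, hδ, hball⟩ := Metric.eventually_nhds_iff.1 (hx κ hκ)
      have hsm : ∀ᶠ n in atTop, e n < δ / (4 * L) := het.eventually (gt_mem_nhds (by positivity))
      filter_upwards [hsm] with n hn
      apply ENNReal.ofReal_le_ofReal
      have hen := he0 n
      rw [div_le_iff₀ hen, sub_le_iff_le_add]
      refine ciSup_le fun z => ?_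
      by_cases hz : ‖z‖ < δ
      · have h1 := @hball (x + z) (by simpa using hz)
        rw [add_sub_cancel_left] at h1
        have h2 : κ * ‖z‖ - ‖z‖ ^ 2 / (4 * e n) ≤ κ ^ 2 * e n := by
          have : κ ^ 2 * e n - (κ * ‖z‖ - ‖z‖ ^ 2 / (4 * e n)) = (‖z‖ - 2 * e n * κ) ^ 2 / (4 * e n) := by
            field_simp; ring
          have h3 : 0 ≤ (‖z‖ - 2 * e n * κ) ^ 2 / (4 * e n) := by positivity
          linarith
        linarith
      · push Not at hz
        have h1 := hf.lip.dist_le_mul (x + z) x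
        rw [dist_self_add_left, Real.dist_eq] at h1
        have h1 := (abs_le.1 h1).2
        have h2 : L * ‖z‖ ≤ ‖z‖ ^ 2 / (4 * e n) := by
          rw [le_div_iff₀ (by positivity)]
          rw [lt_div_iff₀ (by positivity)] at hn
          nlinarith [norm_nonneg z]
        have h3 : 0 ≤ κ ^ 2 * e n := by positivity
        linarith
    have hcont : Tendsto (fun κ : ℝ => ENNReal.ofReal (κ ^ 2)) (𝓝[>] (g x)) (𝓝 (ENNReal.ofReal (g x ^ 2))) := by
      have : Continuous fun κ : ℝ => ENNReal.ofReal (κ ^ 2) := ENNReal.continuous_ofReal.comp (continuous_pow 2)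
      exact (this.tendsto _).mono_left nhdsWithin_le_nhds
    exact ge_of_tendsto hcont (eventually_nhdsWithin_of_forall fun κ hκ => key κ hκ)

end
end

noncomputable section
open MeasureTheory Real Filter
open scoped Pointwise ENNReal NNReal Topology
set_option linter.all false
set_option linter.deprecated false

/-- positive radial solutions of the profile equation -/
structure Sol (u u1 : ℝ → ℝ) : Prop where
  pos : ∀ r, 0 < r → 0 < u r
  d1 : ∀ r, 0 < r → HasDerivAt u (u1 r) r
  d2 : ∀ r, 0 < r → HasDerivAt u1 (u r - u r ^ 3 - u1 r / r) r
  lim0 : ∃ u0, 0 < u0 ∧ Tendsto u (𝓝[>] 0) (𝓝 u0)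
  lim1 : Tendsto u1 (𝓝[>] 0) (𝓝 0)
  seq : ∀ ε > 0, ∀ R : ℝ, ∃ r > R, u r < ε ∧ |u1 r| < ε

/-- monotonicity tools on Ioi -/
lemma anti_of_deriv_nonpos {f f' : ℝ → ℝ} {a : ℝ} (hd : ∀ r, a < r → HasDerivAt f (f' r) r)
    (hn : ∀ r, a < r → f' r ≤ 0) : AntitoneOn f (Set.Ioi a) := by
  apply antitoneOn_of_deriv_nonpos (convex_Ioi a)
  · exact fun r hr => (hd r hr).continuousAt.continuousWithinAt
  · rw [interior_Ioi]; exact fun r hr => (hd r hr).differentiableAt.differentiableWithinAt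
  · rw [interior_Ioi]; intro r hr; rw [(hd r hr).deriv]; exact hn r hr

lemma strictAnti_of_derivneg {f f' : ℝ → ℝ} {a : ℝ} (hd : ∀ r, a < r → HasDerivAt f (f' r) r)
    (hn : ∀ r, a < r → f' r < 0) : StrictAntiOn f (Set.Ioi a) := by
  apply strictAntiOn_of_deriv_neg (convex_Ioi a)
  · exact fun r hr => (hd r hr).continuousAt.continuousWithinAt
  · rw [interior_Ioi]; intro r hr; rw [(hd r hr).deriv]; exact hn r hr

namespace Sol
variable {u u1 : ℝ → ℝ}

lemma energy_nonneg (h : Sol u u1) {r : ℝ} (hr : 0 < r) : 0 ≤ u1 r ^ 2 / 2 - u r ^ 2 / 2 + u r ^ 4 / 4 := by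
  have hd : ∀ r, 0 < r → HasDerivAt (fun r => u1 r ^ 2 / 2 - u r ^ 2 / 2 + u r ^ 4 / 4) (- u1 r ^ 2 / r) r := by
    intro r hr
    have h1 := h.d1 r hr
    have h2 := h.d2 r hr
    refine ((((h2.pow 2).div_const 2).sub ((h1.pow 2).div_const 2)).add ((h1.pow 4).div_const 4)).congr_deriv ?_
    simp only [Nat.cast_ofNat]
    field_simp; ring
  have ha := anti_of_deriv_nonpos hd (fun r hr => by
    rw [neg_div]; have : 0 ≤ u1 r ^ 2 / r := by positivity
    linarith)
  by_contra hc
  push Not at hc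
  set e := u1 r ^ 2 / 2 - u r ^ 2 / 2 + u r ^ 4 / 4 with he
  obtain ⟨s, hs, hs1, hs2⟩ := h.seq (min 1 (-e)) (by simp; linarith) r
  have := ha hr (hr.trans hs) hs.le
  simp only at this
  rw [← he] at this
  have hu := h.pos s (hr.trans hs)
  have h3 : u s ^ 2 < -e := by
    have : u s < 1 := lt_of_lt_of_le hs1 (min_le_left _ _)
    have : u s < -e := lt_of_lt_of_le hs1 (min_le_right _ _)
    nlinarith
  have : 0 ≤ u s ^ 4 := by positivity
  have : 0 ≤ u1 s ^ 2 := by positivity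
  linarith

lemma ne_zero (h : Sol u u1) {r : ℝ} (hr : 0 < r) (hu : u r < 1) : u1 r ≠ 0 := by
  intro h0
  have := h.energy_nonneg hr
  have hp := h.pos r hr
  rw [h0] at this
  have : u r ^ 2 < 1 := by nlinarith
  nlinarith [sq_pos_of_pos hp]

lemma contOn (h : Sol u u1) : ContinuousOn u (Set.Ioi 0) := fun r hr => (h.d1 r hr).continuousAt.continuousWithinAt
lemma contOn1 (h : Sol u u1) : ContinuousOn u1 (Set.Ioi 0) := fun r hr => (h.d2 r hr).continuousAt.continuousWithinAt

lemma eventually_dec (h : Sol u u1) : ∃ R > 0, ∀ r, R ≤ r → u r < 1 ∧ u1 r < 0 := by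
  obtain ⟨a, ha, ha1, -⟩ := h.seq 1 one_pos 0
  obtain ⟨b, hb, hb1, -⟩ := h.seq (u a) (h.pos a ha) a
  have hb0 : 0 < b := lt_trans ha hb
  have key : ∀ r, b < r → u r < u b := by
    intro r hr
    by_contra hc
    push Not at hc
    obtain ⟨c, hc1, hc2⟩ := isCompact_Icc.exists_isMinOn (s := Set.Icc a r) ⟨b, hb.le, hr.le⟩
      (h.contOn.mono fun x hx => lt_of_lt_of_le ha hx.1)
    have hmin : u c ≤ u b := hc2 ⟨hb.le, hr.le⟩
    have : ∃ d ∈ Set.Ioo a r, IsMinOn u (Set.Icc a r) d ∧ u d ≤ u b := by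
      by_cases hcr : c = r
      · refine ⟨b, ⟨hb, hr⟩, ?_, le_rfl⟩
        intro x hx
        have := hc2 hx
        simp only [Set.mem_setOf_eq] at this ⊢
        rw [hcr] at this; linarith
      · refine ⟨c, ⟨lt_of_le_of_ne hc1.1 ?_, lt_of_le_of_ne hc1.2 hcr⟩, hc2, hmin⟩
        rintro rfl; linarith
    obtain ⟨d, hd, hd2, hd3⟩ := this
    have hl : IsLocalMin u d := hd2.isLocalMin (Icc_mem_nhds hd.1 hd.2)
    have hd0 : 0 < d := lt_trans ha hd.1
    exact h.ne_zero hd0 (by linarith) (hl.hasDerivAt_eq_zero (h.d1 d hd0))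
  have hlt : ∀ r, b ≤ r → u r < 1 := by
    intro r hr
    rcases hr.eq_or_lt with rfl | hr
    · linarith
    · have := key r hr; linarith
  refine ⟨b, hb0, fun r hr => ⟨hlt r hr, ?_⟩⟩
  by_contra hc
  push Not at hc
  -- find a point with negative derivative
  obtain ⟨s, hs1, hs2⟩ := exists_hasDerivAt_eq_slope u u1 (a := b) (b := b + 1) (by linarith)
    (h.contOn.mono fun x hx => lt_of_lt_of_le hb0 hx.1) (fun x hx => h.d1 x (hb0.trans hx.1))
  have hs3 : u1 s < 0 := by
    rw [hs2]
    have := key (b + 1) (by linarith)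
    simp; linarith
  have hpre : IsPreconnected (Set.Ici b) := isPreconnected_Ici
  obtain ⟨z, hz1, hz2⟩ := hpre.intermediate_value (a := s) (b := r) hs1.1.le hr
    (h.contOn1.mono fun x hx => lt_of_lt_of_le hb0 hx) ⟨hs3.le, hc⟩
  exact h.ne_zero (lt_of_lt_of_le hb0 hz1) (hlt z hz1) hz2

lemma decay (h : Sol u u1) : ∃ A > 0, ∃ R > 0, ∀ r, R ≤ r → u r ≤ A * exp (-(r / 2)) ∧ |u1 r| ≤ A * exp (-(r/2)) ∧ u1 r < 0 := by
  obtain ⟨R, hR, hdec⟩ := h.eventually_dec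
  have h1 : ∀ r, R ≤ r → u1 r ≤ - u r / 2 := by
    intro r hr
    obtain ⟨a1, a2⟩ := hdec r hr
    have hp := h.pos r (by linarith)
    have he := h.energy_nonneg (r := r) (by linarith)
    by_contra hc
    push Not at hc
    have : u1 r ^ 2 < u r ^ 2 / 4 := by nlinarith
    have : u r ^ 4 ≤ u r ^ 2 := by
      have : u r ^ 2 ≤ 1 := by nlinarith
      nlinarith
    nlinarith [sq_pos_of_pos hp]
  have hanti : AntitoneOn (fun r => u r * exp (r / 2)) (Set.Ici R) := by
    apply antitoneOn_of_hasDerivWithinAt_nonpos (f' := fun r => u1 r * exp (r / 2) + u r * (exp (r/2) * (1/2))) (convex_Ici R)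
    · intro r hr
      exact (((h.d1 r (lt_of_lt_of_le hR hr)).continuousAt).mul (by fun_prop)).continuousWithinAt
    · rw [interior_Ici]
      intro r hr
      have : HasDerivAt (fun r:ℝ => exp (r/2)) (exp (r/2) * (1/2)) r := ((hasDerivAt_id r).div_const 2).exp
      exact ((h.d1 r (hR.trans hr)).mul this).hasDerivWithinAt
    · rw [interior_Ici]
      intro r hr
      have := h1 r (le_of_lt hr)
      have he := exp_pos (r/2)
      nlinarith
  have hu : ∀ r, R ≤ r → u r ≤ (u R * exp (R/2)) * exp (-(r/2)) := by
    intro r hr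
    have := hanti (Set.mem_Ici.2 le_rfl) (Set.mem_Ici.2 hr) hr
    simp only at this
    rw [exp_neg]
    rw [← div_eq_mul_inv, le_div_iff₀ (exp_pos _)]
    exact this
  have hmono : MonotoneOn (fun r => r * u1 r) (Set.Ici R) := by
    apply monotoneOn_of_hasDerivWithinAt_nonneg (f' := fun r => 1 * u1 r + r * (u r - u r ^ 3 - u1 r / r)) (convex_Ici R)
    · intro r hr
      exact (continuousAt_id.mul (h.d2 r (lt_of_lt_of_le hR hr)).continuousAt).continuousWithinAt
    · rw [interior_Ici]
      intro r hr
      exact ((hasDerivAt_id r).mul (h.d2 r (hR.trans hr))).hasDerivWithinAt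
    · rw [interior_Ici]
      intro r hr
      have hr0 : 0 < r := hR.trans hr
      obtain ⟨a1, a2⟩ := hdec r (le_of_lt hr)
      have hp := h.pos r (by linarith)
      have : 1 * u1 r + r * (u r - u r ^ 3 - u1 r / r) = r * (u r * (1 - u r ^ 2)) := by field_simp; ring
      rw [this]
      have : 0 ≤ 1 - u r ^ 2 := by nlinarith
      positivity
  have huR : 0 < u R := h.pos R hR
  refine ⟨u R * exp (R/2) * exp (1/2), by positivity, R + 1, by linarith, fun r hr => ⟨?_, ?_, (hdec r (by linarith)).2⟩⟩
  · refine (hu r (by linarith)).trans ?_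
    have : 1 ≤ exp (1/2) := by rw [Real.one_le_exp_iff]; norm_num
    have : u R * exp (R/2) * 1 ≤ u R * exp (R/2) * exp (1/2) := by gcongr
    rw [mul_one] at this
    gcongr
  · have hu' := hu (r - 1) (by linarith)
    have he : u R * exp (R/2) * exp (-((r-1)/2)) = u R * exp (R/2) * exp (1/2) * exp (-(r/2)) := by
      rw [mul_assoc _ (exp (1/2)), ← exp_add]; congr 2; ring
    rw [he] at hu'
    obtain ⟨s, hs1, hs2⟩ := exists_hasDerivAt_eq_slope u u1 (a := r - 1) (b := r) (by linarith)
      (h.contOn.mono fun x hx => by have := hx.1; simp; linarith) (fun x hx => h.d1 x (by have := hx.1; linarith))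
    have e2 : u1 s = u r - u (r - 1) := by rw [hs2]; ring
    have m := hmono (a := s) (b := r) (by have := hs1.1; simp; linarith) (by simp; linarith) hs1.2.le
    simp only at m
    obtain ⟨b1, b2⟩ := hdec r (by linarith)
    have hp := h.pos r (by linarith)
    obtain ⟨b3, b4⟩ := hdec s (by linarith [hs1.1])
    rw [abs_of_neg b2]
    refine le_trans ?_ hu'
    have hr0 : 0 < r := by linarith
    have : r * (-u1 r) ≤ r * u (r-1) := by
      have hs0 : 0 < s := by linarith [hs1.1]
      have : r * (-u1 r) ≤ s * (-u1 s) := by linarith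
      have : s * (-u1 s) ≤ r * (-u1 s) := by
        have := hs1.2; nlinarith
      have : r * (-u1 s) ≤ r * u (r-1) := by
        apply mul_le_mul_of_nonneg_left _ hr0.le
        linarith
      linarith
    exact le_of_mul_le_mul_left this hr0

end Sol
end

noncomputable section
open MeasureTheory Real Filter
open scoped Pointwise ENNReal NNReal Topology
set_option linter.all false
set_option linter.deprecated false

lemma neg_of_deriv {f f' : ℝ → ℝ} {b : ℝ} (hd : ∀ r, 0 < r → HasDerivAt f (f' r) r)
    (hn : ∀ r, 0 < r → r < b → f' r < 0) (h0 : Tendsto f (𝓝[>] 0) (𝓝 0)) {r : ℝ} (hr : 0 < r) (hrb : r ≤ b) : f r < 0 := by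
  have hanti : StrictAntiOn f (Set.Ioc 0 b) := by
    apply strictAntiOn_of_deriv_neg (convex_Ioc 0 b)
    · exact fun r hr => (hd r hr.1).continuousAt.continuousWithinAt
    · rw [interior_Ioc]; intro r hr; rw [(hd r hr.1).deriv]; exact hn r hr.1 hr.2
  have h1 : f r < f (r/2) := hanti ⟨by linarith, by linarith⟩ ⟨hr, hrb⟩ (by linarith)
  have h2 : f (r/2) ≤ 0 := by
    refine ge_of_tendsto h0 ?_
    have : Set.Ioo (0:ℝ) (r/2) ∈ 𝓝[>] (0:ℝ) := Ioo_mem_nhdsGT (by linarith)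
    filter_upwards [this] with s hs
    exact (hanti ⟨hs.1, by linarith [hs.2]⟩ ⟨by linarith, by linarith⟩ hs.2).le
  linarith

/-- cube root -/
def kk (r : ℝ) : ℝ := r ^ (1/3 : ℝ)

lemma kk_pos {r : ℝ} (hr : 0 < r) : 0 < kk r := Real.rpow_pos_of_pos hr _
lemma kk_cube {r : ℝ} (hr : 0 < r) : kk r ^ 3 = r := by
  unfold kk; rw [← Real.rpow_natCast, ← Real.rpow_mul hr.le]; norm_num
lemma kk_deriv {r : ℝ} (hr : 0 < r) : HasDerivAt kk (1 / (3 * kk r ^ 2)) r := by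
  have := Real.hasDerivAt_rpow_const (x := r) (p := 1/3) (Or.inl hr.ne')
  refine this.congr_deriv ?_
  rw [Real.rpow_sub_one hr.ne']
  change 1 / 3 * (kk r / r) = _
  have hk := kk_pos hr
  have := kk_cube hr
  rw [div_mul_div_comm, div_eq_div_iff (by positivity) (by positivity)]
  linear_combination 3 * this
lemma kk_zero : Tendsto kk (𝓝[>] 0) (𝓝 0) := by
  have : Continuous kk := Real.continuous_rpow_const (by norm_num)
  have h := this.tendsto 0
  have e : kk 0 = 0 := by unfold kk; rw [Real.zero_rpow]; norm_num
  rw [e] at h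
  exact h.mono_left nhdsWithin_le_nhds
lemma kk_le {r : ℝ} (hr : 1 ≤ r) : kk r ≤ r := by
  have := Real.rpow_le_rpow_of_exponent_le hr (by norm_num : (1/3:ℝ) ≤ 1)
  rw [Real.rpow_one] at this; exact this

def JJ (u u1 : ℝ → ℝ) (r : ℝ) : ℝ := kk r ^ 4 * u1 r ^ 2 / 2 + kk r / 3 * u r * u1 r + u r ^ 2 / (9 * kk r ^ 2)
   - kk r ^ 4 * u r ^ 2 / 2 + kk r ^ 4 * u r ^ 4 / 4

namespace Sol
variable {u u1 v v1 : ℝ → ℝ}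

lemma J_deriv (h : Sol u u1) {r : ℝ} (hr : 0 < r) : HasDerivAt (JJ u u1) (-(kk r / 3 + 2 / (27 * kk r ^ 5)) * u r ^ 2) r := by
  have h1 := h.d1 r hr
  have h2 := h.d2 r hr
  have hk := kk_deriv hr
  have hk0 := kk_pos hr
  have hk3 := kk_cube hr
  have H := (((((((hk.pow 4).mul (h2.pow 2)).div_const 2).add (((hk.div_const 3).mul h1).mul h2)).add
    ((h1.pow 2).div ((hk.pow 2).const_mul 9) (by simp only [Pi.pow_apply]; positivity))).sub (((hk.pow 4).mul (h1.pow 2)).div_const 2)).add (((hk.pow 4).mul (h1.pow 4)).div_const 4))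
  refine H.congr_deriv ?_
  simp only [Nat.cast_ofNat, Pi.pow_apply, Pi.mul_apply]
  generalize kk r = k at *
  subst hk3
  field_simp
  ring

lemma tend_aux (h : Sol u u1) : Tendsto (fun r => kk r ^ 2 * u r) atTop (𝓝 0) ∧ Tendsto (fun r => kk r ^ 2 * u1 r) atTop (𝓝 0)
    ∧ Tendsto u atTop (𝓝 0) ∧ Tendsto u1 atTop (𝓝 0) ∧ Tendsto (fun r => r ^ 2 * u r) atTop (𝓝 0) ∧ Tendsto (fun r => r ^ 2 * u1 r) atTop (𝓝 0) := by
  obtain ⟨A, hA, R, hR, hd⟩ := h.decay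
  have h0 : Tendsto (fun r : ℝ => A * (r ^ 2 * exp (-(1/2) * r))) atTop (𝓝 0) := by
    have := (Real.tendsto_pow_mul_exp_neg_atTop_nhds_zero 2).comp (tendsto_id.const_mul_atTop (by norm_num : (0:ℝ) < 1/2))
    have := this.const_mul (4 * A)
    rw [mul_zero] at this
    refine this.congr fun r => ?_
    simp only [Function.comp, id]
    ring_nf
  have key : ∀ (m f : ℝ → ℝ), (∀ r, 1 ≤ r → 0 ≤ m r ∧ m r ≤ r ^ 2) → (∀ r, R ≤ r → |f r| ≤ A * exp (-(r/2))) → Tendsto (fun r => m r * f r) atTop (𝓝 0) := by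
    intro m f hm hf
    apply squeeze_zero_norm' _ h0
    filter_upwards [eventually_ge_atTop R, eventually_ge_atTop 1] with r hr1 hr2
    rw [norm_mul, Real.norm_eq_abs, Real.norm_eq_abs, abs_of_nonneg (hm r hr2).1]
    have := hf r hr1
    have e : A * (r ^ 2 * exp (-(1/2) * r)) = r ^ 2 * (A * exp (-(r/2))) := by ring_nf
    rw [e]
    have := (hm r hr2).2
    gcongr
  have hu : ∀ r, R ≤ r → |u r| ≤ A * exp (-(r/2)) := fun r hr => by
    rw [abs_of_pos (h.pos r (by linarith))]; exact (hd r hr).1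
  have hu1 : ∀ r, R ≤ r → |u1 r| ≤ A * exp (-(r/2)) := fun r hr => (hd r hr).2.1
  have m1 : ∀ r:ℝ, 1 ≤ r → 0 ≤ kk r ^ 2 ∧ kk r ^ 2 ≤ r ^ 2 := fun r hr => ⟨by positivity, by
    have := kk_le hr; have := kk_pos (r := r) (by linarith); gcongr⟩
  have m2 : ∀ r:ℝ, 1 ≤ r → (0:ℝ) ≤ 1 ∧ 1 ≤ r ^ 2 := fun r hr => ⟨by positivity, by nlinarith⟩
  have m3 : ∀ r:ℝ, 1 ≤ r → (0:ℝ) ≤ r^2 ∧ r ^ 2 ≤ r ^ 2 := fun r hr => ⟨by positivity, le_rfl⟩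
  refine ⟨key _ _ m1 hu, key _ _ m1 hu1, ?_, ?_, key _ _ m3 hu, key _ _ m3 hu1⟩
  · simpa using key _ _ m2 hu
  · simpa using key _ _ m2 hu1

lemma J_inf (h : Sol u u1) : Tendsto (JJ u u1) atTop (𝓝 0) := by
  obtain ⟨t1, t2, t3, t4, -⟩ := h.tend_aux
  have t5 : Tendsto (fun r : ℝ => r⁻¹) atTop (𝓝 0) := tendsto_inv_atTop_zero
  have H := ((((t2.pow 2).const_mul (1/2)).add (((t1.mul t2).mul t5).const_mul (1/3))).add (((t1.pow 2).mul (t5.pow 2)).const_mul (1/9))).add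
    (((t1.pow 2).const_mul (-1/2)).add (((t1.pow 2).mul (t3.pow 2)).const_mul (1/4)))
  simp only [mul_zero, add_zero, ne_eq, OfNat.ofNat_ne_zero, not_false_eq_true, zero_pow] at H
  refine H.congr' ?_
  filter_upwards [eventually_gt_atTop 0] with r hr
  unfold JJ
  have hk0 := kk_pos hr
  have hk3 := kk_cube hr
  generalize kk r = k at *
  generalize u r = a at *
  generalize u1 r = b at *
  subst hk3
  field_simp
  ring

lemma J_pos (h : Sol u u1) {r : ℝ} (hr : 0 < r) : 0 < JJ u u1 r := by
  have hs : StrictAntiOn (JJ u u1) (Set.Ioi 0) := strictAnti_of_derivneg (fun r hr => h.J_deriv hr) (fun r hr => by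
    have := kk_pos hr
    have := h.pos r hr
    have : 0 < (kk r / 3 + 2 / (27 * kk r ^ 5)) * u r ^ 2 := by positivity
    linarith)
  have h1 : JJ u u1 (r + 1) < JJ u u1 r := hs hr (by simp; linarith) (by linarith)
  have h2 : 0 ≤ JJ u u1 (r+1) := by
    refine le_of_tendsto h.J_inf ?_
    filter_upwards [eventually_gt_atTop (r+1)] with s hs'
    exact (hs (by simp; linarith) (by simp; linarith) hs').le
  linarith

/-- the Wronskian-like quantity -/
lemma N_deriv (h : Sol u u1) (k : Sol v v1) {r : ℝ} (hr : 0 < r) :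
    HasDerivAt (fun r => r * (v1 r * u r - v r * u1 r)) (r * (u r * v r * (u r ^ 2 - v r ^ 2))) r := by
  have H := (hasDerivAt_id r).mul (((k.d2 r hr).mul (h.d1 r hr)).sub ((k.d1 r hr).mul (h.d2 r hr)))
  refine H.congr_deriv ?_
  simp only [id, Pi.mul_apply, Pi.sub_apply]
  field_simp
  ring

lemma w_deriv (h : Sol u u1) (k : Sol v v1) {r : ℝ} (hr : 0 < r) :
    HasDerivAt (fun r => v r / u r) ((v1 r * u r - v r * u1 r) / u r ^ 2) r :=
  (k.d1 r hr).div (h.d1 r hr) (h.pos r hr).ne'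

lemma X_deriv (h : Sol u u1) (k : Sol v v1) {r : ℝ} (hr : 0 < r) :
    HasDerivAt (fun r => (v r / u r) ^ 2 * JJ u u1 r - JJ v v1 r) 
      (2 * (v r / u r) * ((v1 r * u r - v r * u1 r) / u r ^ 2) * JJ u u1 r) r := by
  have H := (((h.w_deriv k hr).pow 2).mul (h.J_deriv hr)).sub (k.J_deriv hr)
  refine H.congr_deriv ?_
  simp only [Pi.pow_apply, Nat.cast_ofNat, show (2 - 1 : ℕ) = 1 from rfl, pow_one]
  have := h.pos r hr
  have := kk_pos hr
  field_simp
  ring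

lemma X_eq (h : Sol u u1) {r : ℝ} (hr : 0 < r) :
    (v r / u r) ^ 2 * JJ u u1 r - JJ v v1 r = - (kk r ^ 4 / 2) * ((v1 r * u r - v r * u1 r) / u r ^ 2) ^ 2 * u r ^ 2
      - kk r ^ 4 * (v r / u r) * ((v1 r * u r - v r * u1 r) / u r ^ 2) * u r * u1 r 
      - kk r / 3 * (v r / u r) * ((v1 r * u r - v r * u1 r) / u r ^ 2) * u r ^ 2 
      + kk r ^ 4 / 4 * (v r / u r) ^ 2 * u r ^ 4 * (1 - (v r / u r) ^ 2) := by
  unfold JJ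
  have := h.pos r hr
  have := kk_pos hr
  field_simp
  ring

lemma not_lt (h : Sol u u1) (k : Sol v v1) {u0 v0 : ℝ} (hu0 : 0 < u0) (hu : Tendsto u (𝓝[>] 0) (𝓝 u0)) 
    (hv : Tendsto v (𝓝[>] 0) (𝓝 v0)) (hlt : u0 < v0) : False := by
  have tid : Tendsto (fun r:ℝ => r) (𝓝[>] 0) (𝓝 0) := tendsto_id.mono_left nhdsWithin_le_nhds
  have tD := (k.lim1.mul hu).sub (hv.mul h.lim1)
  simp only [zero_mul, mul_zero, sub_zero] at tD
  have tN : Tendsto (fun r => r * (v1 r * u r - v r * u1 r)) (𝓝[>] 0) (𝓝 0) := by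
    simpa using tid.mul tD
  have tw := hv.div hu hu0.ne'
  have tw' := tD.div (hu.pow 2) (by positivity)
  rw [zero_div] at tw'
  have tX : Tendsto (fun r => (v r / u r) ^ 2 * JJ u u1 r - JJ v v1 r) (𝓝[>] 0) (𝓝 0) := by
    have H := ((((((kk_zero.pow 4).div_const 2).neg.mul (tw'.pow 2)).mul (hu.pow 2)).sub (((((kk_zero.pow 4).mul tw).mul tw').mul hu).mul h.lim1)).sub
      ((((kk_zero.div_const 3).mul tw).mul tw').mul (hu.pow 2))).add (((((kk_zero.pow 4).div_const 4).mul (tw.pow 2)).mul (hu.pow 4)).mul ((tw.pow 2).const_sub 1))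
    simp only [ne_eq, OfNat.ofNat_ne_zero, not_false_eq_true, zero_pow, zero_div, neg_zero, mul_zero, zero_mul, sub_zero, add_zero] at H
    refine H.congr' ?_
    filter_upwards [self_mem_nhdsWithin] with r hr
    rw [h.X_eq hr]
    simp only [Pi.div_apply, Pi.pow_apply]
  set N := fun r => r * (v1 r * u r - v r * u1 r) with hN
  have hNd : ∀ r, 0 < r → HasDerivAt N (r * (u r * v r * (u r ^ 2 - v r ^ 2))) r := fun r hr => h.N_deriv k hr
  have hND : ∀ r, 0 < r → (N r < 0 ↔ v1 r * u r - v r * u1 r < 0) := by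
    intro r hr
    simp only [hN]
    constructor
    · intro h1; by_contra hc; push Not at hc
      have := mul_nonneg hr.le hc
      linarith
    · intro h1; nlinarith
  have hNd' : ∀ r, 0 < r → u r < v r → r * (u r * v r * (u r ^ 2 - v r ^ 2)) < 0 := by
    intro r hr huv
    have := h.pos r hr
    have := k.pos r hr
    have h1 : u r ^ 2 - v r ^ 2 < 0 := by nlinarith
    have h2 : 0 < r * (u r * v r) := by positivity
    nlinarith
  -- near zero
  obtain ⟨δ, hδ, hnear⟩ : ∃ δ > 0, ∀ r, 0 < r → r ≤ δ → N r < 0 := by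
    have : ∀ᶠ r in 𝓝[>] (0:ℝ), u r < v r := hu.eventually_lt hv hlt
    rw [eventually_nhdsWithin_iff, Metric.eventually_nhds_iff] at this
    obtain ⟨δ, hδ, hh⟩ := this
    refine ⟨δ, hδ, fun r hr hrd => ?_⟩
    refine neg_of_deriv hNd (fun s hs hs2 => hNd' s hs (hh ?_ hs)) tN hr hrd
    rw [Real.dist_eq, sub_zero, abs_of_pos hs]; exact hs2
  have hXneg : ∀ b, (∀ r, 0 < r → r < b → N r < 0) → ∀ r, 0 < r → r ≤ b → (v r / u r) ^ 2 * JJ u u1 r - JJ v v1 r < 0 := by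
    intro b hb r hr hrb
    refine neg_of_deriv (fun r hr => h.X_deriv k hr) (fun s hs hsb => ?_) tX hr hrb
    have h1 := (hND s hs).1 (hb s hs hsb)
    have h2 := h.pos s hs
    have h3 := k.pos s hs
    have h4 := h.J_pos hs
    have h5 : (v1 s * u s - v s * u1 s) / u s ^ 2 < 0 := div_neg_of_neg_of_pos h1 (by positivity)
    have h6 : 0 < 2 * (v s / u s) := by positivity
    exact mul_neg_of_neg_of_pos (mul_neg_of_pos_of_neg h6 h5) h4
  have hall : ∀ r, 0 < r → N r < 0 := by
    by_contra hc
    push Not at hc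
    obtain ⟨r, hr, hNr⟩ := hc
    set S := {s | δ ≤ s ∧ s ≤ r ∧ 0 ≤ N s} with hS
    have hrδ : δ ≤ r := by
      by_contra h'; push Not at h'
      have := hnear r hr h'.le
      linarith
    have hSc : IsCompact S := by
      have : S = Set.Icc δ r ∩ N ⁻¹' (Set.Ici 0) := by ext s; simp [hS, and_assoc]
      rw [this]
      have hc : ContinuousOn N (Set.Icc δ r) := fun s hs => (hNd s (lt_of_lt_of_le hδ hs.1)).continuousAt.continuousWithinAt
      exact isCompact_Icc.of_isClosed_subset (hc.preimage_isClosed_of_isClosed isClosed_Icc isClosed_Ici) Set.inter_subset_left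
    obtain ⟨b, hbS, hbmin⟩ := hSc.exists_isLeast ⟨r, hrδ, le_rfl, hNr⟩
    have hb0 : 0 < b := lt_of_lt_of_le hδ hbS.1
    have hlow : ∀ s, 0 < s → s < b → N s < 0 := by
      intro s hs hsb
      by_contra hcc
      push Not at hcc
      rcases le_or_gt s δ with h1 | h1
      · have := hnear s hs h1; linarith
      · have := hbmin (a := s) ⟨h1.le, hsb.le.trans hbS.2.1, hcc⟩
        linarith
    have hNb : N b = 0 := by
      refine le_antisymm ?_ hbS.2.2
      have hcb : Tendsto N (𝓝[<] b) (𝓝 (N b)) := (hNd b hb0).continuousAt.tendsto.mono_left nhdsWithin_le_nhds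
      refine le_of_tendsto hcb ?_
      filter_upwards [Ioo_mem_nhdsLT hb0] with s hs
      exact (hlow s hs.1 hs.2).le
    have hXb := hXneg b hlow b hb0 le_rfl
    have hDb : v1 b * u b - v b * u1 b = 0 := by
      have : b * (v1 b * u b - v b * u1 b) = 0 := hNb
      rcases mul_eq_zero.1 this with h | h
      · linarith
      · exact h
    rw [h.X_eq hb0, hDb] at hXb
    simp only [zero_div, ne_eq, OfNat.ofNat_ne_zero, not_false_eq_true, zero_pow, mul_zero, zero_mul, sub_zero, zero_add] at hXb
    have hub := h.pos b hb0
    have hvb := k.pos b hb0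
    have hkb := kk_pos hb0
    have hw1 : 1 < v b / u b := by
      by_contra hcc
      push Not at hcc
      have : 0 < v b / u b := by positivity
      have : (0:ℝ) ≤ 1 - (v b / u b) ^ 2 := by nlinarith
      have : 0 ≤ kk b ^ 4 / 4 * (v b / u b) ^ 2 * u b ^ 4 * (1 - (v b / u b) ^ 2) := by positivity
      linarith
    have hwanti : AntitoneOn (fun r => v r / u r) (Set.Ioc 0 b) := by
      apply antitoneOn_of_deriv_nonpos (convex_Ioc 0 b)
      · exact fun r hr => (h.w_deriv k hr.1).continuousAt.continuousWithinAt
      · rw [interior_Ioc]; exact fun r hr => (h.w_deriv k hr.1).differentiableAt.differentiableWithinAt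
      · rw [interior_Ioc]; intro r hr; rw [(h.w_deriv k hr.1).deriv]
        exact div_nonpos_of_nonpos_of_nonneg ((hND r hr.1).1 (hlow r hr.1 hr.2)).le (by positivity)
    have : N b < 0 := by
      refine neg_of_deriv hNd (fun s hs hs2 => hNd' s hs ?_) tN hb0 le_rfl
      have h1 := hwanti ⟨hs, hs2.le⟩ ⟨hb0, le_rfl⟩ hs2.le
      simp only at h1
      have h2 : 1 < v s / u s := by linarith
      exact (one_lt_div (h.pos s hs)).1 h2
    linarith
  -- contradiction at infinity
  have hwanti : AntitoneOn (fun r => v r / u r) (Set.Ioi 0) := by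
    refine anti_of_deriv_nonpos (fun r hr => h.w_deriv k hr) fun r hr => ?_
    exact div_nonpos_of_nonpos_of_nonneg ((hND r hr).1 (hall r hr)).le (by positivity)
  have hX1 := hXneg 1 (fun r hr _ => hall r hr) 1 one_pos le_rfl
  have hXanti : AntitoneOn (fun r => (v r / u r) ^ 2 * JJ u u1 r - JJ v v1 r) (Set.Ioi 0) := by
    refine anti_of_deriv_nonpos (fun r hr => h.X_deriv k hr) fun s hs => ?_
    have h1 := (hND s hs).1 (hall s hs)
    have h2 := h.pos s hs
    have h3 := k.pos s hs
    have h4 := h.J_pos hs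
    have h5 : (v1 s * u s - v s * u1 s) / u s ^ 2 < 0 := div_neg_of_neg_of_pos h1 (by positivity)
    have h6 : 0 < 2 * (v s / u s) := by positivity
    exact (mul_neg_of_neg_of_pos (mul_neg_of_pos_of_neg h6 h5) h4).le
  have tXi : Tendsto (fun r => (v r / u r) ^ 2 * JJ u u1 r - JJ v v1 r) atTop (𝓝 0) := by
    have h1 : Tendsto (fun r => (v r / u r) ^ 2 * JJ u u1 r) atTop (𝓝 0) := by
      have h2 : Tendsto (fun r => (v 1 / u 1) ^ 2 * JJ u u1 r) atTop (𝓝 0) := by simpa using h.J_inf.const_mul ((v 1 / u 1) ^ 2)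
      refine squeeze_zero' ?_ ?_ h2
      · filter_upwards [eventually_gt_atTop 0] with r hr
        have := h.J_pos hr; positivity
      · filter_upwards [eventually_ge_atTop 1] with r hr
        have hr0 : 0 < r := by linarith
        have := h.J_pos hr0
        have h3 := hwanti (Set.mem_Ioi.2 one_pos) (Set.mem_Ioi.2 hr0) hr
        simp only at h3
        have := h.pos r hr0
        have := k.pos r hr0
        gcongr
    simpa using h1.sub k.J_inf
  have : 0 ≤ (v 1 / u 1) ^ 2 * JJ u u1 1 - JJ v v1 1 := by
    refine le_of_tendsto tXi ?_
    filter_upwards [eventually_ge_atTop 1] with r hr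
    exact hXanti (Set.mem_Ioi.2 one_pos) (Set.mem_Ioi.2 (by linarith)) hr
  linarith

lemma bdd (h : Sol u u1) : ∃ B, ∀ r, 0 < r → u r ≤ B := by
  obtain ⟨u0, hu0, hu⟩ := h.lim0
  have : ∀ᶠ r in 𝓝[>] (0:ℝ), u r < u0 + 1 := hu.eventually_lt_const (by linarith)
  rw [eventually_nhdsWithin_iff, Metric.eventually_nhds_iff] at this
  obtain ⟨δ, hδ, hh⟩ := this
  obtain ⟨R, hR, hd⟩ := h.eventually_dec
  obtain ⟨B, hB⟩ := (isCompact_Icc (a := δ) (b := R)).bddAbove_image (f := u) (h.contOn.mono fun x hx => lt_of_lt_of_le hδ hx.1)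
  refine ⟨max (u0 + 1) (max 1 B), fun r hr => ?_⟩
  rcases lt_or_ge r δ with h1 | h1
  · exact (hh (by rw [Real.dist_eq, sub_zero, abs_of_pos hr]; exact h1) hr).le.trans (le_max_left _ _)
  rcases le_or_gt R r with h2 | h2
  · exact (hd r h2).1.le.trans ((le_max_left _ _).trans (le_max_right _ _))
  · exact (hB ⟨r, ⟨h1, h2.le⟩, rfl⟩).trans ((le_max_right _ _).trans (le_max_right _ _))

theorem unique (h : Sol u u1) (k : Sol v v1) : ∀ r, 0 < r → u r = v r ∧ u1 r = v1 r := by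
  obtain ⟨u0, hu0, hu⟩ := h.lim0
  obtain ⟨v0, hv0, hv⟩ := k.lim0
  have e0 : u0 = v0 := by
    rcases lt_trichotomy u0 v0 with hl | hl | hl
    · exact (h.not_lt k hu0 hu hv hl).elim
    · exact hl
    · exact (k.not_lt h hv0 hv hu hl).elim
  subst e0
  obtain ⟨B, hB⟩ := h.bdd
  obtain ⟨B', hB'⟩ := k.bdd
  set K := max B B' with hK
  have hKu : ∀ r, 0 < r → u r ≤ K := fun r hr => (hB r hr).trans (le_max_left _ _)
  have hKv : ∀ r, 0 < r → v r ≤ K := fun r hr => (hB' r hr).trans (le_max_right _ _)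
  set M := 2 + 3 * K ^ 2 with hM
  set ψ := fun r => (v r - u r) ^ 2 + (v1 r - u1 r) ^ 2 with hψ
  have hd : ∀ r, 0 < r → HasDerivAt (fun r => ψ r * exp (- M * r)) 
      ((2 * (v r - u r) * (v1 r - u1 r) + 2 * (v1 r - u1 r) * ((v r - v r ^ 3 - v1 r / r) - (u r - u r ^ 3 - u1 r / r))) * exp (-M * r)
        + ψ r * (exp (-M * r) * (-M))) r := by
    intro r hr
    have h1 := (((k.d1 r hr).sub (h.d1 r hr)).pow 2).add (((k.d2 r hr).sub (h.d2 r hr)).pow 2)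
    have h2 : HasDerivAt (fun r => exp (-M * r)) (exp (-M * r) * (-M)) r := by
      have := ((hasDerivAt_id r).const_mul (-M)).exp
      simpa using this
    refine (h1.mul h2).congr_deriv ?_
    simp only [Pi.sub_apply, Pi.pow_apply, Pi.add_apply, Nat.cast_ofNat, hψ]
    ring
  have hanti := anti_of_deriv_nonpos hd (fun r hr => by
    have hpu := h.pos r hr
    have hpv := k.pos r hr
    have a1 := hKu r hr
    have a2 := hKv r hr
    have he := exp_pos (-M * r)
    have e1 : ∀ X : ℝ, X * exp (-M * r) + ψ r * (exp (-M * r) * (-M)) = (X - M * ψ r) * exp (-M * r) := fun X => by ring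
    rw [e1]
    apply mul_nonpos_of_nonpos_of_nonneg _ he.le
    set d := v r - u r with hd0
    set d1 := v1 r - u1 r with hd1
    set S := v r ^ 2 + v r * u r + u r ^ 2 with hS
    have hS0 : 0 ≤ S := by positivity
    have hS1 : S ≤ 3 * K ^ 2 := by
      have : v r ^ 2 ≤ K ^ 2 := by gcongr
      have : u r ^ 2 ≤ K ^ 2 := by gcongr
      have : v r * u r ≤ K * K := by gcongr; linarith
      nlinarith
    have e2 : 2 * d * d1 + 2 * d1 * ((v r - v r ^ 3 - v1 r / r) - (u r - u r ^ 3 - u1 r / r)) = 2 * (d * d1) * (2 - S) - 2 * (d1 ^ 2 / r) := by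
      rw [hd0, hd1, hS]; field_simp; ring
    have e3 : ψ r = d ^ 2 + d1 ^ 2 := rfl
    rw [e2, e3]
    have p1 : 0 ≤ d1 ^ 2 / r := by positivity
    have q1 : 2 * (d * d1) ≤ d ^ 2 + d1 ^ 2 := by nlinarith [sq_nonneg (d - d1)]
    have q2 : -(2 * (d * d1)) ≤ d ^ 2 + d1 ^ 2 := by nlinarith [sq_nonneg (d + d1)]
    have p2 : 2 * (d * d1) * (2 - S) ≤ M * (d ^ 2 + d1 ^ 2) := by
      have : 2 * (d * d1) * (2 - S) = 2 * (2 * (d * d1)) + S * (-(2 * (d * d1))) := by ring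
      have : S * (-(2 * (d * d1))) ≤ S * (d ^ 2 + d1 ^ 2) := by gcongr
      have : S * (d ^ 2 + d1 ^ 2) ≤ (3 * K ^ 2) * (d ^ 2 + d1 ^ 2) := by gcongr
      rw [hM]; nlinarith
    linarith)
  have tψ : Tendsto (fun r => ψ r * exp (- M * r)) (𝓝[>] 0) (𝓝 0) := by
    have h1 : Tendsto ψ (𝓝[>] 0) (𝓝 0) := by
      have := ((hv.sub hu).pow 2).add ((k.lim1.sub h.lim1).pow 2)
      simpa using this
    have h2 : Tendsto (fun r : ℝ => exp (-M * r)) (𝓝[>] 0) (𝓝 1) := by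
      have : Continuous (fun r : ℝ => exp (-M * r)) := by fun_prop
      have := (this.tendsto 0).mono_left (nhdsWithin_le_nhds (s := Set.Ioi 0))
      simpa using this
    simpa using h1.mul h2
  intro r hr
  have h1 : ψ r * exp (-M * r) ≤ 0 := by
    refine ge_of_tendsto tψ ?_
    filter_upwards [Ioo_mem_nhdsGT hr] with s hs
    exact hanti (Set.mem_Ioi.2 hs.1) (Set.mem_Ioi.2 hr) hs.2.le
  have h2 : ψ r ≤ 0 := by
    by_contra hc; push Not at hc
    have := exp_pos (-M * r)
    nlinarith
  have h3 : ψ r = (v r - u r) ^ 2 + (v1 r - u1 r) ^ 2 := rfl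
  rw [h3] at h2
  have h4 : v r - u r = 0 := by
    have : (v r - u r) ^ 2 = 0 := by nlinarith [sq_nonneg (v r - u r), sq_nonneg (v1 r - u1 r)]
    exact pow_eq_zero_iff (two_ne_zero) |>.1 this
  have h5 : v1 r - u1 r = 0 := by
    have : (v1 r - u1 r) ^ 2 = 0 := by nlinarith [sq_nonneg (v r - u r), sq_nonneg (v1 r - u1 r)]
    exact pow_eq_zero_iff (two_ne_zero) |>.1 this
  constructor <;> linarith

end Sol
end

noncomputable section
open MeasureTheory Real Filter
open scoped Pointwise ENNReal NNReal Topology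
set_option linter.all false
set_option linter.deprecated false

lemma radial_integral (f : ℝ → ℝ) : ∫ x : E2, f ‖x‖ = 2 * π * ∫ r in Set.Ioi (0:ℝ), r * f r := by
  rw [integral_fun_norm_addHaar]
  have e : (volume : Measure E2).real (Metric.ball 0 1) = π := by
    rw [Measure.real, EuclideanSpace.volume_ball_fin_two]
    simp [pi_pos.le]
  rw [e]
  simp [mul_assoc]

lemma radial_integrable (f : ℝ → ℝ) : Integrable (fun x : E2 => f ‖x‖) ↔ IntegrableOn (fun r => r * f r) (Set.Ioi 0) := by
  rw [integrable_fun_norm_addHaar]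
  simp

namespace Sol
variable {u u1 : ℝ → ℝ}

lemma pohozaev (h : Sol u u1) (iM : IntegrableOn (fun r => r * u r ^ 2) (Set.Ioi 0)) (iG : IntegrableOn (fun r => r * u1 r ^ 2) (Set.Ioi 0))
    (iF : IntegrableOn (fun r => r * u r ^ 4) (Set.Ioi 0)) :
    (∫ r in Set.Ioi (0:ℝ), r * u r ^ 4) = 2 * (∫ r in Set.Ioi (0:ℝ), r * u r ^ 2) ∧
    (∫ r in Set.Ioi (0:ℝ), r * u1 r ^ 2) = (∫ r in Set.Ioi (0:ℝ), r * u r ^ 2) := by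
  obtain ⟨u0, hu0, hu⟩ := h.lim0
  have tid : Tendsto (fun r:ℝ => r) (𝓝[>] 0) (𝓝 0) := tendsto_id.mono_left nhdsWithin_le_nhds
  obtain ⟨-, -, t3, t4, t5, t6⟩ := h.tend_aux
  have tinv : Tendsto (fun r : ℝ => r⁻¹) atTop (𝓝 0) := tendsto_inv_atTop_zero
  have i1 : (∫ r in Set.Ioi (0:ℝ), (r * u1 r ^ 2 + r * u r ^ 2 - r * u r ^ 4)) = 0 - (0 * u 0 * u1 0) := by
    apply integral_Ioi_of_hasDerivAt_of_tendsto (f := fun r => r * u r * u1 r)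
    · rw [← continuousWithinAt_Ioi_iff_Ici]
      unfold ContinuousWithinAt
      have := (tid.mul hu).mul h.lim1
      simpa using this
    · intro r hr
      have hr : 0 < r := hr
      refine (((hasDerivAt_id r).mul (h.d1 r hr)).mul (h.d2 r hr)).congr_deriv ?_
      simp only [id, Pi.mul_apply]
      field_simp; ring
    · exact (iG.add iM).sub iF
    · have := (t5.mul t4).mul tinv
      simp only [mul_zero] at this
      refine this.congr' ?_
      filter_upwards [eventually_gt_atTop 0] with r hr
      field_simp
  have i2 : (∫ r in Set.Ioi (0:ℝ), ((1/2) * (r * u r ^ 4) - r * u r ^ 2)) = 0 - (0 ^ 2 * u1 0 ^ 2 / 2 - 0 ^ 2 * u 0 ^ 2 / 2 + 0 ^ 2 * u 0 ^ 4 / 4) := by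
    apply integral_Ioi_of_hasDerivAt_of_tendsto (f := fun r => r ^ 2 * u1 r ^ 2 / 2 - r ^ 2 * u r ^ 2 / 2 + r ^ 2 * u r ^ 4 / 4)
    · rw [← continuousWithinAt_Ioi_iff_Ici]
      unfold ContinuousWithinAt
      have := ((((tid.pow 2).mul (h.lim1.pow 2)).div_const 2).sub (((tid.pow 2).mul (hu.pow 2)).div_const 2)).add (((tid.pow 2).mul (hu.pow 4)).div_const 4)
      simpa using this
    · intro r hr
      have hr : 0 < r := hr
      have a := (hasDerivAt_id r).pow 2
      refine (((((a.mul ((h.d2 r hr).pow 2)).div_const 2).sub ((a.mul ((h.d1 r hr).pow 2)).div_const 2)).add ((a.mul ((h.d1 r hr).pow 4)).div_const 4))).congr_deriv ?_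
      simp only [id, Pi.mul_apply, Pi.pow_apply, Nat.cast_ofNat]
      field_simp; ring
    · exact (iF.const_mul (1/2)).sub iM
    · have := (((t6.mul t4).div_const 2).sub ((t5.mul t3).div_const 2)).add (((t5.mul t3).mul (t3.pow 2)).div_const 4)
      simp only [mul_zero, zero_div, sub_zero, add_zero, ne_eq, OfNat.ofNat_ne_zero, not_false_eq_true, zero_pow, zero_mul] at this
      refine this.congr fun r => ?_
      ring
  have iGM : Integrable (fun r => r * u1 r ^ 2 + r * u r ^ 2) (volume.restrict (Set.Ioi (0:ℝ))) := iG.add iM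
  rw [integral_sub iGM iF, integral_add iG iM] at i1
  rw [integral_sub (iF.const_mul (1/2)) iM, integral_const_mul] at i2
  constructor <;> linarith

end Sol

/-- first basis vector -/
def ev : E2 := EuclideanSpace.single 0 1
def fv : E2 := EuclideanSpace.single 1 1

lemma norm_ev : ‖ev‖ = 1 := by simp [ev]
lemma norm_evfv (r t : ℝ) : ‖r • ev + t • fv‖ = √(r ^ 2 + t ^ 2) := by
  simp [ev, fv, EuclideanSpace.norm_eq, Fin.sum_univ_two]

section
variable {Q : E2 → ℝ}

lemma GS_radial (hQ : IsGroundState Q) (x : E2) : Q x = Q (‖x‖ • ev) :=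
  hQ.2.2.1 _ _ (by rw [norm_smul, norm_ev]; simp)

def prof (Q : E2 → ℝ) (r : ℝ) : ℝ := Q (r • ev)
def prof1 (Q : E2 → ℝ) (r : ℝ) : ℝ := fderiv ℝ Q (r • ev) ev

lemma GS_diff (hQ : IsGroundState Q) : Differentiable ℝ Q := hQ.1.differentiable (by norm_num)

lemma GS_d1 (hQ : IsGroundState Q) (r : ℝ) : HasDerivAt (prof Q) (prof1 Q r) r := by
  have h1 : HasDerivAt (fun r : ℝ => r • ev) ev r := by simpa using (hasDerivAt_id r).smul_const ev
  exact (GS_diff hQ (r • ev)).hasFDerivAt.comp_hasDerivAt r h1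

lemma GS_fdiff (hQ : IsGroundState Q) (v : E2) : Differentiable ℝ (fun y => fderiv ℝ Q y v) := by
  have h : ContDiff ℝ 1 (fderiv ℝ Q) := hQ.1.fderiv_right (by norm_num)
  exact (h.differentiable (by norm_num)).clm_apply (differentiable_const v)

lemma GS_d2a (hQ : IsGroundState Q) (r : ℝ) : HasDerivAt (prof1 Q) (fderiv ℝ (fun y => fderiv ℝ Q y ev) (r • ev) ev) r := by
  have h1 : HasDerivAt (fun r : ℝ => r • ev) ev r := by simpa using (hasDerivAt_id r).smul_const ev
  exact (GS_fdiff hQ ev (r • ev)).hasFDerivAt.comp_hasDerivAt r h1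

lemma GS_d2b (hQ : IsGroundState Q) {r : ℝ} (hr : 0 < r) : fderiv ℝ (fun y => fderiv ℝ Q y fv) (r • ev) fv = prof1 Q r / r := by
  have hline : ∀ t : ℝ, HasDerivAt (fun t : ℝ => r • ev + t • fv) fv t := fun t => by
    simpa using ((hasDerivAt_id t).smul_const fv).const_add (r • ev)
  have h1 : HasDerivAt (fun t : ℝ => fderiv ℝ Q (r • ev + t • fv) fv) (fderiv ℝ (fun y => fderiv ℝ Q y fv) (r • ev) fv) 0 := by
    have := (GS_fdiff hQ fv (r • ev + (0:ℝ) • fv)).hasFDerivAt.comp_hasDerivAt 0 (hline 0)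
    simp only [zero_smul, add_zero] at this
    exact this
  have hsq : ∀ t : ℝ, HasDerivAt (fun t : ℝ => √(r ^ 2 + t ^ 2)) (t / √(r ^ 2 + t ^ 2)) t := by
    intro t
    have h0 : 0 < r ^ 2 + t ^ 2 := by positivity
    have := (((hasDerivAt_id t).pow 2).const_add (r ^ 2)).sqrt (by simpa using h0.ne')
    refine this.congr_deriv ?_
    simp
    field_simp
  have h2 : ∀ t : ℝ, fderiv ℝ Q (r • ev + t • fv) fv = prof1 Q (√(r ^ 2 + t ^ 2)) * (t / √(r ^ 2 + t ^ 2)) := by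
    intro t
    have a1 : HasDerivAt (fun t : ℝ => Q (r • ev + t • fv)) (fderiv ℝ Q (r • ev + t • fv) fv) t :=
      (GS_diff hQ (r • ev + t • fv)).hasFDerivAt.comp_hasDerivAt t (hline t)
    have a2 : HasDerivAt (fun t : ℝ => prof Q (√(r ^ 2 + t ^ 2))) (prof1 Q (√(r ^ 2 + t ^ 2)) * (t / √(r ^ 2 + t ^ 2))) t :=
      (GS_d1 hQ _).comp t (hsq t)
    have e : (fun t : ℝ => Q (r • ev + t • fv)) = fun t : ℝ => prof Q (√(r ^ 2 + t ^ 2)) := by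
      ext t
      rw [GS_radial hQ, norm_evfv]; rfl
    rw [e] at a1
    exact a1.unique a2
  have e0 : √(r ^ 2 + 0 ^ 2) = r := by simp [Real.sqrt_sq hr.le]
  have h3 : HasDerivAt (fun t : ℝ => (prof1 Q (√(r ^ 2 + t ^ 2)) / √(r ^ 2 + t ^ 2)) * t) (prof1 Q r / r) 0 := by
    have b1 : HasDerivAt (fun t : ℝ => prof1 Q (√(r ^ 2 + t ^ 2))) _ 0 := (GS_d2a hQ _).comp 0 (hsq 0)
    have b2 := b1.div (hsq 0) (by rw [e0]; exact hr.ne')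
    have b3 := b2.mul (hasDerivAt_id 0)
    refine b3.congr_deriv ?_
    simp only [id, mul_zero, zero_add, mul_one, Pi.div_apply, e0]
  have h4 : (fun t : ℝ => fderiv ℝ Q (r • ev + t • fv) fv) = fun t : ℝ => (prof1 Q (√(r ^ 2 + t ^ 2)) / √(r ^ 2 + t ^ 2)) * t := by
    ext t; rw [h2 t]; ring
  rw [h4] at h1
  exact h1.unique h3

lemma GS_grad (hQ : IsGroundState Q) {x : E2} (hx : x ≠ 0) : gradSq Q x = prof1 Q ‖x‖ ^ 2 := by
  have hd : DifferentiableAt ℝ (fun x : E2 => ‖x‖) x := (contDiffAt_norm ℝ hx (n := 1)).differentiableAt one_ne_zero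
  have h1 : HasFDerivAt (fun x : E2 => prof Q ‖x‖) (prof1 Q ‖x‖ • fderiv ℝ (fun x : E2 => ‖x‖) x) x :=
    (GS_d1 hQ ‖x‖).comp_hasFDerivAt x hd.hasFDerivAt
  have e : (fun x : E2 => prof Q ‖x‖) = Q := by ext x; rw [GS_radial hQ x]; rfl
  rw [e] at h1
  unfold gradSq
  rw [h1.fderiv, norm_smul, norm_fderiv_norm hd, mul_one, Real.norm_eq_abs, sq_abs]

lemma ae_ne_zero : ∀ᵐ x : E2, x ≠ 0 := by simp [ae_iff, Set.setOf_eq_eq_singleton]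

lemma GS_ints (hQ : IsGroundState Q) : IntegrableOn (fun r => r * prof Q r ^ 2) (Set.Ioi 0) ∧ IntegrableOn (fun r => r * prof1 Q r ^ 2) (Set.Ioi 0) ∧
    IntegrableOn (fun r => r * prof Q r ^ 4) (Set.Ioi 0) := by
  obtain ⟨-, iM, iG, iF⟩ := hQ.2.2.2.1
  refine ⟨?_, ?_, ?_⟩
  · rw [← radial_integrable (fun r => prof Q r ^ 2)]
    refine iM.congr (Eventually.of_forall fun x => ?_)
    simp only; rw [GS_radial hQ x]; rfl
  · rw [← radial_integrable (fun r => prof1 Q r ^ 2)]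
    refine iG.congr ?_
    filter_upwards [ae_ne_zero] with x hx
    exact GS_grad hQ hx
  · rw [← radial_integrable (fun r => prof Q r ^ 4)]
    refine iF.congr (Eventually.of_forall fun x => ?_)
    simp only; rw [GS_radial hQ x]; rfl

lemma GS_sol (hQ : IsGroundState Q) : Sol (prof Q) (prof1 Q) := by
  refine ⟨fun r hr => hQ.2.1 _, fun r hr => GS_d1 hQ r, fun r hr => ?_, ⟨prof Q 0, hQ.2.1 _, ?_⟩, ?_, ?_⟩
  · refine (GS_d2a hQ r).congr_deriv ?_
    have h := hQ.2.2.2.2 (r • ev)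
    have hb := GS_d2b hQ hr
    unfold lap at h
    rw [Fin.sum_univ_two] at h
    change -(fderiv ℝ (fun y => fderiv ℝ Q y ev) (r • ev) ev + fderiv ℝ (fun y => fderiv ℝ Q y fv) (r • ev) fv) + prof Q r - prof Q r ^ 3 = 0 at h
    rw [hb] at h
    linarith
  · exact (GS_d1 hQ 0).continuousAt.tendsto.mono_left nhdsWithin_le_nhds
  · have h0 : prof1 Q 0 = 0 := by
      have h1 : HasDerivAt (fun r => prof Q (-r)) (prof1 Q (-0) * (-1)) 0 := (GS_d1 hQ (-0)).comp 0 (hasDerivAt_neg 0)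
      have h2 : (fun r => prof Q (-r)) = prof Q := by
        ext r; exact hQ.2.2.1 _ _ (by simp)
      rw [h2] at h1
      have := h1.unique (GS_d1 hQ 0)
      rw [neg_zero] at this
      linarith
    have := (GS_d2a hQ 0).continuousAt.tendsto.mono_left (nhdsWithin_le_nhds (s := Set.Ioi 0))
    rwa [h0] at this
  · intro ε hε R
    by_contra hc
    push Not at hc
    obtain ⟨iM, iG, -⟩ := GS_ints hQ
    have i1 : IntegrableOn (fun r => r * prof Q r ^ 2 + r * prof1 Q r ^ 2) (Set.Ioi (max R 1)) :=
      (iM.add iG).mono_set (Set.Ioi_subset_Ioi (le_trans zero_le_one (le_max_right _ _)))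
    have i2 : IntegrableOn (fun _ : ℝ => ε ^ 2) (Set.Ioi (max R 1)) := by
      refine Integrable.mono' i1 aestronglyMeasurable_const ?_
      rw [ae_restrict_iff' measurableSet_Ioi]
      refine Eventually.of_forall fun r hr => ?_
      have hr1 : R < r := lt_of_le_of_lt (le_max_left _ _) hr
      have hr2 : 1 < r := lt_of_le_of_lt (le_max_right _ _) hr
      rw [Real.norm_eq_abs, abs_of_nonneg (by positivity)]
      have : ε ^ 2 ≤ prof Q r ^ 2 + prof1 Q r ^ 2 := by
        rcases lt_or_ge (prof Q r) ε with h | h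
        · have := hc r hr1 h
          have : ε ^ 2 ≤ |prof1 Q r| ^ 2 := by gcongr
          rw [sq_abs] at this
          nlinarith [sq_nonneg (prof Q r)]
        · have : ε ^ 2 ≤ prof Q r ^ 2 := by gcongr
          nlinarith [sq_nonneg (prof1 Q r)]
      nlinarith [sq_nonneg (prof Q r), sq_nonneg (prof1 Q r)]
    rw [integrableOn_const_iff] at i2
    rcases i2 with h | h
    · have : ε ^ 2 = 0 := by simpa using h
      have := sq_pos_of_pos hε; linarith
    · simp at h

lemma GS_mass (hQ : IsGroundState Q) : ∫ x : E2, Q x ^ 2 = 2 * π * ∫ r in Set.Ioi (0:ℝ), r * prof Q r ^ 2 := by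
  rw [← radial_integral (fun r => prof Q r ^ 2)]
  congr 1; ext x; rw [GS_radial hQ x]; rfl

lemma GS_four (hQ : IsGroundState Q) : ∫ x : E2, Q x ^ 4 = 2 * ∫ x : E2, Q x ^ 2 := by
  have e : ∫ x : E2, Q x ^ 4 = 2 * π * ∫ r in Set.Ioi (0:ℝ), r * prof Q r ^ 4 := by
    rw [← radial_integral (fun r => prof Q r ^ 4)]
    congr 1; ext x; rw [GS_radial hQ x]; rfl
  obtain ⟨iM, iG, iF⟩ := GS_ints hQ
  rw [e, GS_mass hQ, ((GS_sol hQ).pohozaev iM iG iF).1]; ring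

lemma GS_grad_int (hQ : IsGroundState Q) : ∫ x : E2, gradSq Q x = ∫ x : E2, Q x ^ 2 := by
  have e : ∫ x : E2, gradSq Q x = 2 * π * ∫ r in Set.Ioi (0:ℝ), r * prof1 Q r ^ 2 := by
    rw [← radial_integral (fun r => prof1 Q r ^ 2)]
    apply integral_congr_ae
    filter_upwards [ae_ne_zero] with x hx
    exact GS_grad hQ hx
  obtain ⟨iM, iG, iF⟩ := GS_ints hQ
  rw [e, GS_mass hQ, ((GS_sol hQ).pohozaev iM iG iF).2]
end
end

noncomputable section
open MeasureTheory Real Filter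
open scoped Pointwise ENNReal NNReal Topology
set_option linter.all false
set_option linter.deprecated false

structure Prof (k : ℝ → ℝ) (L : ℝ≥0) (R : ℝ) : Prop where
  lip : LipschitzWith L k
  sup : ∀ r, R ≤ r → k r = 0

def M1 (k : ℝ → ℝ) : ℝ := ∫ r in Set.Ioi (0:ℝ), r * k r ^ 2
def F1 (k : ℝ → ℝ) : ℝ := ∫ r in Set.Ioi (0:ℝ), r * k r ^ 4
def G1 (k : ℝ → ℝ) : ℝ := ∫ r in Set.Ioi (0:ℝ), r * deriv k r ^ 2

lemma intOn_bdd {g : ℝ → ℝ} (hg : AEStronglyMeasurable g (volume.restrict (Set.Ioi (0:ℝ)))) {B R : ℝ} (hB : ∀ r, 0 < r → r ≤ R → |g r| ≤ B) (hR : ∀ r, R < r → g r = 0) :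
    IntegrableOn g (Set.Ioi 0) := by
  have h1 : IntegrableOn ((Set.Ioc 0 R).indicator fun _ => B) (Set.Ioi (0:ℝ)) := by
    have : Integrable ((Set.Ioc 0 R).indicator fun _ : ℝ => B) := by
      rw [integrable_indicator_iff measurableSet_Ioc, integrableOn_const_iff]
      right; simp
    exact this.integrableOn
  refine Integrable.mono' h1 hg ?_
  rw [ae_restrict_iff' measurableSet_Ioi]
  refine Eventually.of_forall fun r hr => ?_
  by_cases h : r ≤ R
  · rw [Set.indicator_of_mem (show r ∈ Set.Ioc 0 R from ⟨hr, h⟩)]; exact hB r hr h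
  · push Not at h
    rw [hR r h, Set.indicator_of_notMem (fun h' => by linarith [h'.2])]; simp

namespace Prof
variable {k l : ℝ → ℝ} {L L' : ℝ≥0} {R R' : ℝ}

lemma bd (h : Prof k L R) {r : ℝ} (hr : 0 < r) (hrR : r ≤ R) : |k r| ≤ L * R := by
  have := h.lip.dist_le_mul r R
  rw [h.sup R le_rfl, Real.dist_eq, Real.dist_eq, sub_zero, abs_of_nonpos (show r - R ≤ 0 by linarith)] at this
  refine this.trans ?_
  gcongr; linarith

lemma dsup (h : Prof k L R) {r : ℝ} (hr : R < r) : deriv k r = 0 := by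
  have : k =ᶠ[𝓝 r] fun _ => 0 := by
    filter_upwards [lt_mem_nhds hr] with s hs using h.sup s hs.le
  rw [this.deriv_eq]; simp

lemma dbd (h : Prof k L R) (r : ℝ) : |deriv k r| ≤ L := by
  exact norm_deriv_le_of_lipschitz h.lip

lemma int_mul (h : Prof k L R) {w : ℝ → ℝ} (hw : Measurable w) {B : ℝ} (hB : ∀ r, 0 < r → r ≤ R → |w r| ≤ B) (n : ℕ) (hn : n ≠ 0) :
    IntegrableOn (fun r => w r * k r ^ n) (Set.Ioi 0) := by
  refine intOn_bdd (B := B * (L * R) ^ n) (R := R) (by have := h.lip.continuous.measurable; exact (hw.mul (this.pow_const n)).aestronglyMeasurable) ?_ ?_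
  · intro r hr hrR
    rw [abs_mul, abs_pow]
    have := h.bd hr hrR
    have h2 := hB r hr hrR
    have : 0 ≤ B := (abs_nonneg _).trans h2
    gcongr
  · intro r hr; rw [h.sup r hr.le]; simp [hn]

lemma int_pow (h : Prof k L R) (n : ℕ) (hn : n ≠ 0) : IntegrableOn (fun r => r * k r ^ n) (Set.Ioi 0) :=
  h.int_mul measurable_id (B := R) (fun r hr hrR => by simp; rw [abs_of_pos hr]; exact hrR) n hn

lemma int_d (h : Prof k L R) : IntegrableOn (fun r => r * deriv k r ^ 2) (Set.Ioi 0) := by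
  refine intOn_bdd (B := R * L ^ 2) (R := R) (by have := measurable_deriv k; fun_prop) ?_ ?_
  · intro r hr hrR
    rw [abs_mul, abs_pow, abs_of_pos hr]
    have := h.dbd r
    gcongr
    linarith
  · intro r hr; rw [h.dsup hr]; simp
end Prof

lemma ae_norm {p : ℝ → Prop} (h : ∀ᵐ r : ℝ, p r) : ∀ᵐ x : E2, p ‖x‖ := by
  obtain ⟨T, hT1, hT2, hT3⟩ := exists_measurable_superset_of_null (ae_iff.1 h)
  have hz : (fun r : ℝ => r * T.indicator (fun _ => (1:ℝ)) r) =ᵐ[volume.restrict (Set.Ioi (0:ℝ))] 0 := by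
    have : ∀ᵐ r : ℝ, r ∉ T := by rw [ae_iff]; simpa using hT3
    filter_upwards [ae_restrict_of_ae this] with r hr
    simp [hr]
  have hi : Integrable (fun x : E2 => T.indicator (fun _ => (1:ℝ)) ‖x‖) := by
    rw [radial_integrable (T.indicator (fun _ => (1:ℝ)))]
    exact (integrable_zero _ _ _).congr hz.symm
  have h0 : ∫ x : E2, T.indicator (fun _ => (1:ℝ)) ‖x‖ = 0 := by
    rw [radial_integral (T.indicator (fun _ => (1:ℝ))), integral_congr_ae hz]; simp
  rw [integral_eq_zero_iff_of_nonneg (fun x => Set.indicator_nonneg (fun _ _ => zero_le_one) _) hi] at h0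
  filter_upwards [h0] with x hx
  by_contra hc
  have : ‖x‖ ∈ T := hT1 hc
  simp [this] at hx

lemma ofReal_int_sq {f : E2 → ℝ} (hf : Integrable f) (h0 : ∀ x, 0 ≤ f x) : ENNReal.ofReal (∫ x, f x) = ∫⁻ x, ENNReal.ofReal (f x) :=
  ofReal_integral_eq_lintegral_ofReal hf (Eventually.of_forall h0)

lemma Nice.int_pow {f : E2 → ℝ} {L : ℝ≥0} {R B : ℝ} (hf : Nice f L R B) (n : ℕ) (hn : n ≠ 0) : Integrable (fun x => f x ^ n) := by
  refine Continuous.integrable_of_hasCompactSupport (hf.lip.continuous.pow n) ?_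
  refine HasCompactSupport.intro (isCompact_closedBall (0:E2) R) (fun x hx => ?_)
  rw [hf.sup x (by simp at hx; exact hx.le)]; simp [hn]

theorem Nice.rearr1 {f : E2 → ℝ} {L : ℝ≥0} {R B : ℝ} (hf : Nice f L R B) (hL : 0 < L) (hB : 0 ≤ B) (g : E2 → ℝ) (hg0 : ∀ x, 0 ≤ g x)
    (hg : ∀ᵐ x, ∀ κ > g x, ∀ᶠ y in 𝓝 x, f y ≤ f x + κ * ‖y - x‖) (hgi : Integrable fun x => g x ^ 2) :
    Prof (hst f) L (rad f 0) ∧ AntitoneOn (hst f) (Set.Ici 0) ∧ (∀ r, 0 ≤ hst f r) ∧ 2 * π * G1 (hst f) ≤ ∫ x, g x ^ 2 ∧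
      2 * π * M1 (hst f) = ∫ x, f x ^ 2 ∧ 2 * π * F1 (hst f) = ∫ x, f x ^ 4 := by
  have hP : Prof (hst f) L (rad f 0) := ⟨hf.hst_lip hL, fun r hr => hf.hst_supp r hr⟩
  have hs := hf.star hL hB
  have hpow : ∀ n : ℕ, n ≠ 0 → ∫ x : E2, hst f ‖x‖ ^ n = ∫ x, f x ^ n := by
    intro n hn
    have e := lintegral_equi _ _ hs.lip.continuous.measurable hf.lip.continuous.measurable hs.nn hf.nn
      (fun t ht => hf.equi ht) n hn
    rw [← ofReal_int_sq (hs.int_pow n hn) (fun x => pow_nonneg (hs.nn x) n), ← ofReal_int_sq (hf.int_pow n hn) (fun x => pow_nonneg (hf.nn x) n)] at e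
    rw [ENNReal.ofReal_eq_ofReal_iff (integral_nonneg fun x => pow_nonneg (hs.nn x) n) (integral_nonneg fun x => pow_nonneg (hf.nn x) n)] at e
    exact e
  refine ⟨hP, hf.hst_anti, hst_nonneg f, ?_, ?_, ?_⟩
  · unfold G1
    rw [← radial_integral (fun r => deriv (hst f) r ^ 2)]
    have e := hf.rearr hL hB g hg0 hg
    have hi : Integrable (fun x : E2 => deriv (hst f) ‖x‖ ^ 2) := by
      rw [radial_integrable (fun r => deriv (hst f) r ^ 2)]; exact hP.int_d
    rw [← ofReal_int_sq hi (fun x => by positivity), ← ofReal_int_sq hgi (fun x => by positivity)] at e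
    exact (ENNReal.ofReal_le_ofReal_iff (integral_nonneg fun x => by positivity)).1 e
  · unfold M1
    rw [← radial_integral (fun r => hst f r ^ 2)]
    exact hpow 2 two_ne_zero
  · unfold F1
    rw [← radial_integral (fun r => hst f r ^ 4)]
    exact hpow 4 (by norm_num)

theorem Prof.rearr {k : ℝ → ℝ} {L : ℝ≥0} {R : ℝ} (h : Prof k L R) : ∃ k' L' R', Prof k' L' R' ∧ AntitoneOn k' (Set.Ici 0) ∧ (∀ r, 0 ≤ k' r) ∧
    G1 k' ≤ G1 k ∧ M1 k' = M1 k ∧ F1 k' = F1 k := by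
  have hN : Nice (fun x => |k ‖x‖|) (L + 1) (max R 0) (L * max R 0) := by
    refine ⟨fun x => abs_nonneg _, ?_, fun x hx => by rw [h.sup _ ((le_max_left _ _).trans hx)]; simp, fun x => ?_⟩
    · have := (h.lip.comp (lipschitzWith_one_norm (E := E2)))
      have h2 : LipschitzWith 1 (fun x : ℝ => |x|) := lipschitzWith_one_norm
      have := h2.comp this
      exact this.weaken (by simp)
    · rcases le_or_gt R ‖x‖ with hx | hx
      · rw [h.sup _ hx]; simp; positivity
      · have := h.lip.dist_le_mul ‖x‖ R
        rw [h.sup R le_rfl, Real.dist_eq, Real.dist_eq, sub_zero, abs_of_nonpos (show ‖x‖ - R ≤ 0 by linarith)] at this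
        refine this.trans ?_
        have := le_max_left R 0
        gcongr
        linarith [norm_nonneg x]
  have hd : ∀ᵐ x : E2, DifferentiableAt ℝ k ‖x‖ := ae_norm h.lip.ae_differentiableAt
  have hgi : Integrable (fun x : E2 => |deriv k ‖x‖| ^ 2) := by
    have := (radial_integrable (fun r => deriv k r ^ 2)).2 h.int_d
    simpa using this
  obtain ⟨a1, a2, a3, a4, a5, a6⟩ := hN.rearr1 (by positivity) (by positivity) (fun x => |deriv k ‖x‖|) (fun x => abs_nonneg _) (by
    filter_upwards [hd] with x hx κ hκ
    have h1 := hx.hasDerivAt.isLittleO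
    have h2 := h1.def (c := κ - |deriv k ‖x‖|) (by linarith)
    have h3 : Tendsto (fun y : E2 => ‖y‖) (𝓝 x) (𝓝 ‖x‖) := continuous_norm.tendsto x
    filter_upwards [h3.eventually h2] with y hy
    have e1 : |k ‖y‖ - k ‖x‖| ≤ κ * |‖y‖ - ‖x‖| := by
      have : k ‖y‖ - k ‖x‖ = (k ‖y‖ - k ‖x‖ - (‖y‖ - ‖x‖) * deriv k ‖x‖) + (‖y‖ - ‖x‖) * deriv k ‖x‖ := by ring
      rw [this]
      refine (abs_add_le _ _).trans ?_
      simp only [smul_eq_mul, Real.norm_eq_abs] at hy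
      rw [abs_mul (‖y‖ - ‖x‖)]
      nlinarith
    have e2 : |k ‖y‖| ≤ |k ‖x‖| + |k ‖y‖ - k ‖x‖| := by
      have := abs_add_le (k ‖x‖) (k ‖y‖ - k ‖x‖)
      simpa using this
    have e3 : |‖y‖ - ‖x‖| ≤ ‖y - x‖ := abs_norm_sub_norm_le y x
    have e4 : κ * |‖y‖ - ‖x‖| ≤ κ * ‖y - x‖ := by
      have : 0 ≤ κ := (abs_nonneg _).trans (le_of_lt hκ)
      gcongr
    linarith) hgi
  refine ⟨_, _, _, a1, a2, a3, ?_, ?_, ?_⟩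
  · have e : ∫ x : E2, |deriv k ‖x‖| ^ 2 = 2 * π * G1 k := by
      rw [G1, ← radial_integral (fun r => deriv k r ^ 2)]; simp
    rw [e] at a4
    exact le_of_mul_le_mul_left a4 (by positivity)
  · have e : ∫ x : E2, |k ‖x‖| ^ 2 = 2 * π * M1 k := by
      rw [M1, ← radial_integral (fun r => k r ^ 2)]; simp
    rw [e] at a5
    exact mul_left_cancel₀ (by positivity) a5
  · have e : ∫ x : E2, |k ‖x‖| ^ 4 = 2 * π * F1 k := by
      rw [F1, ← radial_integral (fun r => k r ^ 4)]
      congr 1; ext x; exact Even.pow_abs (by decide) _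
    rw [e] at a6
    exact mul_left_cancel₀ (by positivity) a6
end

noncomputable section
open MeasureTheory Real Filter
open scoped Pointwise ENNReal NNReal Topology
set_option linter.all false
set_option linter.deprecated false

lemma Prof.ftc {k : ℝ → ℝ} {L : ℝ≥0} {R : ℝ} (h : Prof k L R) (s t : ℝ) : ∫ x in s..t, deriv k x = k t - k s :=
  (h.lip.lipschitzOnWith (s := Set.uIcc s t)).absolutelyContinuousOnInterval.integral_deriv_eq_sub

lemma Prof.intd {k : ℝ → ℝ} {L : ℝ≥0} {R : ℝ} (h : Prof k L R) (s t : ℝ) : IntervalIntegrable (deriv k) volume s t := by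
  refine IntervalIntegrable.mono_fun' (g := fun _ => (L:ℝ)) (by simp) (measurable_deriv k).aestronglyMeasurable ?_
  exact Eventually.of_forall fun r => h.dbd r

/-- decreasing normalised profile -/
structure Dec (k : ℝ → ℝ) : Prop where
  prof : ∃ L R, Prof k L R
  anti : AntitoneOn k (Set.Ici 0)
  nn : ∀ r, 0 ≤ k r
  nrm : G1 k + M1 k ≤ 2

lemma G1_nn (k : ℝ → ℝ) : 0 ≤ G1 k := setIntegral_nonneg measurableSet_Ioi fun r hr => mul_nonneg (le_of_lt hr) (sq_nonneg _)
lemma M1_nn (k : ℝ → ℝ) : 0 ≤ M1 k := setIntegral_nonneg measurableSet_Ioi fun r hr => mul_nonneg (le_of_lt hr) (sq_nonneg _)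
lemma F1_nn (k : ℝ → ℝ) : 0 ≤ F1 k := setIntegral_nonneg measurableSet_Ioi fun r hr => mul_nonneg (le_of_lt hr) (by positivity)

lemma Dec.b1 {k : ℝ → ℝ} (h : Dec k) {r : ℝ} (hr : 0 < r) : r * k r ≤ 2 := by
  obtain ⟨L, R, hp⟩ := h.prof
  have i1 := hp.int_pow 2 two_ne_zero
  have e1 : ∫ x in Set.Ioc 0 r, x * k x ^ 2 ≤ M1 k :=
    setIntegral_mono_set i1 ((ae_restrict_iff' measurableSet_Ioi).2 (Eventually.of_forall fun x hx => mul_nonneg (le_of_lt hx) (sq_nonneg _)))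
      (HasSubset.Subset.eventuallyLE fun x hx => hx.1)
  have e2 : ∫ x in Set.Ioc 0 r, x * k r ^ 2 ≤ ∫ x in Set.Ioc 0 r, x * k x ^ 2 := by
    refine setIntegral_mono_on ?_ (i1.mono_set fun x hx => hx.1) measurableSet_Ioc ?_
    · exact ((continuous_id.mul continuous_const).integrableOn_Icc (a := 0) (b := r)).mono_set Set.Ioc_subset_Icc_self
    · intro x hx
      have := h.anti (Set.mem_Ici.2 hx.1.le) (Set.mem_Ici.2 hr.le) hx.2
      have := h.nn r
      have := hx.1.le
      gcongr
  have e3 : ∫ x in Set.Ioc 0 r, x * k r ^ 2 = r ^ 2 / 2 * k r ^ 2 := by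
    rw [← intervalIntegral.integral_of_le hr.le, intervalIntegral.integral_mul_const, integral_id]; ring
  have := h.nrm
  have := G1_nn k
  have : (r * k r) ^ 2 ≤ 2 ^ 2 := by nlinarith
  exact le_of_abs_le (by simpa using sq_le_sq.1 this)

lemma Dec.b2 {k : ℝ → ℝ} (h : Dec k) {s t l : ℝ} (hs : 0 < s) (hst : s ≤ t) (hl : 0 < l) : k s - k t ≤ l + log (t / s) / (2 * l) := by
  obtain ⟨L, R, hp⟩ := h.prof
  have hinv : IntervalIntegrable (fun x : ℝ => x⁻¹) volume s t := by
    refine intervalIntegral.intervalIntegrable_inv (f := fun x => x) (fun x hx => ?_) continuousOn_id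
    rw [Set.uIcc_of_le hst] at hx
    exact (hs.trans_le hx.1).ne'
  have i2 : IntervalIntegrable (fun x : ℝ => x * deriv k x ^ 2) volume s t := by
    rw [intervalIntegrable_iff_integrableOn_Ioc_of_le hst]
    exact hp.int_d.mono_set fun x hx => hs.trans hx.1
  have e1 : k s - k t = ∫ x in s..t, - deriv k x := by
    rw [intervalIntegral.integral_neg, hp.ftc]; ring
  have e2 : ∫ x in s..t, - deriv k x ≤ ∫ x in s..t, (l / 2) * (x * deriv k x ^ 2) + (1 / (2 * l)) * x⁻¹ := by
    refine intervalIntegral.integral_mono_on hst (hp.intd s t).neg ((i2.const_mul _).add (hinv.const_mul _)) fun x hx => ?_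
    have hx0 : 0 < x := hs.trans_le hx.1
    have : (l / 2) * (x * deriv k x ^ 2) + (1 / (2 * l)) * x⁻¹ + deriv k x = (l * x * deriv k x + 1) ^ 2 / (2 * l * x) := by
      field_simp; ring
    have : 0 ≤ (l * x * deriv k x + 1) ^ 2 / (2 * l * x) := by positivity
    linarith
  have e3 : ∫ x in s..t, x * deriv k x ^ 2 ≤ G1 k := by
    rw [intervalIntegral.integral_of_le hst]
    exact setIntegral_mono_set hp.int_d ((ae_restrict_iff' measurableSet_Ioi).2 (Eventually.of_forall fun x hx => mul_nonneg (le_of_lt hx) (sq_nonneg _)))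
      (HasSubset.Subset.eventuallyLE fun x hx => hs.trans hx.1)
  rw [intervalIntegral.integral_add (i2.const_mul _) (hinv.const_mul _), intervalIntegral.integral_const_mul, intervalIntegral.integral_const_mul,
    integral_inv_of_pos hs (hs.trans_le hst)] at e2
  have := h.nrm
  have := M1_nn k
  have e4 : l / 2 * ∫ x in s..t, x * deriv k x ^ 2 ≤ l / 2 * 2 := by gcongr; linarith
  have e5 : 1 / (2 * l) * log (t / s) = log (t / s) / (2 * l) := by ring
  linarith

lemma bd_aux {y r : ℝ} (hr : 0 < r) (h0 : 0 ≤ y) (h1 : r * y ≤ 2) (h2 : r ≤ 1 → y ≤ 3 + log (1 / r) / 2) :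
    r * y ^ 4 ≤ 2500 * (1 + r ^ 2)⁻¹ ∧ r * y ^ 3 ≤ 626 := by
  rcases le_or_gt r 1 with hr1 | hr1
  · have h3 := h2 hr1
    set x := log (1 / r) / 4 with hx
    have hx0 : 0 ≤ x := by
      have : 0 ≤ log (1 / r) := log_nonneg (by rw [le_div_iff₀ hr]; linarith)
      positivity
    have he : exp x ^ 4 = 1 / r := by
      rw [← Real.exp_nat_mul]; push_cast
      rw [hx, mul_div_cancel₀ _ (by norm_num), exp_log (by positivity)]
    have h4 : y ≤ 5 * exp x := by
      have := add_one_le_exp x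
      have h5 : y ≤ 3 + 2 * x := by rw [hx]; linarith
      linarith
    have h6 : r * y ^ 4 ≤ 625 := by
      calc r * y ^ 4 ≤ r * (5 * exp x) ^ 4 := by gcongr
        _ = 625 := by rw [mul_pow, he]; field_simp; norm_num
    have h7 : y ^ 3 ≤ 1 + y ^ 4 := by nlinarith [sq_nonneg (y^2 - 1), sq_nonneg (y^2-y), sq_nonneg (y-1), sq_nonneg y]
    refine ⟨?_, ?_⟩
    · rw [← div_eq_mul_inv, le_div_iff₀ (by positivity)]
      nlinarith [sq_nonneg r, show r ^ 2 ≤ 1 by nlinarith, show 0 ≤ r * y ^ 4 by positivity]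
    · nlinarith [show r * y ^ 3 ≤ r * (1 + y ^ 4) by gcongr]
  · have h3 : y ≤ 2 := by nlinarith
    have h4 : r ^ 2 * y ^ 2 ≤ 4 := by
      have : (r * y) ^ 2 ≤ 2 ^ 2 := by gcongr
      nlinarith
    have h5 : r * y ^ 3 ≤ 8 := by
      have : r * y ^ 3 = (r * y) * y ^ 2 := by ring
      rw [this]
      have : y ^ 2 ≤ 4 := by nlinarith
      have : 0 ≤ r * y := by positivity
      nlinarith [sq_nonneg y]
    refine ⟨?_, by linarith⟩
    rw [← div_eq_mul_inv, le_div_iff₀ (by positivity)]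
    have : r * y ^ 4 * r ^ 2 = (r * y) * y * (r ^ 2 * y ^ 2) := by ring
    have h8 : (r * y) * y * (r ^ 2 * y ^ 2) ≤ 2 * 2 * 4 := by gcongr
    have h9 : r * y ^ 4 ≤ r * y ^ 4 * r ^ 2 := by
      have : 0 ≤ r * y ^ 4 := by positivity
      exact le_mul_of_one_le_right this (by nlinarith)
    nlinarith

lemma Dec.b3 {k : ℝ → ℝ} (h : Dec k) {r : ℝ} (hr : 0 < r) : r * k r ^ 4 ≤ 2500 * (1 + r ^ 2)⁻¹ ∧ r * k r ^ 3 ≤ 626 := by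
  refine bd_aux hr (h.nn r) (h.b1 hr) fun h1 => ?_
  have := h.b2 hr h1 one_pos
  have := h.b1 one_pos
  linarith

lemma Dec.F_le {k : ℝ → ℝ} (h : Dec k) : F1 k ≤ ∫ r in Set.Ioi (0:ℝ), 2500 * (1 + r ^ 2)⁻¹ := by
  obtain ⟨L, R, hp⟩ := h.prof
  exact setIntegral_mono_on (hp.int_pow 4 four_ne_zero) (integrable_inv_one_add_sq.const_mul _).integrableOn measurableSet_Ioi fun r hr => (h.b3 hr).1

lemma Prof.smul {k : ℝ → ℝ} {L : ℝ≥0} {R : ℝ} (h : Prof k L R) (c : ℝ) : Prof (fun r => c * k r) (‖c‖₊ * L) R :=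
  ⟨(lipschitzWith_smul c).comp h.lip, fun r hr => by rw [h.sup r hr, mul_zero]⟩

lemma G1_smul (k : ℝ → ℝ) (c : ℝ) : G1 (fun r => c * k r) = c ^ 2 * G1 k := by
  unfold G1; rw [← integral_const_mul]; congr 1; ext r
  rw [show deriv (fun r => c * k r) r = c * deriv k r from deriv_const_mul_field c]; ring
lemma M1_smul (k : ℝ → ℝ) (c : ℝ) : M1 (fun r => c * k r) = c ^ 2 * M1 k := by
  unfold M1; rw [← integral_const_mul]; congr 1; ext r; ring
lemma F1_smul (k : ℝ → ℝ) (c : ℝ) : F1 (fun r => c * k r) = c ^ 4 * F1 k := by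
  unfold F1; rw [← integral_const_mul]; congr 1; ext r; ring

def SF : Set ℝ := {y | ∃ k, Dec k ∧ y = F1 k}
def SS : ℝ := sSup SF

lemma SF_bdd : BddAbove SF := ⟨_, fun y ⟨k, hk, e⟩ => e ▸ hk.F_le⟩

lemma Prof.le_SS0 {k : ℝ → ℝ} {L : ℝ≥0} {R : ℝ} (h : Prof k L R) (h2 : G1 k + M1 k ≤ 2) : F1 k ≤ SS := by
  obtain ⟨k', L', R', hp, ha, hn, hG, hM, hF⟩ := h.rearr
  rw [← hF]
  exact le_csSup SF_bdd ⟨k', ⟨⟨L', R', hp⟩, ha, hn, by linarith⟩, rfl⟩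

lemma Prof.le_SS {k : ℝ → ℝ} {L : ℝ≥0} {R : ℝ} (h : Prof k L R) : 4 * F1 k ≤ SS * (G1 k + M1 k) ^ 2 := by
  have key : ∀ e : ℝ, 0 < e → 4 * F1 k ≤ SS * (G1 k + M1 k + e) ^ 2 := by
    intro e he
    have hG := G1_nn k
    have hM := M1_nn k
    have hd : 0 < G1 k + M1 k + e := by positivity
    set c := √(2 / (G1 k + M1 k + e))
    have hc : c ^ 2 = 2 / (G1 k + M1 k + e) := sq_sqrt (by positivity)
    have h1 := (h.smul c).le_SS0 (by
      rw [G1_smul, M1_smul, ← mul_add, hc, div_mul_eq_mul_div, div_le_iff₀ hd]; linarith)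
    rw [F1_smul, show c ^ 4 = (c ^ 2) ^ 2 by ring, hc, div_pow, div_mul_eq_mul_div, div_le_iff₀ (by positivity)] at h1
    linarith
  have : Tendsto (fun e : ℝ => SS * (G1 k + M1 k + e) ^ 2) (𝓝[>] 0) (𝓝 (SS * (G1 k + M1 k + 0) ^ 2)) := by
    refine tendsto_nhdsWithin_of_tendsto_nhds (Continuous.tendsto (by fun_prop) 0)
  rw [add_zero] at this
  exact ge_of_tendsto this (by filter_upwards [self_mem_nhdsWithin] with e he using key e he)

lemma SS_pos : 0 < SS := by
  have hp : Prof (fun r : ℝ => max 0 (1 - r)) 1 1 := by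
    refine ⟨?_, fun r hr => max_eq_left (by linarith)⟩
    refine LipschitzWith.of_le_add_mul 1 fun x y => ?_
    rw [Real.dist_eq, NNReal.coe_one, one_mul]
    have := neg_abs_le (x - y)
    refine max_le (by positivity) ?_
    have := le_max_right 0 (1 - y)
    linarith
  have h1 := hp.le_SS
  have hF : 0 < F1 (fun r : ℝ => max 0 (1 - r)) := by
    unfold F1
    rw [setIntegral_pos_iff_support_of_nonneg_ae]
    · refine lt_of_lt_of_le ?_ (measure_mono (s := Set.Ioo (0:ℝ) 1) ?_)
      · simp
      · intro x hx
        have : 0 < max 0 (1 - x) := lt_max_of_lt_right (by linarith [hx.2])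
        have := hx.1
        exact ⟨by simp only [Function.mem_support]; positivity, hx.1⟩
    · exact (ae_restrict_iff' measurableSet_Ioi).2 (Eventually.of_forall fun x hx => mul_nonneg (le_of_lt hx) (by positivity))
    · exact hp.int_pow 4 four_ne_zero
  by_contra hc
  push Not at hc
  nlinarith [sq_nonneg (G1 (fun r : ℝ => max 0 (1 - r)) + M1 (fun r : ℝ => max 0 (1 - r)))]

lemma exists_seq : ∃ k : ℕ → ℝ → ℝ, (∀ n, Dec (k n)) ∧ Tendsto (fun n => F1 (k n)) atTop (𝓝 SS) := by
  have hne : SF.Nonempty := by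
    by_contra hc
    rw [Set.not_nonempty_iff_eq_empty] at hc
    have := SS_pos
    rw [SS, hc, Real.sSup_empty] at this
    exact lt_irrefl _ this
  obtain ⟨u, -, h1, h2⟩ := exists_seq_tendsto_sSup hne SF_bdd
  choose k hk e using h2
  exact ⟨k, hk, by simpa [← e] using (show Tendsto u atTop (𝓝 SS) from h1)⟩
end

noncomputable section
open MeasureTheory Real Filter
open scoped Pointwise ENNReal NNReal Topology
set_option linter.all false
set_option linter.deprecated false

lemma exists_lim : ∃ (k : ℕ → ℝ → ℝ) (h : ℝ → ℝ), (∀ n, Dec (k n)) ∧ Tendsto (fun n => F1 (k n)) atTop (𝓝 SS) ∧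
    ∀ r, 0 < r → Tendsto (fun n => k n r) atTop (𝓝 (h r)) := by
  obtain ⟨k, hk, hF⟩ := exists_seq
  have hcomp : IsCompact (Set.pi Set.univ fun q : ℚ => Set.Icc (0:ℝ) (if (0:ℚ) < q then 2 / (q:ℝ) else 0)) :=
    isCompact_univ_pi fun q => isCompact_Icc
  obtain ⟨H, -, φ, hφ, hH⟩ := hcomp.tendsto_subseq (x := fun n q => if (0:ℚ) < q then k n q else 0) (by
    intro n q _
    by_cases hq : (0:ℚ) < q
    · have hq' : (0:ℝ) < q := by exact_mod_cast hq
      simp only [hq, if_true]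
      refine ⟨(hk n).nn _, ?_⟩
      rw [le_div_iff₀ hq', mul_comm]
      exact (hk n).b1 hq'
    · simp [hq])
  have hHq : ∀ q : ℚ, 0 < q → Tendsto (fun n => k (φ n) q) atTop (𝓝 (H q)) := by
    intro q hq
    have := (tendsto_pi_nhds.1 hH) q
    simpa [hq] using this
  have hC : ∀ r : ℝ, 0 < r → ∃ l, Tendsto (fun n => k (φ n) r) atTop (𝓝 l) := by
    intro r hr
    apply cauchySeq_tendsto_of_complete
    rw [Metric.cauchySeq_iff']
    intro e he
    have hcont : ∀ᶠ t in 𝓝[>] r, (e / 8) + log (t / r) / (2 * (e / 8)) < e / 4 := by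
      have : Tendsto (fun t => (e / 8) + log (t / r) / (2 * (e / 8))) (𝓝[>] r) (𝓝 ((e / 8) + log (r / r) / (2 * (e / 8)))) := by
        refine tendsto_nhdsWithin_of_tendsto_nhds ?_
        have : ContinuousAt (fun t => (e / 8) + log (t / r) / (2 * (e / 8))) r := by
          refine continuousAt_const.add (ContinuousAt.div_const (ContinuousAt.log (by fun_prop) ?_) _)
          rw [div_self hr.ne']; norm_num
        exact this
      rw [div_self hr.ne', log_one, zero_div, add_zero] at this
      exact this.eventually_lt_const (by linarith)
    obtain ⟨t, ht1, ht2⟩ := (mem_nhdsGT_iff_exists_Ioo_subset.1 hcont)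
    obtain ⟨q, hq1, hq2⟩ := exists_rat_btwn (show r < t from ht1)
    have hq0 : (0:ℚ) < q := by exact_mod_cast hr.trans hq1
    have hq3 := ht2 ⟨hq1, hq2⟩
    simp only [Set.mem_setOf_eq] at hq3
    have hb : ∀ n, |k (φ n) r - k (φ n) q| ≤ e / 4 := by
      intro n
      have h1 := (hk (φ n)).b2 hr hq1.le (show 0 < e / 8 by positivity)
      have h2 := (hk (φ n)).anti (Set.mem_Ici.2 hr.le) (Set.mem_Ici.2 (hr.trans hq1).le) hq1.le
      rw [abs_of_nonneg (by linarith)]; linarith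
    obtain ⟨N, hN⟩ := Metric.cauchySeq_iff'.1 (hHq q hq0).cauchySeq (e / 4) (by positivity)
    refine ⟨N, fun n hn => ?_⟩
    have h1 := hN n hn
    rw [Real.dist_eq] at h1 ⊢
    have h2 := abs_le.1 (hb n)
    have h3 := abs_le.1 (hb N)
    have h4 := abs_lt.1 h1
    rw [abs_lt]
    constructor <;> linarith
  refine ⟨fun n => k (φ n), fun r => if hr : 0 < r then (hC r hr).choose else 0, fun n => hk _, hF.comp hφ.tendsto_atTop, fun r hr => ?_⟩
  simp only [hr, dif_pos]
  exact (hC r hr).choose_spec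

/-- limit profile -/
structure LimP (h : ℝ → ℝ) : Prop where
  nn : ∀ r, 0 < r → 0 ≤ h r
  anti : ∀ s t, 0 < s → s ≤ t → h t ≤ h s
  b1 : ∀ r, 0 < r → r * h r ≤ 2
  b2 : ∀ s t l, 0 < s → s ≤ t → 0 < l → h s - h t ≤ l + log (t / s) / (2 * l)
  b3 : ∀ r, 0 < r → r * h r ^ 3 ≤ 626

lemma LimP.of {k : ℕ → ℝ → ℝ} {h : ℝ → ℝ} (hk : ∀ n, Dec (k n)) (hl : ∀ r, 0 < r → Tendsto (fun n => k n r) atTop (𝓝 (h r))) : LimP h := by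
  refine ⟨fun r hr => ge_of_tendsto' (hl r hr) fun n => (hk n).nn r, fun s t hs hst => ?_, fun r hr => ?_, fun s t l hs hst h0 => ?_, fun r hr => ?_⟩
  · exact le_of_tendsto_of_tendsto' (hl t (hs.trans_le hst)) (hl s hs) fun n => (hk n).anti (Set.mem_Ici.2 hs.le) (Set.mem_Ici.2 (hs.le.trans hst)) hst
  · exact le_of_tendsto' ((hl r hr).const_mul r) fun n => (hk n).b1 hr
  · exact le_of_tendsto' ((hl s hs).sub (hl t (hs.trans_le hst))) fun n => (hk n).b2 hs hst h0
  · exact le_of_tendsto' (((hl r hr).pow 3).const_mul r) fun n => ((hk n).b3 hr).2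

lemma LimP.cont {h : ℝ → ℝ} (H : LimP h) : ContinuousOn h (Set.Ioi 0) := by
  intro r hr
  refine ContinuousAt.continuousWithinAt ?_
  rw [Metric.continuousAt_iff']
  intro e he
  have hr0 : (0:ℝ) < r := hr
  have c1 : ContinuousAt (fun t => (e / 4) + log (t / r) / (2 * (e / 4))) r := by
    refine continuousAt_const.add (ContinuousAt.div_const (ContinuousAt.log (by fun_prop) ?_) _)
    rw [div_self hr0.ne']; norm_num
  have c2 : ContinuousAt (fun t => (e / 4) + log (r / t) / (2 * (e / 4))) r := by
    refine continuousAt_const.add (ContinuousAt.div_const (ContinuousAt.log (by exact continuousAt_const.div continuousAt_id hr0.ne') ?_) _)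
    rw [div_self hr0.ne']; norm_num
  have t1 : ∀ᶠ t in 𝓝 r, (e / 4) + log (t / r) / (2 * (e / 4)) < e :=
    c1.tendsto.eventually_lt_const (by rw [div_self hr0.ne', log_one, zero_div, add_zero]; linarith)
  have t2 : ∀ᶠ t in 𝓝 r, (e / 4) + log (r / t) / (2 * (e / 4)) < e :=
    c2.tendsto.eventually_lt_const (by rw [div_self hr0.ne', log_one, zero_div, add_zero]; linarith)
  filter_upwards [t1, t2, lt_mem_nhds hr0] with t h1 h2 h3
  rw [Real.dist_eq]
  rcases le_total r t with h4 | h4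
  · have a1 := H.b2 r t (e / 4) hr0 h4 (by positivity)
    have a2 := H.anti r t hr0 h4
    rw [abs_of_nonpos (by linarith)]; linarith
  · have a1 := H.b2 t r (e / 4) h3 h4 (by positivity)
    have a2 := H.anti t r h3 h4
    rw [abs_of_nonneg (by linarith)]; linarith

lemma LimP.F1_eq {k : ℕ → ℝ → ℝ} {h : ℝ → ℝ} (hk : ∀ n, Dec (k n)) (hl : ∀ r, 0 < r → Tendsto (fun n => k n r) atTop (𝓝 (h r)))
    (hF : Tendsto (fun n => F1 (k n)) atTop (𝓝 SS)) : F1 h = SS := by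
  refine tendsto_nhds_unique ?_ hF
  refine tendsto_integral_of_dominated_convergence (fun r => 2500 * (1 + r ^ 2)⁻¹) (fun n => ?_) (integrable_inv_one_add_sq.const_mul _).integrableOn (fun n => ?_) ?_
  · obtain ⟨L, R, hp⟩ := (hk n).prof
    exact (hp.int_pow 4 four_ne_zero).aestronglyMeasurable
  · refine (ae_restrict_iff' measurableSet_Ioi).2 (Eventually.of_forall fun r hr => ?_)
    have hr0 : (0:ℝ) < r := hr
    rw [Real.norm_eq_abs, abs_of_nonneg (by positivity)]
    exact ((hk n).b3 hr).1
  · exact (ae_restrict_iff' measurableSet_Ioi).2 (Eventually.of_forall fun r hr => ((hl r hr).pow 4).const_mul r)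

/-- logarithmic test function -/
def lphi (s t r : ℝ) : ℝ := log (t / max s (min r t))

lemma lphi_prof {s t : ℝ} (hs : 0 < s) (hst : s < t) : Prof (lphi s t) (⟨1 / s, by positivity⟩) t := by
  refine ⟨LipschitzWith.of_le_add_mul _ fun x y => ?_, fun r hr => ?_⟩
  · unfold lphi
    have h1 : 0 < max s (min x t) := lt_max_of_lt_left hs
    have h2 : 0 < max s (min y t) := lt_max_of_lt_left hs
    have ht : 0 < t := hs.trans hst
    rw [log_div ht.ne' h1.ne', log_div ht.ne' h2.ne']
    have h3 : log (max s (min y t)) - log (max s (min x t)) ≤ (1 / s) * |max s (min y t) - max s (min x t)| := by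
      rw [← log_div h2.ne' h1.ne']
      refine (log_le_sub_one_of_pos (by positivity)).trans ?_
      have : max s (min y t) / max s (min x t) - 1 = (max s (min y t) - max s (min x t)) * (1 / max s (min x t)) := by field_simp
      rw [this, mul_comm (1 / s)]
      have h5 : 1 / max s (min x t) ≤ 1 / s := one_div_le_one_div_of_le hs (le_max_left _ _)
      exact mul_le_mul (le_abs_self _) h5 (by positivity) (abs_nonneg _)
    have h4 : |max s (min y t) - max s (min x t)| ≤ |x - y| := by
      have e1 := abs_max_sub_max_le_abs (min y t) (min x t) s
      have e2 := abs_min_sub_min_le_max y t x t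
      rw [sub_self, abs_zero, max_eq_left (abs_nonneg _)] at e2
      rw [max_comm s, max_comm s, abs_sub_comm x y]
      exact e1.trans e2
    have h5 : (1 / s) * |max s (min y t) - max s (min x t)| ≤ (1 / s) * |x - y| := by gcongr
    rw [Real.dist_eq]
    change _ ≤ _ + (1 / s) * _
    linarith
  · unfold lphi
    rw [min_eq_right hr, max_eq_right hst.le, div_self (hs.trans hst).ne', log_one]

lemma lphi_low {s t r : ℝ} (hst : s < t) (hr : r ≤ s) : lphi s t r = log (t / s) := by
  unfold lphi; rw [min_eq_left (hr.trans hst.le), max_eq_left hr]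
lemma lphi_mid {s t r : ℝ} (h1 : s ≤ r) (h2 : r ≤ t) : lphi s t r = log (t / r) := by
  unfold lphi; rw [min_eq_left h2, max_eq_right h1]

lemma lphi_nn {s t r : ℝ} (hs : 0 < s) (hst : s < t) : 0 ≤ lphi s t r := by
  unfold lphi
  refine log_nonneg ?_
  rw [le_div_iff₀ (lt_max_of_lt_left hs), one_mul]
  exact max_le hst.le (min_le_right _ _)

lemma lphi_le {s t r : ℝ} (hs : 0 < s) (hst : s < t) : lphi s t r ≤ log (t / s) := by
  unfold lphi
  have := hs.trans hst
  refine log_le_log (div_pos this (lt_max_of_lt_left hs)) ?_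
  exact div_le_div_of_nonneg_left this.le hs (le_max_left _ _)

lemma lphi_deriv {s t r : ℝ} (hs : 0 < s) (hst : s < t) (h1 : r ≠ s) (h2 : r ≠ t) :
    deriv (lphi s t) r = (Set.Ioc s t).indicator (fun r => - r⁻¹) r := by
  rcases lt_or_gt_of_ne h1 with h | h
  · have : lphi s t =ᶠ[𝓝 r] fun _ => log (t / s) := by
      filter_upwards [gt_mem_nhds h] with x hx using lphi_low hst hx.le
    rw [this.deriv_eq, Set.indicator_of_notMem (fun hh => by linarith [hh.1])]; simp
  · rcases lt_or_gt_of_ne h2 with h' | h'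
    · have : lphi s t =ᶠ[𝓝 r] fun x => log t - log x := by
        filter_upwards [lt_mem_nhds h, gt_mem_nhds h'] with x hx hx'
        rw [lphi_mid hx.le hx'.le, log_div (hs.trans hst).ne' (hs.trans hx).ne']
      rw [this.deriv_eq, Set.indicator_of_mem (show r ∈ Set.Ioc s t from ⟨h, h'.le⟩)]
      simp
    · rw [(lphi_prof hs hst).dsup h', Set.indicator_of_notMem (fun hh => by linarith [hh.2])]
end

noncomputable section
open MeasureTheory Real Filter
open scoped Pointwise ENNReal NNReal Topology
set_option linter.all false
set_option linter.deprecated false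

lemma Prof.add {k f : ℝ → ℝ} {L L' : ℝ≥0} {R R' : ℝ} (h : Prof k L R) (h' : Prof f L' R') : Prof (fun r => k r + f r) (L + L') (max R R') :=
  ⟨h.lip.add h'.lip, fun r hr => by rw [h.sup r ((le_max_left _ _).trans hr), h'.sup r ((le_max_right _ _).trans hr), add_zero]⟩

lemma Prof.int_kf {k f : ℝ → ℝ} {L L' : ℝ≥0} {R R' : ℝ} (h : Prof k L R) (h' : Prof f L' R') (n : ℕ) :
    IntegrableOn (fun r => r * k r ^ n * f r) (Set.Ioi 0) := by
  obtain ⟨B, hB⟩ := (isCompact_Icc (a := (0:ℝ)) (b := R')).exists_bound_of_continuousOn (f := fun r => r * k r ^ n) (by have := h.lip.continuous; fun_prop)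
  have := h'.int_mul (w := fun r => r * k r ^ n) (by have := h.lip.continuous.measurable; fun_prop) (B := B) (fun r h1 h2 => hB r ⟨h1.le, h2⟩) 1 one_ne_zero
  simpa using this

lemma Prof.int_dd {k f : ℝ → ℝ} {L L' : ℝ≥0} {R R' : ℝ} (h : Prof k L R) (h' : Prof f L' R') :
    IntegrableOn (fun r => r * (deriv k r * deriv f r)) (Set.Ioi 0) := by
  refine intOn_bdd (B := R * (L * L')) (R := R) (by have := measurable_deriv k; have := measurable_deriv f; fun_prop) ?_ ?_
  · intro r hr hrR
    rw [abs_mul, abs_mul, abs_of_pos hr]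
    have := h.dbd r
    have := h'.dbd r
    gcongr
    linarith
  · intro r hr; rw [h.dsup hr]; simp

lemma G1_add {k f : ℝ → ℝ} {L L' : ℝ≥0} {R R' : ℝ} (h : Prof k L R) (h' : Prof f L' R') (c : ℝ) :
    G1 (fun r => k r + c * f r) = G1 k + 2 * c * (∫ r in Set.Ioi (0:ℝ), r * (deriv k r * deriv f r)) + c ^ 2 * G1 f := by
  unfold G1
  have i1 := h.int_d
  have i2 := (h.int_dd h').const_mul (2 * c)
  have i3 := (h'.int_d).const_mul (c ^ 2)
  have i12 : Integrable (fun r => r * deriv k r ^ 2 + 2 * c * (r * (deriv k r * deriv f r))) (volume.restrict (Set.Ioi (0:ℝ))) := i1.add i2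
  rw [← integral_const_mul, ← integral_const_mul, ← integral_add i1 i2, ← integral_add i12 i3]
  refine integral_congr_ae (ae_restrict_of_ae ?_)
  filter_upwards [h.lip.ae_differentiableAt_real, h'.lip.ae_differentiableAt_real] with r h1 h2
  have : deriv (fun r => k r + c * f r) r = deriv k r + c * deriv f r := (h1.hasDerivAt.add (h2.hasDerivAt.const_mul c)).deriv
  simp only [this]; ring

lemma M1_add {k f : ℝ → ℝ} {L L' : ℝ≥0} {R R' : ℝ} (h : Prof k L R) (h' : Prof f L' R') (c : ℝ) :
    M1 (fun r => k r + c * f r) = M1 k + 2 * c * (∫ r in Set.Ioi (0:ℝ), r * k r * f r) + c ^ 2 * M1 f := by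
  unfold M1
  have i1 := h.int_pow 2 two_ne_zero
  have i2 := (h.int_kf h' 1).const_mul (2 * c)
  simp only [pow_one] at i2
  have i3 := (h'.int_pow 2 two_ne_zero).const_mul (c ^ 2)
  have i12 : Integrable (fun r => r * k r ^ 2 + 2 * c * (r * k r * f r)) (volume.restrict (Set.Ioi (0:ℝ))) := i1.add i2
  rw [← integral_const_mul, ← integral_const_mul, ← integral_add i1 i2, ← integral_add i12 i3]
  congr 1; ext r; ring

lemma F1_add {k f : ℝ → ℝ} {L L' : ℝ≥0} {R R' : ℝ} (h : Prof k L R) (h' : Prof f L' R') (c : ℝ) :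
    F1 k + 4 * c * (∫ r in Set.Ioi (0:ℝ), r * k r ^ 3 * f r) ≤ F1 (fun r => k r + c * f r) := by
  unfold F1
  have i1 := h.int_pow 4 four_ne_zero
  have i2 := (h.int_kf h' 3).const_mul (4 * c)
  rw [← integral_const_mul, ← integral_add i1 i2]
  refine setIntegral_mono_on (i1.add i2) ((h.add (h'.smul c)).int_pow 4 four_ne_zero) measurableSet_Ioi fun r hr => ?_
  have hr0 : (0:ℝ) < r := hr
  have : r * (k r + c * f r) ^ 4 - (r * k r ^ 4 + 4 * c * (r * k r ^ 3 * f r)) = r * ((c * f r) ^ 2 * (2 * k r ^ 2 + (2 * k r + c * f r) ^ 2)) := by ring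
  have : 0 ≤ r * ((c * f r) ^ 2 * (2 * k r ^ 2 + (2 * k r + c * f r) ^ 2)) := by positivity
  linarith

lemma Dec.var {k f : ℝ → ℝ} {L' : ℝ≥0} {R' : ℝ} (hk : Dec k) (h' : Prof f L' R') (c : ℝ) :
    4 * F1 k + 16 * c * (∫ r in Set.Ioi (0:ℝ), r * k r ^ 3 * f r) ≤
      SS * (2 + 2 * c * ((∫ r in Set.Ioi (0:ℝ), r * (deriv k r * deriv f r)) + ∫ r in Set.Ioi (0:ℝ), r * k r * f r) + c ^ 2 * (G1 f + M1 f)) ^ 2 := by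
  obtain ⟨L, R, h⟩ := hk.prof
  have h1 := (h.add (h'.smul c)).le_SS
  have h2 := F1_add h h' c
  have h3 : SS * (G1 (fun r => k r + c * f r) + M1 (fun r => k r + c * f r)) ^ 2 ≤ SS * (2 + 2 * c * ((∫ r in Set.Ioi (0:ℝ), r * (deriv k r * deriv f r)) + ∫ r in Set.Ioi (0:ℝ), r * k r * f r) + c ^ 2 * (G1 f + M1 f)) ^ 2 := by
    have hSS := SS_pos.le
    have := G1_nn (fun r => k r + c * f r)
    have := M1_nn (fun r => k r + c * f r)
    have h4 := hk.nrm
    refine mul_le_mul_of_nonneg_left (pow_le_pow_left₀ (by positivity) ?_ 2) hSS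
    rw [G1_add h h', M1_add h h']
    linarith
  linarith

lemma dd_lphi {k : ℝ → ℝ} {L : ℝ≥0} {R s t : ℝ} (h : Prof k L R) (hs : 0 < s) (hst : s < t) :
    ∫ r in Set.Ioi (0:ℝ), r * (deriv k r * deriv (lphi s t) r) = k s - k t := by
  have e1 : ∫ r in Set.Ioi (0:ℝ), r * (deriv k r * deriv (lphi s t) r) = ∫ r in Set.Ioi (0:ℝ), (Set.Ioc s t).indicator (fun r => - deriv k r) r := by
    refine setIntegral_congr_ae measurableSet_Ioi ?_
    have a1 : ∀ᵐ r : ℝ, r ≠ s := by simp [ae_iff]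
    have a2 : ∀ᵐ r : ℝ, r ≠ t := by simp [ae_iff]
    filter_upwards [a1, a2] with r h1 h2 hr
    have hr0 : (0:ℝ) < r := hr
    rw [lphi_deriv hs hst h1 h2]
    by_cases hm : r ∈ Set.Ioc s t
    · rw [Set.indicator_of_mem hm, Set.indicator_of_mem hm]; field_simp
    · rw [Set.indicator_of_notMem hm, Set.indicator_of_notMem hm]; simp
  rw [e1, setIntegral_indicator measurableSet_Ioc, show Set.Ioi 0 ∩ Set.Ioc s t = Set.Ioc s t from Set.inter_eq_right.2 (fun x hx => hs.trans hx.1), ← intervalIntegral.integral_of_le hst.le,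
    intervalIntegral.integral_neg, h.ftc]
  ring

lemma dct_lphi {k : ℕ → ℝ → ℝ} {h : ℝ → ℝ} (hk : ∀ n, Dec (k n)) (hl : ∀ r, 0 < r → Tendsto (fun n => k n r) atTop (𝓝 (h r)))
    {s t : ℝ} (hs : 0 < s) (hst : s < t) (m : ℕ) {B : ℝ} (hB : ∀ n r, 0 < r → r * k n r ^ m ≤ B) :
    Tendsto (fun n => ∫ r in Set.Ioi (0:ℝ), r * k n r ^ m * lphi s t r) atTop (𝓝 (∫ r in Set.Ioi (0:ℝ), r * h r ^ m * lphi s t r)) := by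
  have hb : IntegrableOn (fun r => B * lphi s t r ^ 1) (Set.Ioi 0) :=
    (lphi_prof hs hst).int_mul (w := fun _ => B) measurable_const (B := |B|) (fun _ _ _ => le_rfl) 1 one_ne_zero
  refine tendsto_integral_of_dominated_convergence (fun r => B * lphi s t r ^ 1) (fun n => ?_) hb (fun n => ?_) ?_
  · obtain ⟨L, R, hp⟩ := (hk n).prof
    exact (hp.int_kf (lphi_prof hs hst) m).aestronglyMeasurable
  · refine (ae_restrict_iff' measurableSet_Ioi).2 (Eventually.of_forall fun r hr => ?_)
    have hr0 : (0:ℝ) < r := hr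
    have h1 := hB n r hr0
    have h2 := (hk n).nn r
    have h3 := lphi_nn (r := r) hs hst
    rw [Real.norm_eq_abs, abs_of_nonneg (by positivity), pow_one]
    gcongr
  · exact (ae_restrict_iff' measurableSet_Ioi).2 (Eventually.of_forall fun r hr => (((hl r hr).pow m).const_mul r).mul_const _)

lemma poly_aux {S A B D : ℝ} (hS : 0 < S) (h : ∀ c : ℝ, 4 * S + 16 * c * D ≤ S * (2 + 2 * c * A + c ^ 2 * B) ^ 2) : 2 * D = S * A := by
  have hd : HasDerivAt (fun c : ℝ => S * (2 + 2 * c * A + c ^ 2 * B) ^ 2 - 4 * S - 16 * c * D) (8 * S * A - 16 * D) 0 := by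
    have h1 : HasDerivAt (fun c : ℝ => 2 + 2 * c * A + c ^ 2 * B) (2 * A) 0 := by
      have := (((hasDerivAt_id (0:ℝ)).const_mul 2).mul_const A).const_add 2 |>.add (((hasDerivAt_id (0:ℝ)).pow 2).mul_const B)
      refine this.congr_deriv ?_
      simp
    have h2 := (((h1.pow 2).const_mul S).sub_const (4 * S)).sub (((hasDerivAt_id (0:ℝ)).const_mul 16).mul_const D)
    refine h2.congr_deriv ?_
    simp; ring
  have hm : IsLocalMin (fun c : ℝ => S * (2 + 2 * c * A + c ^ 2 * B) ^ 2 - 4 * S - 16 * c * D) 0 := by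
    refine Eventually.of_forall fun c => ?_
    have := h c
    simp only [mul_zero, zero_mul, add_zero, ne_eq, OfNat.ofNat_ne_zero, not_false_eq_true, zero_pow]
    linarith
  have := hm.hasDerivAt_eq_zero hd
  linarith

lemma weak_eq {k : ℕ → ℝ → ℝ} {h : ℝ → ℝ} (hk : ∀ n, Dec (k n)) (hl : ∀ r, 0 < r → Tendsto (fun n => k n r) atTop (𝓝 (h r)))
    (hF : Tendsto (fun n => F1 (k n)) atTop (𝓝 SS)) {s t : ℝ} (hs : 0 < s) (hst : s < t) :
    2 * (∫ r in Set.Ioi (0:ℝ), r * h r ^ 3 * lphi s t r) = SS * ((h s - h t) + ∫ r in Set.Ioi (0:ℝ), r * h r * lphi s t r) := by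
  have t3 := dct_lphi hk hl hs hst 3 (B := 626) (fun n r hr => ((hk n).b3 hr).2)
  have t1 := dct_lphi hk hl hs hst 1 (B := 2) (fun n r hr => by rw [pow_one]; exact (hk n).b1 hr)
  simp only [pow_one] at t1
  refine poly_aux (B := G1 (lphi s t) + M1 (lphi s t)) SS_pos fun c => ?_
  have e1 : Tendsto (fun n => 4 * F1 (k n) + 16 * c * (∫ r in Set.Ioi (0:ℝ), r * k n r ^ 3 * lphi s t r)) atTop
    (𝓝 (4 * SS + 16 * c * (∫ r in Set.Ioi (0:ℝ), r * h r ^ 3 * lphi s t r))) := (hF.const_mul 4).add (t3.const_mul _)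
  have e2 : Tendsto (fun n => SS * (2 + 2 * c * ((k n s - k n t) + ∫ r in Set.Ioi (0:ℝ), r * k n r * lphi s t r) + c ^ 2 * (G1 (lphi s t) + M1 (lphi s t))) ^ 2) atTop
    (𝓝 (SS * (2 + 2 * c * ((h s - h t) + ∫ r in Set.Ioi (0:ℝ), r * h r * lphi s t r) + c ^ 2 * (G1 (lphi s t) + M1 (lphi s t))) ^ 2)) :=
    ((((((hl s hs).sub (hl t (hs.trans hst))).add t1).const_mul _).const_add 2 |>.add_const _).pow 2).const_mul _
  refine le_of_tendsto_of_tendsto' e1 e2 fun n => ?_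
  obtain ⟨L, R, hp⟩ := (hk n).prof
  have := (hk n).var (lphi_prof hs hst) c
  rwa [dd_lphi hp hs hst] at this
end

noncomputable section
open MeasureTheory Real Filter
open scoped Pointwise ENNReal NNReal Topology
set_option linter.all false
set_option linter.deprecated false

def kap (h : ℝ → ℝ) (r : ℝ) : ℝ := r * ((2 / SS) * h r ^ 3 - h r)
def KK (h : ℝ → ℝ) (s : ℝ) : ℝ := ∫ r in (0:ℝ)..s, kap h r

def WE (h : ℝ → ℝ) : Prop := ∀ s t, 0 < s → s < t →
  2 * (∫ r in Set.Ioi (0:ℝ), r * h r ^ 3 * lphi s t r) = SS * ((h s - h t) + ∫ r in Set.Ioi (0:ℝ), r * h r * lphi s t r)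

lemma LimP.kap_cont {h : ℝ → ℝ} (H : LimP h) : ContinuousOn (kap h) (Set.Ioi 0) := by
  have := H.cont
  unfold kap
  fun_prop

lemma LimP.kap_bd {h : ℝ → ℝ} (H : LimP h) : ∃ B, 0 < B ∧ ∀ r, 0 < r → |kap h r| ≤ B := by
  have hS := SS_pos
  refine ⟨2 / SS * 626 + 2, by positivity, fun r hr => ?_⟩
  have h0 := H.nn r hr
  have h1 := H.b1 r hr
  have h3 := H.b3 r hr
  have e : kap h r = 2 / SS * (r * h r ^ 3) - r * h r := by unfold kap; ring
  have : 2 / SS * (r * h r ^ 3) ≤ 2 / SS * 626 := by gcongr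
  have : 0 ≤ 2 / SS * (r * h r ^ 3) := by positivity
  have : 0 ≤ r * h r := by positivity
  rw [e, abs_le]; constructor <;> linarith

lemma LimP.int_lphi {h : ℝ → ℝ} {s t : ℝ} (hs : 0 < s) (hst : s < t) {w : ℝ → ℝ} (hw : ContinuousOn w (Set.Ioi 0)) {B : ℝ} (hB : ∀ r, 0 < r → |w r| ≤ B) :
    IntegrableOn (fun r => w r * lphi s t r) (Set.Ioi 0) := by
  have hp := lphi_prof hs hst
  have hB0 : 0 ≤ B := (abs_nonneg _).trans (hB 1 one_pos)
  refine intOn_bdd (B := B * log (t / s)) (R := t) ?_ ?_ ?_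
  · exact (hw.aestronglyMeasurable measurableSet_Ioi).mul hp.lip.continuous.aestronglyMeasurable
  · intro r hr _
    rw [abs_mul, abs_of_nonneg (lphi_nn hs hst)]
    exact mul_le_mul (hB r hr) (lphi_le hs hst) (lphi_nn hs hst) hB0
  · intro r hr; rw [hp.sup r hr.le, mul_zero]

lemma LimP.kap_int {h : ℝ → ℝ} (H : LimP h) {s t : ℝ} (hs : 0 ≤ s) (ht : 0 ≤ t) : IntervalIntegrable (kap h) volume s t := by
  obtain ⟨B, hB0, hB⟩ := H.kap_bd
  have key : ∀ t, 0 ≤ t → IntervalIntegrable (kap h) volume 0 t := by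
    intro t ht
    rw [intervalIntegrable_iff_integrableOn_Ioc_of_le ht]
    refine Integrable.mono' (g := fun _ => B) (by simp) ?_ ?_
    · exact (H.kap_cont.aestronglyMeasurable measurableSet_Ioi).mono_set Set.Ioc_subset_Ioi_self
    · exact (ae_restrict_iff' measurableSet_Ioc).2 (Eventually.of_forall fun r hr => hB r hr.1)
  exact (key s hs).symm.trans (key t ht)

lemma LimP.rep {h : ℝ → ℝ} (H : LimP h) (W : WE h) {s t : ℝ} (hs : 0 < s) (hst : s < t) :
    h t = h s - (log t * KK h t - log s * KK h s - ∫ r in s..t, kap h r * log r) := by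
  have hS := SS_pos
  have ht : 0 < t := hs.trans hst
  have w := W s t hs hst
  have c3 : ContinuousOn (fun r => r * h r ^ 3) (Set.Ioi 0) := by have := H.cont; fun_prop
  have c1 : ContinuousOn (fun r => r * h r) (Set.Ioi 0) := by have := H.cont; fun_prop
  have i3 : IntegrableOn (fun r => r * h r ^ 3 * lphi s t r) (Set.Ioi 0) := LimP.int_lphi (h := h) hs hst c3 (B := 626) fun r hr => by
    have := H.nn r hr; rw [abs_of_nonneg (by positivity)]; exact H.b3 r hr
  have i1 : IntegrableOn (fun r => r * h r * lphi s t r) (Set.Ioi 0) := LimP.int_lphi (h := h) hs hst c1 (B := 2) fun r hr => by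
    have := H.nn r hr; rw [abs_of_nonneg (by positivity)]; exact H.b1 r hr
  have e1 : h s - h t = ∫ r in Set.Ioi (0:ℝ), kap h r * lphi s t r := by
    have : ∀ r, kap h r * lphi s t r = 2 / SS * (r * h r ^ 3 * lphi s t r) - r * h r * lphi s t r := fun r => by unfold kap; ring
    simp only [this]
    rw [integral_sub (i3.const_mul _) i1, integral_const_mul]
    field_simp
    linarith
  have e2 : ∫ r in Set.Ioi (0:ℝ), kap h r * lphi s t r = ∫ r in (0:ℝ)..t, kap h r * lphi s t r := by
    rw [intervalIntegral.integral_of_le ht.le]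
    refine (setIntegral_eq_of_subset_of_forall_diff_eq_zero measurableSet_Ioi Set.Ioc_subset_Ioi_self fun r hr => ?_)
    have : t < r := by
      by_contra hc; push Not at hc; exact hr.2 ⟨hr.1, hc⟩
    rw [(lphi_prof hs hst).sup r this.le, mul_zero]
  obtain ⟨B, hB0, hB⟩ := H.kap_bd
  have ii : ∀ a b, 0 ≤ a → 0 ≤ b → IntervalIntegrable (fun r => kap h r * lphi s t r) volume a b := fun a b ha hb =>
    (H.kap_int ha hb).mul_continuousOn (lphi_prof hs hst).lip.continuous.continuousOn
  have ilog : IntervalIntegrable (fun r => kap h r * log r) volume s t := by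
    refine (H.kap_int hs.le ht.le).mul_continuousOn ?_
    rw [Set.uIcc_of_le hst.le]
    exact continuousOn_log.mono fun r hr => (hs.trans_le hr.1).ne'
  have e3 : ∫ r in (0:ℝ)..s, kap h r * lphi s t r = KK h s * (log t - log s) := by
    unfold KK
    rw [← intervalIntegral.integral_mul_const]
    refine intervalIntegral.integral_congr fun r hr => ?_
    rw [Set.uIcc_of_le hs.le] at hr
    rw [lphi_low hst hr.2, log_div ht.ne' hs.ne']
  have e4 : ∫ r in s..t, kap h r * lphi s t r = (∫ r in s..t, kap h r) * log t - ∫ r in s..t, kap h r * log r := by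
    rw [← intervalIntegral.integral_mul_const, ← intervalIntegral.integral_sub ((H.kap_int hs.le ht.le).mul_const _) ilog]
    refine intervalIntegral.integral_congr fun r hr => ?_
    rw [Set.uIcc_of_le hst.le] at hr
    rw [lphi_mid hr.1 hr.2, log_div ht.ne' (hs.trans_le hr.1).ne']; ring
  have e5 : KK h t = KK h s + ∫ r in s..t, kap h r := by
    unfold KK
    rw [intervalIntegral.integral_add_adjacent_intervals (H.kap_int le_rfl hs.le) (H.kap_int hs.le ht.le)]
  rw [e2, ← intervalIntegral.integral_add_adjacent_intervals (ii 0 s le_rfl hs.le) (ii s t hs.le ht.le), e3, e4] at e1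
  rw [e5]
  linarith

lemma LimP.KK_deriv {h : ℝ → ℝ} (H : LimP h) {t : ℝ} (ht : 0 < t) : HasDerivAt (KK h) (kap h t) t := by
  refine intervalIntegral.integral_hasDerivAt_right (H.kap_int le_rfl ht.le) ?_ (H.kap_cont.continuousAt (Ioi_mem_nhds ht))
  exact H.kap_cont.stronglyMeasurableAtFilter isOpen_Ioi t ht

lemma LimP.h_deriv {h : ℝ → ℝ} (H : LimP h) (W : WE h) {t : ℝ} (ht : 0 < t) : HasDerivAt h (-(KK h t / t)) t := by
  have hs : 0 < t / 2 := by positivity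
  have hst : t / 2 < t := by linarith
  have d1 : HasDerivAt (fun t' => ∫ r in (t/2)..t', kap h r * log r) (kap h t * log t) t := by
    have cc : ContinuousOn (fun r => kap h r * log r) (Set.Ioi 0) := H.kap_cont.mul (continuousOn_log.mono fun r hr => (ne_of_gt hr))
    refine intervalIntegral.integral_hasDerivAt_right ?_ (cc.stronglyMeasurableAtFilter isOpen_Ioi t ht) (cc.continuousAt (Ioi_mem_nhds ht))
    refine (cc.mono ?_).intervalIntegrable
    rw [Set.uIcc_of_le hst.le]; intro r hr; exact hs.trans_le hr.1
  have d2 := (((((hasDerivAt_log ht.ne').mul (H.KK_deriv ht)).sub_const (log (t/2) * KK h (t/2))).sub d1).const_sub (h (t/2)))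
  have d3 := d2.congr_of_eventuallyEq (f₁ := h) (by
    filter_upwards [lt_mem_nhds hst] with x hx
    exact H.rep W hs hx)
  refine d3.congr_deriv ?_
  field_simp
  ring

lemma LimP.h1_deriv {h : ℝ → ℝ} (H : LimP h) {t : ℝ} (ht : 0 < t) :
    HasDerivAt (fun t => -(KK h t / t)) (h t - 2 / SS * h t ^ 3 - (-(KK h t / t)) / t) t := by
  refine ((H.KK_deriv ht).div (hasDerivAt_id t) ht.ne').neg.congr_deriv ?_
  simp only [id, kap]
  field_simp
  ring

lemma LimP.KK_le {h : ℝ → ℝ} (H : LimP h) {B : ℝ} {m s : ℝ} (hs : 0 ≤ s) (hB : ∀ r, 0 < r → r ≤ s → |kap h r| ≤ B) : |KK h s| ≤ B * s := by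
  have := intervalIntegral.norm_integral_le_of_norm_le_const (a := 0) (b := s) (f := kap h) (C := B) (fun r hr => by
    rw [Set.uIoc_of_le hs] at hr; exact hB r hr.1 hr.2)
  simpa [KK, abs_of_nonneg hs] using this

lemma LimP.pos {h : ℝ → ℝ} (H : LimP h) (W : WE h) (hF : F1 h = SS) : ∀ r, 0 < r → 0 < h r := by
  intro s0 hs0
  refine lt_of_le_of_ne (H.nn s0 hs0) fun hz => ?_
  have hS := SS_pos
  have hz : h s0 = 0 := hz.symm
  have hmin : IsLocalMin h s0 := by
    filter_upwards [lt_mem_nhds hs0] with x hx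
    rw [hz]; exact H.nn x hx
  have hd0 := hmin.hasDerivAt_eq_zero (H.h_deriv W hs0)
  have hall : ∀ s1, 0 < s1 → s1 ≤ s0 → h s1 = 0 := by
    intro s1 h1 h10
    set C : ℝ := 2 + (2 / SS) * (4 / s1 ^ 2) + 2 / s1 with hCdef
    set h' : ℝ → ℝ := fun t => -(KK h t / t) with hh'
    have hder : ∀ t, 0 < t → HasDerivAt (fun t => exp (C * t) * (h t ^ 2 + h' t ^ 2))
        (exp (C * t) * (C * (h t ^ 2 + h' t ^ 2) + (2 * h t * h' t + 2 * h' t * (h t - 2 / SS * h t ^ 3 - h' t / t)))) t := by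
      intro t ht
      have a1 := ((hasDerivAt_id t).const_mul C).exp
      have a2 := ((H.h_deriv W ht).pow 2).add ((H.h1_deriv ht).pow 2)
      refine (a1.mul a2).congr_deriv ?_
      simp only [Nat.cast_ofNat, Pi.pow_apply, Pi.add_apply, id, show (2-1:ℕ)=1 from rfl, pow_one, mul_one]
      simp only [hh']
      ring
    have hmono : MonotoneOn (fun t => exp (C * t) * (h t ^ 2 + h' t ^ 2)) (Set.Icc s1 s0) := by
      refine monotoneOn_of_hasDerivWithinAt_nonneg (convex_Icc _ _) (fun t ht => ((hder t (h1.trans_le ht.1)).continuousAt).continuousWithinAt)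
        (fun t ht => (hder t (by rw [interior_Icc] at ht; exact h1.trans ht.1)).hasDerivWithinAt) ?_
      intro t ht
      rw [interior_Icc] at ht
      have ht0 : 0 < t := h1.trans ht.1
      refine mul_nonneg (exp_pos _).le ?_
      have b0 := H.nn t ht0
      have b1 : h t ≤ 2 / s1 := by
        rw [le_div_iff₀ h1]
        have := H.b1 t ht0
        nlinarith [ht.1]
      have b2 : h t ^ 2 ≤ 4 / s1 ^ 2 := by
        calc h t ^ 2 ≤ (2 / s1) ^ 2 := by gcongr
          _ = 4 / s1 ^ 2 := by rw [div_pow]; norm_num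
      have b3 : 1 / t ≤ 1 / s1 := one_div_le_one_div_of_le h1 ht.1.le
      have e1 : 2 * h' t * (h' t / t) ≤ 2 / s1 * (h t ^ 2 + h' t ^ 2) := by
        have : 2 * h' t * (h' t / t) = 2 * h' t ^ 2 * (1 / t) := by ring
        rw [this]
        have : 2 * h' t ^ 2 * (1 / t) ≤ 2 * h' t ^ 2 * (1 / s1) := by gcongr
        have : 0 ≤ 2 / s1 * h t ^ 2 := by positivity
        have e : 2 / s1 * (h t ^ 2 + h' t ^ 2) = 2 / s1 * h t ^ 2 + 2 * h' t ^ 2 * (1 / s1) := by ring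
        linarith
      have e2 : 2 * h' t * (2 / SS * h t ^ 3) ≤ (2 / SS) * (4 / s1 ^ 2) * (h t ^ 2 + h' t ^ 2) := by
        have c1 : 2 * h' t * (2 / SS * h t ^ 3) = (2 / SS) * (h t ^ 2 * (2 * h t * h' t)) := by ring
        have c2 : h t ^ 2 * (2 * h t * h' t) ≤ h t ^ 2 * (h t ^ 2 + h' t ^ 2) := by
          gcongr; nlinarith [sq_nonneg (h t - h' t)]
        have c3 : h t ^ 2 * (h t ^ 2 + h' t ^ 2) ≤ 4 / s1 ^ 2 * (h t ^ 2 + h' t ^ 2) := by gcongr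
        rw [c1, mul_assoc (2 / SS) (4 / s1 ^ 2)]
        exact mul_le_mul_of_nonneg_left (c2.trans c3) (show (0:ℝ) ≤ 2 / SS by positivity)
      have e3 : 0 ≤ 4 * h t * h' t + 2 * (h t ^ 2 + h' t ^ 2) := by nlinarith [sq_nonneg (h t + h' t)]
      have : C * (h t ^ 2 + h' t ^ 2) = 2 * (h t ^ 2 + h' t ^ 2) + (2 / SS) * (4 / s1 ^ 2) * (h t ^ 2 + h' t ^ 2) + 2 / s1 * (h t ^ 2 + h' t ^ 2) := by rw [hCdef]; ring
      linarith
    have := hmono (Set.left_mem_Icc.2 h10) (Set.right_mem_Icc.2 h10) h10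
    simp only at this
    rw [hz, show h' s0 = 0 from hd0] at this
    have h3 := exp_pos (C * s1)
    have h4 : h s1 ^ 2 + h' s1 ^ 2 ≤ 0 := by
      by_contra hc; push Not at hc
      have := mul_pos h3 hc
      norm_num at *
      linarith
    have : h s1 ^ 2 = 0 := by nlinarith [sq_nonneg (h s1), sq_nonneg (h' s1)]
    exact pow_eq_zero_iff two_ne_zero |>.1 this
  have hz2 : ∀ r, 0 < r → h r = 0 := by
    intro r hr
    rcases le_total r s0 with h1 | h1
    · exact hall r hr h1
    · exact le_antisymm (hz ▸ H.anti s0 r hs0 h1) (H.nn r hr)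
  have : F1 h = 0 := by
    unfold F1
    rw [setIntegral_congr_fun measurableSet_Ioi (g := fun _ => (0:ℝ)) (fun r hr => by simp only; rw [hz2 r hr]; ring)]
    simp
  linarith

lemma LimP.sol {h : ℝ → ℝ} (H : LimP h) (W : WE h) (hF : F1 h = SS) : Sol (fun r => √(2 / SS) * h r) (fun r => √(2 / SS) * (-(KK h r / r))) := by
  have hS := SS_pos
  have hpos := H.pos W hF
  set c := √(2 / SS) with hc
  have hc2 : c ^ 2 = 2 / SS := sq_sqrt (by positivity)
  have hc0 : 0 < c := sqrt_pos.2 (by positivity)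
  obtain ⟨B, hB0, hB⟩ := H.kap_bd
  -- boundedness near zero
  have hd : ∀ r, 0 < r → |-(KK h r / r)| ≤ B := by
    intro r hr
    rw [abs_neg, abs_div, abs_of_pos hr, div_le_iff₀ hr]
    exact H.KK_le (m := 0) hr.le fun x hx _ => hB x hx
  have hbd : ∀ r, 0 < r → r ≤ 1 → h r ≤ h 1 + B := by
    intro r hr hr1
    rcases hr1.eq_or_lt with rfl | hr1
    · linarith
    obtain ⟨x, hx, e⟩ := exists_hasDerivAt_eq_slope h (fun r => -(KK h r / r)) hr1 (fun y hy => (H.h_deriv W (hr.trans_le hy.1)).continuousAt.continuousWithinAt)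
      fun y hy => H.h_deriv W (hr.trans hy.1)
    have h2 := abs_le.1 (hd x (hr.trans hx.1))
    rw [e] at h2
    have h3 := h2.1
    rw [le_div_iff₀ (by linarith)] at h3
    nlinarith
  have hB1 : 0 < h 1 + B := by have := hpos 1 one_pos; positivity
  refine ⟨fun r hr => mul_pos hc0 (hpos r hr), fun r hr => (H.h_deriv W hr).const_mul c, fun r hr => ?_, ?_, ?_, ?_⟩
  · refine ((H.h1_deriv hr).const_mul c).congr_deriv ?_
    rw [← hc2]; ring
  · set S := h '' (Set.Ioo 0 1) with hSdef
    have hSb : BddAbove S := ⟨h 1 + B, by rintro _ ⟨r, hr, rfl⟩; exact hbd r hr.1 hr.2.le⟩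
    have ht : Tendsto h (𝓝[>] 0) (𝓝 (sSup S)) := by
      rw [← nhdsWithin_Ioo_eq_nhdsGT (show (0:ℝ) < 1 by norm_num)]
      rw [tendsto_order]
      constructor
      · intro a ha
        obtain ⟨_, ⟨x, hx, rfl⟩, hax⟩ := exists_lt_of_lt_csSup (⟨_, ⟨1/2, by norm_num, rfl⟩⟩ : S.Nonempty) ha
        rw [nhdsWithin_Ioo_eq_nhdsGT (show (0:ℝ) < 1 by norm_num)]
        filter_upwards [Ioo_mem_nhdsGT hx.1] with y hy
        exact hax.trans_le (H.anti y x hy.1 hy.2.le)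
      · intro a ha
        filter_upwards [self_mem_nhdsWithin] with y hy
        exact (le_csSup hSb ⟨y, hy, rfl⟩).trans_lt ha
    refine ⟨c * sSup S, mul_pos hc0 ?_, ht.const_mul c⟩
    exact (hpos (1/2) (by norm_num)).trans_le (le_csSup hSb ⟨1/2, by norm_num, rfl⟩)
  · set D : ℝ := 2 / SS * (h 1 + B) ^ 3 + (h 1 + B) with hD
    have hk : ∀ s, 0 < s → s ≤ 1 → |c * (-(KK h s / s))| ≤ c * D * s := by
      intro s hs hs1
      have : |KK h s| ≤ D * s * s := by
        refine H.KK_le (m := 0) hs.le fun r hr hrs => ?_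
        have a1 := hbd r hr (hrs.trans hs1)
        have a0 := (hpos r hr).le
        unfold kap
        rw [abs_mul, abs_of_pos hr, mul_comm]
        have : |2 / SS * h r ^ 3 - h r| ≤ D := by
          have b1 : 2 / SS * h r ^ 3 ≤ 2 / SS * (h 1 + B) ^ 3 := by gcongr
          have b2 : 0 ≤ 2 / SS * h r ^ 3 := by positivity
          rw [abs_le, hD]; constructor
          · have : 0 ≤ 2 / SS * (h 1 + B) ^ 3 := by positivity
            linarith
          · linarith
        have : 0 ≤ D := by positivity
        gcongr
      rw [abs_mul, abs_of_pos hc0, abs_neg, abs_div, abs_of_pos hs, mul_assoc]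
      gcongr
      rw [div_le_iff₀ hs]; exact this
    refine squeeze_zero_norm' (a := fun s => c * D * s) ?_ ?_
    · filter_upwards [Ioo_mem_nhdsGT (show (0:ℝ) < 1 by norm_num)] with s hs using hk s hs.1 hs.2.le
    · refine tendsto_nhdsWithin_of_tendsto_nhds ?_
      have : Continuous fun s : ℝ => c * D * s := by fun_prop
      simpa using this.tendsto 0
  · intro e he R
    set T := max R 0 + 2 * c / e + 1 with hT
    have hT0 : 0 < T := by positivity
    have hTR : R < T := by have := le_max_left R 0; have : 0 < 2 * c / e := by positivity
                           linarith
    have hsm : ∀ r, T ≤ r → c * h r < e := by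
      intro r hr
      have hr0 : 0 < r := hT0.trans_le hr
      have b := H.b1 r hr0
      have : 2 * c / e < r := by
        have := le_max_right R 0
        linarith
      rw [div_lt_iff₀ he] at this
      have h2 : c * (r * h r) ≤ c * 2 := by gcongr
      by_contra hh; push Not at hh
      nlinarith
    obtain ⟨x, hx, e1⟩ := exists_hasDerivAt_eq_slope h (fun r => -(KK h r / r)) (show T < T + 1 by linarith) (fun y hy => (H.h_deriv W (hT0.trans_le hy.1)).continuousAt.continuousWithinAt)
      fun y hy => H.h_deriv W (hT0.trans hy.1)
    refine ⟨x, hTR.trans hx.1, hsm x hx.1.le, ?_⟩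
    rw [e1, abs_mul, abs_of_pos hc0, show T + 1 - T = 1 by ring, div_one]
    have a1 := H.anti T (T + 1) hT0 (by linarith)
    have a2 := H.nn (T + 1) (by linarith)
    rw [abs_of_nonpos (by linarith)]
    have := hsm T le_rfl
    nlinarith

/-- sharp radial Gagliardo-Nirenberg -/
theorem radialGN {Q : E2 → ℝ} (hQ : IsGroundState Q) {k : ℝ → ℝ} {L : ℝ≥0} {R : ℝ} (hk : Prof k L R) :
    (∫ x, Q x ^ 2) * F1 k ≤ π * (G1 k + M1 k) ^ 2 := by
  obtain ⟨f, h, hf, hF, hl⟩ := exists_lim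
  have H := LimP.of hf hl
  have W : WE h := fun s t hs hst => weak_eq hf hl hF hs hst
  have hFh := LimP.F1_eq hf hl hF
  have hS := SS_pos
  have hu := (H.sol W hFh).unique (GS_sol hQ)
  have e1 : F1 (prof Q) = 4 / SS := by
    have : F1 (prof Q) = F1 (fun r => √(2 / SS) * h r) := by
      unfold F1
      refine setIntegral_congr_fun measurableSet_Ioi fun r hr => ?_
      simp only
      rw [(hu r hr).1]
    rw [this, F1_smul, show √(2 / SS) ^ 4 = (√(2 / SS) ^ 2) ^ 2 by ring, sq_sqrt (by positivity), hFh]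
    field_simp; norm_num
  have e2 : ∫ x, Q x ^ 4 = 2 * π * F1 (prof Q) := by
    unfold F1
    rw [← radial_integral (fun r => prof Q r ^ 4)]
    congr 1; ext x
    rw [GS_radial hQ x]; rfl
  have e3 := GS_four hQ
  have e4 : (∫ x, Q x ^ 2) = 4 * π / SS := by
    rw [e2, e1] at e3
    have : 2 * π * (4 / SS) = 2 * (4 * π / SS) := by ring
    linarith
  have := hk.le_SS
  rw [e4, div_mul_eq_mul_div, div_le_iff₀ hS]
  nlinarith [pi_pos]

theorem Nice.GN {Q : E2 → ℝ} (hQ : IsGroundState Q) {f : E2 → ℝ} {L : ℝ≥0} {R B : ℝ} (hf : Nice f L R B) (hL : 0 < L) (hB : 0 ≤ B) (g : E2 → ℝ) (hg0 : ∀ x, 0 ≤ g x)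
    (hg : ∀ᵐ x, ∀ κ > g x, ∀ᶠ y in 𝓝 x, f y ≤ f x + κ * ‖y - x‖) (hgi : Integrable fun x => g x ^ 2) :
    2 * (∫ x, Q x ^ 2) * (∫ x, f x ^ 4) ≤ ((∫ x, g x ^ 2) + ∫ x, f x ^ 2) ^ 2 := by
  obtain ⟨hP, -, -, h1, h2, h3⟩ := hf.rearr1 hL hB g hg0 hg hgi
  have h4 := radialGN hQ hP
  have : (2 * π * G1 (hst f) + 2 * π * M1 (hst f)) ^ 2 ≤ ((∫ x, g x ^ 2) + ∫ x, f x ^ 2) ^ 2 := by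
    have := G1_nn (hst f)
    have := M1_nn (hst f)
    have := pi_pos
    refine pow_le_pow_left₀ (by positivity) ?_ 2
    linarith
  refine le_trans ?_ this
  rw [← h3]
  have := pi_pos
  nlinarith
end

noncomputable section
open MeasureTheory Real Filter
open scoped Pointwise ENNReal NNReal Topology Convolution
set_option linter.all false
set_option linter.deprecated false

lemma GN_C1 {Q : E2 → ℝ} (hQ : IsGroundState Q) {f : E2 → ℝ} (hf : ContDiff ℝ 1 f) (hc : HasCompactSupport f) :
    2 * (∫ x, Q x ^ 2) * (∫ x, f x ^ 4) ≤ ((∫ x, gradSq f x) + ∫ x, f x ^ 2) ^ 2 := by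
  obtain ⟨C, hC⟩ := hf.lipschitzWith_of_hasCompactSupport hc one_ne_zero
  obtain ⟨R, hR⟩ := hc.isCompact.isBounded.subset_ball (0:E2)
  obtain ⟨B, hB⟩ := hc.exists_bound_of_continuous hf.continuous
  have hN : Nice (fun x => |f x|) (C + 1) R B := by
    refine ⟨fun x => abs_nonneg _, ?_, fun x hx => ?_, fun x => hB x⟩
    · have h2 : LipschitzWith 1 (fun x : ℝ => |x|) := lipschitzWith_one_norm
      exact (h2.comp hC).weaken (by simp)
    · have : x ∉ tsupport f := fun h => by
        have := hR h; simp at this; linarith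
      simp [image_eq_zero_of_notMem_tsupport this]
  have hcd : HasCompactSupport (fderiv ℝ f) := hc.fderiv (𝕜 := ℝ)
  have hgi : Integrable (fun x => ‖fderiv ℝ f x‖ ^ 2) := by
    refine Continuous.integrable_of_hasCompactSupport ((hf.continuous_fderiv one_ne_zero).norm.pow 2) ?_
    exact hcd.comp_left (g := fun L => ‖L‖ ^ 2) (by simp)
  have := hN.GN hQ (by positivity) ((norm_nonneg _).trans (hB 0)) (fun x => ‖fderiv ℝ f x‖) (fun x => norm_nonneg _) ?_ hgi
  · have e4 : ∀ x, |f x| ^ 4 = f x ^ 4 := fun x => by rw [← abs_pow, abs_of_nonneg (by positivity)]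
    simp only [sq_abs, e4] at this
    exact this
  · refine Eventually.of_forall fun x κ hκ => ?_
    have hd := (hf.differentiable one_ne_zero x).hasFDerivAt.isLittleO.def (sub_pos.2 hκ)
    filter_upwards [hd] with y hy
    have h1 := (fderiv ℝ f x).le_opNorm (y - x)
    have h2 : |f y - f x| ≤ κ * ‖y - x‖ := by
      calc |f y - f x| = ‖(f y - f x - (fderiv ℝ f x) (y - x)) + (fderiv ℝ f x) (y - x)‖ := by simp
        _ ≤ _ := norm_add_le _ _
        _ ≤ (κ - ‖fderiv ℝ f x‖) * ‖y - x‖ + ‖fderiv ℝ f x‖ * ‖y - x‖ := add_le_add hy h1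
        _ = _ := by ring
    have := abs_sub_abs_le_abs_sub (f y) (f x)
    linarith

/-- weighted Cauchy-Schwarz -/
lemma jensen_sq {φ a : E2 → ℝ} (h0 : ∀ x, 0 ≤ φ x) (hφ : Integrable φ) (h1 : ∫ x, φ x = 1) (ha : AEStronglyMeasurable a) (h2 : Integrable fun x => φ x * a x ^ 2) :
    Integrable (fun x => φ x * a x) ∧ (∫ x, φ x * a x) ^ 2 ≤ ∫ x, φ x * a x ^ 2 := by
  have i1 : Integrable (fun x => φ x * a x) := by
    refine Integrable.mono' (hφ.add h2) (hφ.aestronglyMeasurable.mul ha) (Eventually.of_forall fun x => ?_)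
    rw [Real.norm_eq_abs, abs_mul, abs_of_nonneg (h0 x)]
    simp only [Pi.add_apply]
    have : |a x| ≤ 1 + a x ^ 2 := by
      rw [← sq_abs]; nlinarith [sq_nonneg (|a x| - 1), abs_nonneg (a x)]
    nlinarith [h0 x]
  refine ⟨i1, ?_⟩
  set c := ∫ x, φ x * a x with hc
  have e : ∫ x, φ x * (a x - c) ^ 2 = (∫ x, φ x * a x ^ 2) - 2 * c * c + c ^ 2 * 1 := by
    have : ∀ x, φ x * (a x - c) ^ 2 = φ x * a x ^ 2 - 2 * c * (φ x * a x) + c ^ 2 * φ x := fun x => by ring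
    simp only [this]
    have i2 := i1.const_mul (2 * c)
    have i3 := hφ.const_mul (c ^ 2)
    have i12 : Integrable (fun x => φ x * a x ^ 2 - 2 * c * (φ x * a x)) := h2.sub i2
    rw [integral_add i12 i3, integral_sub h2 i2, integral_const_mul, integral_const_mul, ← hc, h1]
  have : 0 ≤ ∫ x, φ x * (a x - c) ^ 2 := integral_nonneg fun x => mul_nonneg (h0 x) (sq_nonneg _)
  nlinarith

lemma conv_int {φ A : E2 → ℝ} (hφ : Integrable φ) (h1 : ∫ x, φ x = 1) (hA : Integrable A) :
    Integrable (fun x => ∫ t, φ t * A (x - t)) ∧ ∫ x, ∫ t, φ t * A (x - t) = ∫ x, A x := by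
  have := integral_convolution (μ := volume) (ν := volume) (ContinuousLinearMap.lsmul ℝ ℝ) hφ hA
  have i := hφ.integrable_convolution (ContinuousLinearMap.lsmul ℝ ℝ) hA
  simp only [convolution, ContinuousLinearMap.lsmul_apply, smul_eq_mul, h1, one_mul] at this i
  exact ⟨i, this⟩

lemma conv_sq_le {φ a f : E2 → ℝ} (h0 : ∀ x, 0 ≤ φ x) (hcφ : Continuous φ) (hsφ : HasCompactSupport φ) (h1 : ∫ x, φ x = 1) (ha : AEStronglyMeasurable a)
    (h2 : Integrable fun x => a x ^ 2) (hf : ∀ x, f x = ∫ t, φ t * a (x - t)) (hfm : AEStronglyMeasurable f) :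
    Integrable (fun x => f x ^ 2) ∧ ∫ x, f x ^ 2 ≤ ∫ x, a x ^ 2 := by
  have hφ : Integrable φ := hcφ.integrable_of_hasCompactSupport hsφ
  obtain ⟨B, hB⟩ := hsφ.exists_bound_of_continuous hcφ
  obtain ⟨i1, i2⟩ := conv_int hφ h1 h2
  have key : ∀ x, f x ^ 2 ≤ ∫ t, φ t * a (x - t) ^ 2 := by
    intro x
    rw [hf]
    have hq : Measure.QuasiMeasurePreserving (fun t => x - t) := (Measure.measurePreserving_sub_left volume x).quasiMeasurePreserving
    refine (jensen_sq h0 hφ h1 (ha.comp_quasiMeasurePreserving hq) ?_).2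
    exact (h2.comp_sub_left x).bdd_mul hcφ.aestronglyMeasurable (Eventually.of_forall hB)
  have i3 : Integrable (fun x => f x ^ 2) := by
    refine Integrable.mono' i1 (hfm.pow 2) (Eventually.of_forall fun x => ?_)
    rw [Real.norm_eq_abs, abs_of_nonneg (sq_nonneg _)]; exact key x
  exact ⟨i3, (integral_mono i3 i1 key).trans i2.le⟩

lemma moll_deriv {φ w : E2 → ℝ} (hφ : ContDiff ℝ 1 φ) (hs : HasCompactSupport φ) (hw : Differentiable ℝ w) (hwg : Integrable (gradSq w)) (x v : E2) :
    fderiv ℝ (φ ⋆[ContinuousLinearMap.lsmul ℝ ℝ, volume] w) x v = ∫ t, φ t * fderiv ℝ w (x - t) v := by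
  have hd := hs.hasFDerivAt_convolution_left (μ := volume) (ContinuousLinearMap.lsmul ℝ ℝ) hφ hw.continuous.locallyIntegrable x
  have hsd : HasCompactSupport (fderiv ℝ φ) := hs.fderiv (𝕜 := ℝ)
  have hcd := hφ.continuous_fderiv one_ne_zero
  rw [hd.fderiv]
  unfold convolution
  have hInt0 : Integrable (fun t => ((ContinuousLinearMap.precompL E2 (ContinuousLinearMap.lsmul ℝ ℝ : ℝ →L[ℝ] ℝ →L[ℝ] ℝ)) (fderiv ℝ φ t)) (w (x - t))) := by
    have hex := hsd.convolutionExists_left (μ := volume) (ContinuousLinearMap.precompL E2 (ContinuousLinearMap.lsmul ℝ ℝ : ℝ →L[ℝ] ℝ →L[ℝ] ℝ)) hcd hw.continuous.locallyIntegrable x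
    exact hex
  rw [ContinuousLinearMap.integral_apply hInt0]
  simp only [ContinuousLinearMap.precompL_apply, ContinuousLinearMap.lsmul_apply, smul_eq_mul]
  have hwx : Differentiable ℝ (fun t => w (x - t)) := hw.comp (differentiable_const x |>.sub differentiable_id)
  have hfd : ∀ t, fderiv ℝ (fun t => w (x - t)) t v = - fderiv ℝ w (x - t) v := by
    intro t
    have : HasFDerivAt (fun t => w (x - t)) ((fderiv ℝ w (x - t)).comp (-(ContinuousLinearMap.id ℝ E2))) t := by
      refine HasFDerivAt.comp t (hw (x - t)).hasFDerivAt ?_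
      simpa using (hasFDerivAt_id t).const_sub x
    rw [this.fderiv]; simp
  have ibp := integral_mul_fderiv_eq_neg_fderiv_mul_of_integrable (μ := volume) (f := φ) (g := fun t => w (x - t)) (v := v) ?_ ?_ ?_
    (fun t _ => hφ.differentiable one_ne_zero t) (fun t _ => hwx t)
  · simp only [hfd] at ibp
    have e : ∫ t, φ t * -(fderiv ℝ w (x - t)) v = - ∫ t, φ t * (fderiv ℝ w (x - t)) v := by
      rw [← integral_neg]; congr 1; ext t; ring
    rw [e] at ibp
    linarith
  · refine Continuous.integrable_of_hasCompactSupport ((hcd.clm_apply continuous_const).mul hwx.continuous) ?_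
    exact HasCompactSupport.mul_right (hsd.comp_left (g := fun L : E2 →L[ℝ] ℝ => L v) (by simp))
  · simp only [hfd]
    obtain ⟨B, hB⟩ := hs.exists_bound_of_continuous hφ.continuous
    have i1 : Integrable φ := hφ.continuous.integrable_of_hasCompactSupport hs
    have i2 : Integrable (fun t => φ t * gradSq w (x - t)) := (hwg.comp_sub_left x).bdd_mul hφ.continuous.aestronglyMeasurable (Eventually.of_forall hB)
    have hm : Measurable fun t => (fderiv ℝ w (x - t)) v := ((measurable_fderiv_apply_const ℝ w v).comp (measurable_const.sub measurable_id))
    refine Integrable.mono' ((i1.norm.add i2.norm).mul_const ‖v‖) (hφ.continuous.aestronglyMeasurable.mul hm.neg.aestronglyMeasurable) (Eventually.of_forall fun t => ?_)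
    simp only [Pi.add_apply]
    rw [norm_mul, norm_neg]
    have h1 := (fderiv ℝ w (x - t)).le_opNorm v
    set n := ‖fderiv ℝ w (x - t)‖
    have h2 : ‖φ t * gradSq w (x - t)‖ = ‖φ t‖ * n ^ 2 := by
      rw [norm_mul]; congr 1; unfold gradSq; rw [Real.norm_eq_abs, abs_of_nonneg (sq_nonneg _)]
    rw [h2]
    have h3 : n ≤ 1 + n ^ 2 := by nlinarith [sq_nonneg (n - 1), norm_nonneg (fderiv ℝ w (x - t))]
    calc ‖φ t‖ * ‖(fderiv ℝ w (x - t)) v‖ ≤ ‖φ t‖ * ((1 + n ^ 2) * ‖v‖) := by gcongr; exact h1.trans (by gcongr)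
      _ = _ := by ring
  · refine Continuous.integrable_of_hasCompactSupport (hφ.continuous.mul hwx.continuous) ?_
    exact HasCompactSupport.mul_right hs

lemma GN_moll {Q : E2 → ℝ} (hQ : IsGroundState Q) {w : E2 → ℝ} (hw : Differentiable ℝ w) (hc : HasCompactSupport w) (hg : Integrable (gradSq w)) (i2 : Integrable (fun x => w x ^ 2))
    (b : ContDiffBump (0:E2)) (f : E2 → ℝ) (hf : f = (b.normed volume) ⋆[ContinuousLinearMap.lsmul ℝ ℝ, volume] w) (hfd : ContDiff ℝ 1 f) (hfc : HasCompactSupport f) :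
    2 * (∫ x, Q x ^ 2) * (∫ x, f x ^ 4) ≤ ((∫ x, gradSq w x) + ∫ x, w x ^ 2) ^ 2 := by
  have h0 : ∀ x, 0 ≤ b.normed volume x := fun x => b.nonneg_normed x
  have hcn := b.continuous_normed (μ := volume)
  have hsn := b.hasCompactSupport_normed (μ := volume)
  have h1 := b.integral_normed (μ := volume)
  have hfx : ∀ x, f x = ∫ t, b.normed volume t * w (x - t) := fun x => by
    simp only [hf, convolution, ContinuousLinearMap.lsmul_apply, smul_eq_mul]
  have a2 := conv_sq_le h0 hcn hsn h1 hw.continuous.aestronglyMeasurable i2 hfx hfd.continuous.aestronglyMeasurable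
  let p : E2 → ℝ := fun x => ∫ t, b.normed volume t * ‖fderiv ℝ w (x - t)‖
  have hmw : AEStronglyMeasurable (fun x => ‖fderiv ℝ w x‖) := (measurable_fderiv ℝ w).norm.aestronglyMeasurable
  obtain ⟨B, hB⟩ := hsn.exists_bound_of_continuous hcn
  have hpi : ∀ x, Integrable (fun t => b.normed volume t * ‖fderiv ℝ w (x - t)‖) := by
    intro x
    have hq : Measure.QuasiMeasurePreserving (fun t => x - t) := (Measure.measurePreserving_sub_left volume x).quasiMeasurePreserving
    refine (jensen_sq h0 (hcn.integrable_of_hasCompactSupport hsn) h1 (hmw.comp_quasiMeasurePreserving hq) ?_).1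
    exact (hg.comp_sub_left x).bdd_mul hcn.aestronglyMeasurable (Eventually.of_forall hB)
  have hpm : AEStronglyMeasurable p := by
    have : p = (b.normed volume) ⋆[ContinuousLinearMap.lsmul ℝ ℝ, volume] (fun x => ‖fderiv ℝ w x‖) := by
      ext x; simp only [p, convolution, ContinuousLinearMap.lsmul_apply, smul_eq_mul]
    rw [this]
    have hi1 : Integrable (fun x => ‖fderiv ℝ w x‖) := by
      have hz : ∀ x, x ∉ tsupport w → fderiv ℝ w x = 0 := fun x hx => by
        have := hc.fderiv (𝕜 := ℝ)
        exact image_eq_zero_of_notMem_tsupport (fun h => hx (tsupport_fderiv_subset ℝ h))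
      have hind : Integrable ((tsupport w).indicator fun _ : E2 => (1:ℝ)) := by
        rw [integrable_indicator_iff (isClosed_tsupport w).measurableSet, integrableOn_const_iff]
        right; exact hc.isCompact.measure_lt_top
      refine Integrable.mono' (hg.add hind) hmw (Eventually.of_forall fun x => ?_)
      simp only [Pi.add_apply, norm_norm, gradSq]
      by_cases hx : x ∈ tsupport w
      · rw [Set.indicator_of_mem hx]; nlinarith [sq_nonneg (‖fderiv ℝ w x‖ - 1), norm_nonneg (fderiv ℝ w x)]
      · rw [hz x hx, Set.indicator_of_notMem hx]; simp
    exact ((hcn.integrable_of_hasCompactSupport hsn).integrable_convolution _ hi1).aestronglyMeasurable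
  have ap := conv_sq_le h0 hcn hsn h1 hmw hg (f := p) (fun x => rfl) hpm
  have hgp : ∀ x, gradSq f x ≤ p x ^ 2 := by
    intro x
    unfold gradSq
    have hp0 : 0 ≤ p x := integral_nonneg fun t => mul_nonneg (h0 t) (norm_nonneg _)
    refine pow_le_pow_left₀ (norm_nonneg _) (ContinuousLinearMap.opNorm_le_bound _ hp0 fun v => ?_) 2
    rw [hf, moll_deriv b.contDiff_normed hsn hw hg x v]
    refine (norm_integral_le_integral_norm _).trans ?_
    rw [← integral_mul_const]
    refine integral_mono_of_nonneg (Eventually.of_forall fun t => norm_nonneg _) ((hpi x).mul_const _) (Eventually.of_forall fun t => ?_)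
    simp only
    rw [norm_mul, Real.norm_eq_abs, abs_of_nonneg (h0 t), mul_assoc]
    exact mul_le_mul_of_nonneg_left ((fderiv ℝ w (x - t)).le_opNorm v) (h0 t)
  have hg1 : ∫ x, gradSq f x ≤ ∫ x, gradSq w x :=
    (integral_mono_of_nonneg (Eventually.of_forall fun x => sq_nonneg _) ap.1 (Eventually.of_forall hgp)).trans ap.2
  refine (GN_C1 hQ hfd hfc).trans ?_
  have : 0 ≤ ∫ x, gradSq f x := integral_nonneg fun x => sq_nonneg _
  have : 0 ≤ ∫ x, f x ^ 2 := integral_nonneg fun x => sq_nonneg _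
  exact pow_le_pow_left₀ (by positivity) (add_le_add hg1 a2.2) 2

lemma exists_bumps : ∃ b : ℕ → ContDiffBump (0:E2), Tendsto (fun n => (b n).rOut) atTop (𝓝 0) := by
  refine ⟨fun n => ⟨1 / (2 * ((n:ℝ) + 1)), 1 / ((n:ℝ) + 1), by positivity, ?_⟩, tendsto_one_div_add_atTop_nhds_zero_nat⟩
  rw [one_div_lt_one_div (by positivity) (by positivity)]
  have : (0:ℝ) < n + 1 := by positivity
  linarith

lemma exists_moll {Q : E2 → ℝ} (hQ : IsGroundState Q) {w : E2 → ℝ} (hw : Differentiable ℝ w) (hc : HasCompactSupport w) (hg : Integrable (gradSq w)) (i2 : Integrable (fun x => w x ^ 2)) :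
    ∃ f : ℕ → E2 → ℝ, (∀ x, Tendsto (fun n => f n x) atTop (𝓝 (w x))) ∧ (∀ n, ContDiff ℝ 1 (f n)) ∧ (∀ n, HasCompactSupport (f n)) ∧
      ∀ n, 2 * (∫ x, Q x ^ 2) * (∫ x, f n x ^ 4) ≤ ((∫ x, gradSq w x) + ∫ x, w x ^ 2) ^ 2 := by
  obtain ⟨b, hb0⟩ := exists_bumps
  have hfd : ∀ n, ContDiff ℝ 1 (((b n).normed volume) ⋆[ContinuousLinearMap.lsmul ℝ ℝ, volume] w) := fun n =>
    ((b n).hasCompactSupport_normed).contDiff_convolution_left (n := 1) (ContinuousLinearMap.lsmul ℝ ℝ) (b n).contDiff_normed hw.continuous.locallyIntegrable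
  have hfc : ∀ n, HasCompactSupport (((b n).normed volume) ⋆[ContinuousLinearMap.lsmul ℝ ℝ, volume] w) := fun n => ((b n).hasCompactSupport_normed).convolution _ hc
  exact ⟨fun n => ((b n).normed volume) ⋆[ContinuousLinearMap.lsmul ℝ ℝ, volume] w,
    fun x => ContDiffBump.convolution_tendsto_right_of_continuous hb0 hw.continuous x, hfd, hfc, fun n => GN_moll hQ hw hc hg i2 (b n) _ rfl (hfd n) (hfc n)⟩

lemma cs_pow {w : E2 → ℝ} (hc : HasCompactSupport w) (n : ℕ) (hn : n ≠ 0) : HasCompactSupport (fun x => w x ^ n) := by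
  have := hc.comp_left (g := fun t : ℝ => t ^ n) (zero_pow hn)
  exact this

lemma cs_int_pow {w : E2 → ℝ} (hw : Continuous w) (hc : HasCompactSupport w) (n : ℕ) (hn : n ≠ 0) : Integrable (fun x => w x ^ n) :=
  (hw.pow n).integrable_of_hasCompactSupport (cs_pow hc n hn)

lemma fatou4 {f : ℕ → E2 → ℝ} {w : E2 → ℝ} (hlim : ∀ x, Tendsto (fun n => f n x) atTop (𝓝 (w x))) (hf : ∀ n, Continuous (f n)) (i4 : Integrable (fun x => w x ^ 4))
    (hfi : ∀ n, Integrable (fun x => f n x ^ 4)) {T : ℝ} (hT : 0 ≤ T) (hF : ∀ n, ∫ x, f n x ^ 4 ≤ T) : ∫ x, w x ^ 4 ≤ T := by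
  have hfat : ∫⁻ x, ENNReal.ofReal (w x ^ 4) ≤ ENNReal.ofReal T := by
    have e : ∀ x, ENNReal.ofReal (w x ^ 4) = liminf (fun n => ENNReal.ofReal (f n x ^ 4)) atTop := fun x =>
      ((ENNReal.continuous_ofReal.tendsto _).comp ((hlim x).pow 4)).liminf_eq.symm
    simp only [e]
    refine (lintegral_liminf_le fun n => (((hf n).pow 4).measurable).ennreal_ofReal).trans ?_
    refine liminf_le_of_le (by isBoundedDefault) fun c hc' => ?_
    obtain ⟨n, hn⟩ := hc'.exists
    refine hn.trans ?_
    change ∫⁻ x, ENNReal.ofReal (f n x ^ 4) ≤ _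
    rw [← ofReal_integral_eq_lintegral_ofReal (hfi n) (Eventually.of_forall fun x => by positivity)]
    exact ENNReal.ofReal_le_ofReal (hF n)
  rwa [← ofReal_integral_eq_lintegral_ofReal i4 (Eventually.of_forall fun x => by positivity), ENNReal.ofReal_le_ofReal_iff hT] at hfat

lemma GN_cs {Q : E2 → ℝ} (hQ : IsGroundState Q) {w : E2 → ℝ} (hw : Differentiable ℝ w) (hc : HasCompactSupport w) (hg : Integrable (gradSq w)) :
    2 * (∫ x, Q x ^ 2) * (∫ x, w x ^ 4) ≤ ((∫ x, gradSq w x) + ∫ x, w x ^ 2) ^ 2 := by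
  have ha0 : 0 ≤ ∫ x, Q x ^ 2 := integral_nonneg fun x => sq_nonneg _
  obtain ⟨f, hlim, hfd, hfc, hb⟩ := exists_moll hQ hw hc hg (cs_int_pow hw.continuous hc 2 two_ne_zero)
  rcases ha0.eq_or_lt with h | hA
  · rw [← h]; simp only [mul_zero, zero_mul]; positivity
  have := fatou4 hlim (fun n => (hfd n).continuous) (cs_int_pow hw.continuous hc 4 four_ne_zero) (fun n => cs_int_pow (hfd n).continuous (hfc n) 4 four_ne_zero)
    (T := ((∫ x, gradSq w x) + ∫ x, w x ^ 2) ^ 2 / (2 * (∫ x, Q x ^ 2))) (by positivity) (fun n => by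
      rw [le_div_iff₀ (by positivity)]; have := hb n; linarith)
  rw [le_div_iff₀ (by positivity)] at this
  linarith
end

noncomputable section
open MeasureTheory Real Filter
open scoped Pointwise ENNReal NNReal Topology
set_option linter.all false
set_option linter.deprecated false

lemma gradSq_meas (w : E2 → ℝ) : Measurable (gradSq w) := ((measurable_fderiv ℝ w).norm).pow_const 2

lemma gradSq_nn (w : E2 → ℝ) (x : E2) : 0 ≤ gradSq w x := sq_nonneg _

lemma exists_cutoff : ∃ (c : ℕ → E2 → ℝ) (B : ℝ), 0 ≤ B ∧ (∀ n, Differentiable ℝ (c n)) ∧ (∀ n, HasCompactSupport (c n)) ∧ (∀ n x, 0 ≤ c n x) ∧ (∀ n x, c n x ≤ 1) ∧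
    (∀ n x, ‖fderiv ℝ (c n) x‖ ≤ B / (n + 1)) ∧ ∀ x, Tendsto (fun n => c n x) atTop (𝓝 1) := by
  let χ : ContDiffBump (0 : E2) := ⟨1, 2, one_pos, one_lt_two⟩
  have hχ : ContDiff ℝ 1 χ := χ.contDiff
  have hd : Differentiable ℝ χ := hχ.differentiable one_ne_zero
  obtain ⟨B, hB⟩ := (χ.hasCompactSupport.fderiv (𝕜 := ℝ)).exists_bound_of_continuous (hχ.continuous_fderiv one_ne_zero)
  have hn : ∀ n : ℕ, (0 : ℝ) < ((n : ℝ) + 1)⁻¹ := fun n => by positivity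
  refine ⟨fun n x => χ (((n : ℝ) + 1)⁻¹ • x), B, (norm_nonneg _).trans (hB 0), fun n => hd.comp (by fun_prop), fun n => ?_, fun n x => χ.nonneg, fun n x => χ.le_one, fun n x => ?_, fun x => ?_⟩
  · exact χ.hasCompactSupport.comp_smul (hn n).ne'
  · rw [fderiv_comp_smul, norm_smul, Real.norm_eq_abs, abs_of_pos (hn n), div_eq_inv_mul]
    exact mul_le_mul_of_nonneg_left (hB _) (hn n).le
  · refine tendsto_const_nhds.congr' ?_
    obtain ⟨N, hN⟩ := exists_nat_gt ‖x‖
    filter_upwards [eventually_ge_atTop N] with n hnN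
    refine (χ.one_of_mem_closedBall ?_).symm
    have : (N : ℝ) ≤ n := by exact_mod_cast hnN
    simp only [mem_closedBall_zero_iff, norm_smul, Real.norm_eq_abs, abs_of_pos (hn n)]
    change _ ≤ (1 : ℝ)
    rw [← div_eq_inv_mul, div_le_one (by positivity)]
    linarith

lemma gradSq_cut {c u : E2 → ℝ} {K d : ℝ} {x : E2} (hc : DifferentiableAt ℝ c x) (hu : DifferentiableAt ℝ u x) (h0 : 0 ≤ c x) (h1 : c x ≤ 1) (hK : ‖fderiv ℝ c x‖ ≤ K) (hd : 0 < d) :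
    gradSq (fun y => c y * u y) x ≤ (1 + d) * gradSq u x + (1 + 1 / d) * K ^ 2 * u x ^ 2 := by
  unfold gradSq
  rw [show (fun y => c y * u y) = c * u from rfl, fderiv_mul hc hu]
  have hb : ‖c x • fderiv ℝ u x + u x • fderiv ℝ c x‖ ≤ ‖fderiv ℝ u x‖ + |u x| * K := by
    refine (norm_add_le _ _).trans ?_
    rw [norm_smul, norm_smul, Real.norm_eq_abs, Real.norm_eq_abs, abs_of_nonneg h0]
    gcongr
    exact mul_le_of_le_one_left (norm_nonneg _) h1
  refine (pow_le_pow_left₀ (norm_nonneg _) hb 2).trans ?_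
  have hs : |u x| ^ 2 = u x ^ 2 := sq_abs _
  rw [← hs]
  have e : (1 + d) * ‖fderiv ℝ u x‖ ^ 2 + (1 + 1 / d) * K ^ 2 * |u x| ^ 2 - (‖fderiv ℝ u x‖ + |u x| * K) ^ 2 = (d * ‖fderiv ℝ u x‖ - |u x| * K) ^ 2 / d := by
    field_simp; ring
  have : 0 ≤ (d * ‖fderiv ℝ u x‖ - |u x| * K) ^ 2 / d := by positivity
  linarith

lemma GN_step {Q : E2 → ℝ} (hQ : IsGroundState Q) {u : E2 → ℝ} (hu : IsH1 u) {c : E2 → ℝ} {K d : ℝ} (hc : Differentiable ℝ c) (hcs : HasCompactSupport c) (h0 : ∀ x, 0 ≤ c x) (h1 : ∀ x, c x ≤ 1)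
    (hK : ∀ x, ‖fderiv ℝ c x‖ ≤ K) (hd : 0 < d) :
    2 * (∫ x, Q x ^ 2) * (∫ x, (c x * u x) ^ 4) ≤ ((1 + d) * (∫ x, gradSq u x) + (1 + 1 / d) * K ^ 2 * (∫ x, u x ^ 2) + ∫ x, u x ^ 2) ^ 2 := by
  obtain ⟨hd1, i2, ig, i4⟩ := hu
  have ib : Integrable (fun x => (1 + d) * gradSq u x + (1 + 1 / d) * K ^ 2 * u x ^ 2) := (ig.const_mul _).add (i2.const_mul _)
  have hb : ∀ x, gradSq (fun y => c y * u y) x ≤ (1 + d) * gradSq u x + (1 + 1 / d) * K ^ 2 * u x ^ 2 := fun x => gradSq_cut (hc x) (hd1 x) (h0 x) (h1 x) (hK x) hd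
  have igw : Integrable (gradSq fun y => c y * u y) := ib.mono' (gradSq_meas _).aestronglyMeasurable
    (Eventually.of_forall fun x => by rw [Real.norm_eq_abs, abs_of_nonneg (gradSq_nn _ _)]; exact hb x)
  have hwc : HasCompactSupport fun y => c y * u y := hcs.mul_right
  have hwd : Differentiable ℝ fun y => c y * u y := hc.mul hd1
  refine (GN_cs hQ hwd hwc igw).trans ?_
  have g1 : ∫ x, gradSq (fun y => c y * u y) x ≤ (1 + d) * (∫ x, gradSq u x) + (1 + 1 / d) * K ^ 2 * (∫ x, u x ^ 2) := by
    rw [← integral_const_mul, ← integral_const_mul, ← integral_add (ig.const_mul _) (i2.const_mul _)]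
    exact integral_mono igw ib hb
  have g2 : ∫ x, (c x * u x) ^ 2 ≤ ∫ x, u x ^ 2 := by
    refine integral_mono (cs_int_pow hwd.continuous hwc 2 two_ne_zero) i2 fun x => ?_
    change (c x * u x) ^ 2 ≤ u x ^ 2
    rw [mul_pow]
    exact mul_le_of_le_one_left (sq_nonneg _) (pow_le_one₀ (h0 x) (h1 x))
  have n1 : 0 ≤ ∫ x, gradSq (fun y => c y * u y) x := integral_nonneg fun x => gradSq_nn _ _
  have n2 : 0 ≤ ∫ x, (c x * u x) ^ 2 := integral_nonneg fun x => sq_nonneg _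
  exact pow_le_pow_left₀ (by linarith) (by linarith) 2

lemma GS_apos {Q : E2 → ℝ} (hQ : IsGroundState Q) : 0 < ∫ x, Q x ^ 2 := by
  have i := hQ.2.2.2.1.2.1
  refine (integral_pos_iff_support_of_nonneg (fun x => sq_nonneg _) i).2 ?_
  have : Function.support (fun x => Q x ^ 2) = Set.univ := by
    ext x; simp [(hQ.2.1 x).ne']
  rw [this]; simp

lemma GN_add {Q : E2 → ℝ} (hQ : IsGroundState Q) {u : E2 → ℝ} (hu : IsH1 u) :
    2 * (∫ x, Q x ^ 2) * (∫ x, u x ^ 4) ≤ ((∫ x, gradSq u x) + ∫ x, u x ^ 2) ^ 2 := by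
  obtain ⟨c, B, hB, hc, hcs, h0, h1, hK, hl⟩ := exists_cutoff
  have hA := GS_apos hQ
  set G := ∫ x, gradSq u x
  set M := ∫ x, u x ^ 2
  have hG : 0 ≤ G := integral_nonneg fun x => gradSq_nn _ _
  have hM : 0 ≤ M := integral_nonneg fun x => sq_nonneg _
  have hs : ∀ d : ℝ, 0 < d → 2 * (∫ x, Q x ^ 2) * (∫ x, u x ^ 4) ≤ ((1 + d) * G + d * M + M) ^ 2 := by
    intro d hd
    have ht : Tendsto (fun n : ℕ => (1 + 1 / d) * (B / (n + 1)) ^ 2) atTop (𝓝 0) := by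
      have : Tendsto (fun n : ℕ => B / ((n : ℝ) + 1)) atTop (𝓝 0) :=
        tendsto_const_nhds.div_atTop (tendsto_atTop_add_const_right _ _ tendsto_natCast_atTop_atTop)
      have := (this.pow 2).const_mul (1 + 1 / d)
      simpa using this
    obtain ⟨N, hN⟩ := ((ht.eventually (ge_mem_nhds hd))).exists_forall_of_atTop
    have := fatou4 (f := fun n x => c (n + N) x * u x) (w := u) (T := ((1 + d) * G + d * M + M) ^ 2 / (2 * ∫ x, Q x ^ 2))
      (fun x => by
        have := (((tendsto_add_atTop_iff_nat N).2 (hl x)).mul_const (u x))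
        simpa using this)
      (fun n => ((hc _).continuous.mul hu.1.continuous)) hu.2.2.2
      (fun n => cs_int_pow ((hc _).continuous.mul hu.1.continuous) ((hcs _).mul_right) 4 four_ne_zero) (by positivity)
      (fun n => by
        rw [le_div_iff₀ (by positivity)]
        have h := GN_step hQ hu (hc (n + N)) (hcs _) (h0 _) (h1 _) (hK _) hd
        have h2 : (1 + 1 / d) * (B / ((n + N : ℕ) + 1)) ^ 2 ≤ d := hN (n + N) (by omega)
        have h3 : ((1 + d) * G + (1 + 1 / d) * (B / ((n + N : ℕ) + 1)) ^ 2 * M + M) ^ 2 ≤ ((1 + d) * G + d * M + M) ^ 2 := by gcongr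
        linarith)
    rw [le_div_iff₀ (by positivity)] at this
    linarith
  have hlim : Tendsto (fun d : ℝ => ((1 + d) * G + d * M + M) ^ 2) (𝓝[>] 0) (𝓝 ((G + M) ^ 2)) := by
    have : Continuous fun d : ℝ => ((1 + d) * G + d * M + M) ^ 2 := by fun_prop
    have := (this.tendsto 0).mono_left (nhdsWithin_le_nhds (s := Set.Ioi 0))
    simpa using this
  exact ge_of_tendsto hlim (by filter_upwards [self_mem_nhdsWithin] with d hd using hs d hd)

lemma gradSq_smul (u : E2 → ℝ) (l : ℝ) (x : E2) : gradSq (fun y => u (l • y)) x = l ^ 2 * gradSq u (l • x) := by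
  unfold gradSq
  rw [fderiv_comp_smul, norm_smul, mul_pow, Real.norm_eq_abs, sq_abs]

lemma int_smul (f : E2 → ℝ) {l : ℝ} (hl : 0 < l) : ∫ x, f (l • x) = (l ^ 2)⁻¹ * ∫ x, f x := by
  rw [Measure.integral_comp_smul]
  simp [abs_of_pos hl]

lemma intble_smul {f : E2 → ℝ} (hf : Integrable f) {l : ℝ} (hl : 0 < l) : Integrable fun x => f (l • x) := hf.comp_smul hl.ne'

lemma H1_smul {u : E2 → ℝ} (hu : IsH1 u) {l : ℝ} (hl : 0 < l) : IsH1 fun x => u (l • x) := by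
  refine ⟨hu.1.comp (by fun_prop), intble_smul hu.2.1 hl, ?_, intble_smul hu.2.2.2 hl⟩
  have := (intble_smul hu.2.2.1 hl).const_mul (l ^ 2)
  exact this.congr (Eventually.of_forall fun x => (gradSq_smul u l x).symm)

/-- Gagliardo-Nirenberg -/
lemma GN {Q : E2 → ℝ} (hQ : IsGroundState Q) {u : E2 → ℝ} (hu : IsH1 u) :
    (∫ x, Q x ^ 2) * (∫ x, u x ^ 4) ≤ 2 * (∫ x, gradSq u x) * ∫ x, u x ^ 2 := by
  have key : ∀ l : ℝ, 0 < l → 2 * (∫ x, Q x ^ 2) * (∫ x, u x ^ 4) ≤ (l * (∫ x, gradSq u x) + (∫ x, u x ^ 2) / l) ^ 2 := by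
    intro l hl
    have := GN_add hQ (H1_smul hu hl)
    simp only [gradSq_smul] at this
    rw [int_smul (fun x => u x ^ 4) hl, int_smul (fun x => u x ^ 2) hl, int_smul (fun x => l ^ 2 * gradSq u x) hl, integral_const_mul] at this
    have e1 : (l ^ 2)⁻¹ * (l ^ 2 * ∫ x, gradSq u x) = ∫ x, gradSq u x := by field_simp
    rw [e1] at this
    have h2 := mul_le_mul_of_nonneg_left this (sq_nonneg l)
    have e2 : l ^ 2 * (2 * (∫ x, Q x ^ 2) * ((l ^ 2)⁻¹ * ∫ x, u x ^ 4)) = 2 * (∫ x, Q x ^ 2) * (∫ x, u x ^ 4) := by field_simp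
    have e3 : l ^ 2 * ((∫ x, gradSq u x) + (l ^ 2)⁻¹ * ∫ x, u x ^ 2) ^ 2 = (l * (∫ x, gradSq u x) + (∫ x, u x ^ 2) / l) ^ 2 := by
      field_simp
    rw [e2, e3] at h2; exact h2
  have hG : 0 ≤ ∫ x, gradSq u x := integral_nonneg fun x => gradSq_nn _ _
  have hM : 0 ≤ ∫ x, u x ^ 2 := integral_nonneg fun x => sq_nonneg _
  generalize (∫ x, gradSq u x) = G at *
  generalize (∫ x, u x ^ 2) = M at *
  generalize (∫ x, u x ^ 4) = F at *
  generalize (∫ x, Q x ^ 2) = A at *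
  have hs : ∀ d : ℝ, 0 < d → A * F ≤ 2 * (G + d) * (M + d) := by
    intro d hd
    have hm : 0 < M + d := by linarith
    have hg : 0 < G + d := by linarith
    have := key (√((M + d) / (G + d))) (by positivity)
    set l := √((M + d) / (G + d)) with hl
    have hl0 : 0 < l := by positivity
    have hl2 : l ^ 2 = (M + d) / (G + d) := Real.sq_sqrt (by positivity)
    have h3 : (l * G + M / l) ^ 2 ≤ (l * (G + d) + (M + d) / l) ^ 2 := by gcongr <;> linarith
    have e : (l * (G + d) + (M + d) / l) ^ 2 = l ^ 2 * (G + d) ^ 2 + 2 * (G + d) * (M + d) + (M + d) ^ 2 / l ^ 2 := by field_simp; ring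
    rw [e, hl2] at h3
    have e2 : (M + d) / (G + d) * (G + d) ^ 2 + 2 * (G + d) * (M + d) + (M + d) ^ 2 / ((M + d) / (G + d)) = 4 * (G + d) * (M + d) := by field_simp; ring
    linarith
  have hlim : Tendsto (fun d : ℝ => 2 * (G + d) * (M + d)) (𝓝[>] 0) (𝓝 (2 * G * M)) := by
    have : Continuous fun d : ℝ => 2 * (G + d) * (M + d) := by fun_prop
    have := (this.tendsto 0).mono_left (nhdsWithin_le_nhds (s := Set.Ioi 0))
    simpa using this
  exact ge_of_tendsto hlim (by filter_upwards [self_mem_nhdsWithin] with d hd using hs d hd)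
end

noncomputable section
open MeasureTheory Real Filter
open scoped Pointwise ENNReal NNReal Topology
set_option linter.all false
set_option linter.deprecated false

lemma one_add_rpow_exp (S : ℝ) : Tendsto (fun r : ℝ => (1 + r) ^ S * exp (-r)) atTop (𝓝 0) := by
  have h := (tendsto_rpow_mul_exp_neg_mul_atTop_nhds_zero S 1 one_pos).comp (tendsto_atTop_add_const_left atTop (1:ℝ) tendsto_id)
  have h2 := h.mul_const (exp 1)
  simp only [zero_mul] at h2
  refine h2.congr fun r => ?_
  simp only [Function.comp, id]
  rw [mul_assoc, ← Real.exp_add]; congr 2; ring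

lemma GS_moment {Q : E2 → ℝ} (hQ : IsGroundState Q) (S : ℝ) : Integrable (fun y : E2 => (1 + ‖y‖) ^ S * Q y ^ 2) := by
  have hcont : Continuous (fun y : E2 => (1 + ‖y‖) ^ S * Q y ^ 2) := by
    refine Continuous.mul ?_ ((GS_diff hQ).continuous.pow 2)
    exact (continuous_const.add continuous_norm).rpow_const fun y => Or.inl (show (1:ℝ) + ‖y‖ ≠ 0 by positivity)
  refine hcont.locallyIntegrable.integrable_of_isBigO_cocompact (g := fun y : E2 => (1 + ‖y‖) ^ (-3:ℝ)) ?_ ?_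
  · obtain ⟨A, hA, R, hR, hd⟩ := (GS_sol hQ).decay
    have h1 : ∀ᶠ r : ℝ in atTop, (1 + r) ^ (S + 3) * exp (-r) ≤ 1 := (one_add_rpow_exp (S + 3)).eventually (ge_mem_nhds one_pos)
    have h2 : ∀ᶠ r : ℝ in atTop, (1 + r) ^ S * prof Q r ^ 2 ≤ A ^ 2 * (1 + r) ^ (-3:ℝ) := by
      filter_upwards [h1, eventually_ge_atTop R] with r hr hrR
      have hr0 : 0 < 1 + r := by linarith
      have hp : prof Q r ^ 2 ≤ A ^ 2 * exp (-r) := by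
        have := pow_le_pow_left₀ (hQ.2.1 _).le (hd r hrR).1 2
        rw [mul_pow, ← Real.exp_nat_mul] at this
        refine this.trans (le_of_eq ?_)
        congr 2; push_cast; ring
      have e : (1 + r) ^ (S + 3) = (1 + r) ^ S * (1 + r) ^ (3:ℝ) := Real.rpow_add hr0 _ _
      have e2 : (1 + r) ^ (-3:ℝ) = ((1 + r) ^ (3:ℝ))⁻¹ := Real.rpow_neg hr0.le _
      rw [e] at hr
      have h3 : 0 < (1 + r) ^ (3:ℝ) := by positivity
      have hS : 0 < (1 + r) ^ S := by positivity
      calc (1 + r) ^ S * prof Q r ^ 2 ≤ (1 + r) ^ S * (A ^ 2 * exp (-r)) := by gcongr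
        _ = A ^ 2 * ((1 + r) ^ S * exp (-r)) := by ring
        _ ≤ _ := by
          gcongr
          rw [e2, ← one_div, le_div_iff₀ h3]; linarith
    refine Asymptotics.IsBigO.of_bound (A ^ 2) ?_
    filter_upwards [(tendsto_norm_cocompact_atTop (E := E2)).eventually h2] with y hy
    rw [Real.norm_eq_abs, Real.norm_eq_abs, abs_of_nonneg (by positivity), abs_of_nonneg (by positivity), GS_radial hQ y]
    exact hy
  · refine (integrable_one_add_norm ?_).integrableAtFilter _
    simp; norm_num

lemma gradSq_trial (Q : E2 → ℝ) (c t : ℝ) (x0 x : E2) (hQ : Differentiable ℝ Q) : gradSq (fun y => c * Q (t • (y - x0))) x = c ^ 2 * t ^ 2 * gradSq Q (t • (x - x0)) := by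
  have e : fderiv ℝ (fun y => c * Q (t • (y - x0))) x = (c * t) • fderiv ℝ Q (t • (x - x0)) := by
    have h1 := fderiv_comp_sub (𝕜 := ℝ) (f := fun y => c * Q (t • y)) (x := x) x0
    rw [h1, fderiv_const_mul (by fun_prop), fderiv_comp_smul, smul_smul]
  unfold gradSq
  rw [e, norm_smul, mul_pow, Real.norm_eq_abs, sq_abs, mul_pow]

lemma int_aff (f : E2 → ℝ) {t : ℝ} (ht : 0 < t) (x0 : E2) : ∫ x, f (t • (x - x0)) = (t ^ 2)⁻¹ * ∫ x, f x := by
  rw [← int_smul f ht]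
  exact integral_sub_right_eq_self (fun x => f (t • x)) x0

lemma intble_aff {f : E2 → ℝ} (hf : Integrable f) {t : ℝ} (ht : 0 < t) (x0 : E2) : Integrable fun x => f (t • (x - x0)) :=
  (intble_smul hf ht).comp_sub_right x0

lemma trial_H1 {Q : E2 → ℝ} (hQ : IsGroundState Q) (c : ℝ) {t : ℝ} (ht : 0 < t) (x0 : E2) :
    IsH1 (fun x => c * Q (t • (x - x0))) := by
  have hd := GS_diff hQ
  obtain ⟨-, i2, ig, i4⟩ := hQ.2.2.2.1
  refine ⟨by fun_prop, ?_, ?_, ?_⟩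
  · simp only [mul_pow]; exact (intble_aff i2 ht x0).const_mul _
  · refine ((intble_aff ig ht x0).const_mul (c ^ 2 * t ^ 2)).congr (Eventually.of_forall fun x => (gradSq_trial Q c t x0 x hd).symm)
  · simp only [mul_pow]; exact (intble_aff i4 ht x0).const_mul _

lemma prod_bound {n : ℕ} (pts : Fin n → E2) (pe : Fin n → ℝ) (hpe : ∀ i, 0 < pe i) (j : Fin n) {t0 : ℝ} (ht0 : 0 < t0) :
    ∃ b : ℝ, 0 < b ∧ ∀ t, t0 ≤ t → ∀ x : E2, ∏ i, ‖x - pts i‖ ^ pe i ≤ t ^ (-(pe j)) * (b * (1 + ‖t • (x - pts j)‖) ^ (∑ i, pe i)) := by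
  obtain ⟨D, hD⟩ : ∃ D : ℝ, ∀ i, ‖pts j - pts i‖ ≤ D := by
    obtain ⟨D, hD⟩ := (Set.finite_range fun i => ‖pts j - pts i‖).bddAbove
    exact ⟨D, fun i => hD ⟨i, rfl⟩⟩
  have hD0 : 0 ≤ D := (norm_nonneg _).trans (hD j)
  set b := 1 + 1 / t0 + D with hb
  have hb1 : 1 ≤ b := by have : 0 < 1 / t0 := by positivity
                         linarith
  refine ⟨b ^ (∑ i, pe i), by positivity, fun t ht x => ?_⟩
  have htp : 0 < t := ht0.trans_le ht
  set y := t • (x - pts j) with hy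
  have hny : ‖y‖ = t * ‖x - pts j‖ := by rw [hy, norm_smul, Real.norm_eq_abs, abs_of_pos htp]
  have hx : ‖x - pts j‖ = ‖y‖ / t := by rw [hny]; field_simp
  have hi : ∀ i ∈ Finset.univ, ‖x - pts i‖ ^ pe i ≤ (if i = j then t ^ (-(pe j)) else 1) * (b * (1 + ‖y‖)) ^ pe i := by
    intro i _
    split_ifs with hij
    · subst hij
      rw [hx, Real.div_rpow (norm_nonneg _) htp.le, Real.rpow_neg htp.le, div_eq_inv_mul]
      gcongr
      · exact (hpe i).le
      · nlinarith [norm_nonneg y]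
    · rw [one_mul]
      gcongr
      · exact (hpe i).le
      · have h1 : ‖x - pts i‖ ≤ ‖x - pts j‖ + ‖pts j - pts i‖ := by simpa using norm_add_le (x - pts j) (pts j - pts i)
        have h2 : ‖y‖ / t ≤ 1 / t0 * ‖y‖ := by rw [div_eq_inv_mul, ← one_div]; gcongr
        have h3 := hD i
        have h4 : 0 < 1 / t0 := by positivity
        rw [hx] at h1
        have : b * (1 + ‖y‖) = 1 + 1 / t0 + D + (1 + D) * ‖y‖ + 1 / t0 * ‖y‖ := by rw [hb]; ring
        have h5 : 0 ≤ (1 + D) * ‖y‖ := by positivity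
        linarith
  refine (Finset.prod_le_prod (fun i _ => by positivity) hi).trans (le_of_eq ?_)
  rw [Finset.prod_mul_distrib, Finset.prod_ite_eq' , if_pos (Finset.mem_univ _), ← Real.rpow_sum_of_pos (by positivity), Real.mul_rpow (by positivity) (by positivity)]

lemma trial {Q : E2 → ℝ} (hQ : IsGroundState Q) {n : ℕ} (pts : Fin n → E2) (pe : Fin n → ℝ) (hpe : ∀ i, 0 < pe i) {C : ℝ} (hC : 0 < C)
    {V : E2 → ℝ} (hVm : AEStronglyMeasurable V volume) (hV0 : ∀ x, 0 ≤ V x) (hV1 : ∀ x, V x ≤ C * ∏ i, ‖x - pts i‖ ^ pe i) {p : ℝ} (hp : ∃ i, pe i = p) :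
    ∃ M : ℝ, 0 < M ∧ ∀ a : ℝ, 0 ≤ a → a < (∫ x : E2, Q x ^ 2) → ∃ v, InH V v ∧ (∫ x, v x ^ 2) = 1 ∧ Ea V a v ≤ M * ((∫ x : E2, Q x ^ 2) - a) ^ (p / (p + 2)) := by
  obtain ⟨j, hj⟩ := hp
  have hp0 : 0 < p := hj ▸ hpe j
  have hA := GS_apos hQ
  set A := ∫ x : E2, Q x ^ 2 with hAdef
  obtain ⟨b, hb, hbd⟩ := prod_bound pts pe hpe j (t0 := A ^ (-(1 / (p + 2)))) (by positivity)
  set S := ∑ i, pe i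
  have im := GS_moment hQ S
  set K := ∫ y : E2, (1 + ‖y‖) ^ S * Q y ^ 2 with hK
  have hK0 : 0 ≤ K := integral_nonneg fun y => by positivity
  refine ⟨1 / A + C * b * K / A, by positivity, fun a ha0 ha => ?_⟩
  have he : 0 < A - a := by linarith
  set t := (A - a) ^ (-(1 / (p + 2))) with ht
  have ht0 : 0 < t := by positivity
  have htA : A ^ (-(1 / (p + 2))) ≤ t := by
    refine Real.rpow_le_rpow_of_nonpos he (by linarith) ?_
    have : 0 < 1 / (p + 2) := by positivity
    linarith
  set c := t / √A with hc
  have hc2 : c ^ 2 = t ^ 2 / A := by rw [hc, div_pow, Real.sq_sqrt hA.le]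
  have hc4 : c ^ 4 = t ^ 4 / A ^ 2 := by rw [show c ^ 4 = (c ^ 2) ^ 2 by ring, hc2]; ring
  set v : E2 → ℝ := fun x => c * Q (t • (x - pts j)) with hv
  have hvH := trial_H1 hQ c ht0 (pts j)
  have hpt : ∀ x, V x * v x ^ 2 ≤ (C * b * t ^ (-p) * c ^ 2) * ((1 + ‖t • (x - pts j)‖) ^ S * Q (t • (x - pts j)) ^ 2) := by
    intro x
    have h1 := (hV1 x).trans (mul_le_mul_of_nonneg_left (hbd t htA x) hC.le)
    rw [hj] at h1
    have h2 := mul_le_mul_of_nonneg_right h1 (sq_nonneg (v x))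
    refine h2.trans (le_of_eq ?_)
    simp only [hv]; ring
  have iM := (intble_aff im ht0 (pts j)).const_mul (C * b * t ^ (-p) * c ^ 2)
  have iV : Integrable (fun x => V x * v x ^ 2) := by
    refine iM.mono' (hVm.mul (hvH.2.1.aestronglyMeasurable)) (Eventually.of_forall fun x => ?_)
    rw [Real.norm_eq_abs, abs_of_nonneg (mul_nonneg (hV0 x) (sq_nonneg _))]
    exact hpt x
  refine ⟨v, ⟨hvH, iV⟩, ?_, ?_⟩
  · simp only [hv, mul_pow]
    rw [integral_const_mul, int_aff (fun x => Q x ^ 2) ht0, hc2, ← hAdef]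
    field_simp
  · have e1 : ∫ x, gradSq v x = t ^ 2 := by
      simp only [hv, gradSq_trial Q c t _ _ (GS_diff hQ)]
      rw [integral_const_mul, int_aff (gradSq Q) ht0, GS_grad_int hQ, ← hAdef, hc2]; field_simp
    have e2 : ∫ x, v x ^ 4 = 2 * t ^ 2 / A := by
      simp only [hv, mul_pow]
      rw [integral_const_mul, int_aff (fun x => Q x ^ 4) ht0, GS_four hQ, ← hAdef, hc4]; field_simp
    have e3 : ∫ x, V x * v x ^ 2 ≤ C * b * K / A * t ^ (-p) := by
      refine (integral_mono iV iM hpt).trans (le_of_eq ?_)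
      rw [integral_const_mul, int_aff (fun y => (1 + ‖y‖) ^ S * Q y ^ 2) ht0, ← hK, hc2]; field_simp
    have r1 : t ^ 2 * (A - a) = (A - a) ^ (p / (p + 2)) := by
      rw [ht, ← Real.rpow_natCast, ← Real.rpow_mul he.le]
      nth_rw 2 [← Real.rpow_one (A - a)]
      rw [← Real.rpow_add he]; congr 1; push_cast; field_simp; ring
    have r2 : t ^ (-p) = (A - a) ^ (p / (p + 2)) := by
      rw [ht, ← Real.rpow_mul he.le]; congr 1; field_simp
    unfold Ea
    rw [e1, e2]
    rw [r2] at e3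
    have : t ^ 2 - a / 2 * (2 * t ^ 2 / A) = 1 / A * (t ^ 2 * (A - a)) := by field_simp
    rw [r1] at this
    rw [add_mul]; linarith
end

noncomputable section
open MeasureTheory Real Filter
open scoped Pointwise ENNReal NNReal Topology
set_option linter.all false
set_option linter.deprecated false

lemma gradSq_const_mul {v : E2 → ℝ} (hv : Differentiable ℝ v) (c : ℝ) (x : E2) : gradSq (fun y => c * v y) x = c ^ 2 * gradSq v x := by
  unfold gradSq
  rw [fderiv_const_mul (hv x), norm_smul, mul_pow, Real.norm_eq_abs, sq_abs]

lemma InH_const_mul {V v : E2 → ℝ} (hv : InH V v) (c : ℝ) : InH V (fun y => c * v y) := by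
  obtain ⟨⟨hd, i2, ig, i4⟩, iV⟩ := hv
  refine ⟨⟨hd.const_mul c, ?_, ?_, ?_⟩, ?_⟩
  · simp only [mul_pow]; exact i2.const_mul _
  · exact (ig.const_mul (c ^ 2)).congr (Eventually.of_forall fun x => (gradSq_const_mul hd c x).symm)
  · simp only [mul_pow]; exact i4.const_mul _
  · refine (iV.const_mul (c ^ 2)).congr (Eventually.of_forall fun x => ?_)
    simp only; ring

lemma Ea_const_mul {V v : E2 → ℝ} (hv : InH V v) (a c : ℝ) : Ea V a (fun y => c * v y) = c ^ 2 * ((∫ x, gradSq v x) + ∫ x, V x * v x ^ 2) - a / 2 * (c ^ 4 * ∫ x, v x ^ 4) := by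
  unfold Ea
  have e1 : ∫ x, gradSq (fun y => c * v y) x = c ^ 2 * ∫ x, gradSq v x := by
    rw [← integral_const_mul]; congr 1; ext x; exact gradSq_const_mul hv.1.1 c x
  have e2 : ∫ x, V x * (c * v x) ^ 2 = c ^ 2 * ∫ x, V x * v x ^ 2 := by
    rw [← integral_const_mul]; congr 1; ext x; ring
  have e3 : ∫ x, (c * v x) ^ 4 = c ^ 4 * ∫ x, v x ^ 4 := by
    rw [← integral_const_mul]; congr 1; ext x; ring
  rw [e1, e2, e3]; ring

lemma min_ineq {V u v : E2 → ℝ} {a : ℝ} (hV0 : ∀ x, 0 ≤ V x) (hu : IsMinimizer V a u) (hv : InH V v) :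
    Ea V a u * (∫ x, v x ^ 2) ^ 2 ≤ ((∫ x, gradSq v x) + ∫ x, V x * v x ^ 2) * (∫ x, v x ^ 2) - a / 2 * ∫ x, v x ^ 4 := by
  have hN : 0 ≤ ∫ x, v x ^ 2 := integral_nonneg fun x => sq_nonneg _
  rcases hN.eq_or_lt with h0 | hpos
  · have h4 : ∫ x, v x ^ 4 = 0 := by
      have := (integral_eq_zero_iff_of_nonneg (fun x => sq_nonneg (v x)) hv.1.2.1).1 h0.symm
      rw [integral_eq_zero_iff_of_nonneg (fun x => by positivity) hv.1.2.2.2]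
      filter_upwards [this] with x hx
      simp only [Pi.zero_apply] at hx ⊢
      rw [show v x ^ 4 = (v x ^ 2) ^ 2 by ring, hx]; ring
    rw [h4, ← h0]; simp
  · set N := ∫ x, v x ^ 2 with hNd
    have hs : 0 < √N := Real.sqrt_pos.2 hpos
    have h1 : ∫ x, ((√N)⁻¹ * v x) ^ 2 = 1 := by
      simp only [mul_pow]
      rw [integral_const_mul, ← hNd, inv_pow, Real.sq_sqrt hpos.le]; field_simp
    have := hu.2.2 _ (InH_const_mul hv (√N)⁻¹) h1
    rw [Ea_const_mul hv] at this
    have c2 : (√N)⁻¹ ^ 2 = N⁻¹ := by rw [inv_pow, Real.sq_sqrt hpos.le]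
    have c4 : (√N)⁻¹ ^ 4 = (N ^ 2)⁻¹ := by rw [show (√N)⁻¹ ^ 4 = ((√N)⁻¹ ^ 2) ^ 2 by ring, c2, inv_pow]
    rw [c2, c4] at this
    have h2 := mul_le_mul_of_nonneg_right this (sq_nonneg N)
    refine h2.trans (le_of_eq ?_)
    field_simp

/-- smooth positive part -/
def thp (d s : ℝ) : ℝ := if 0 < s then s ^ 2 / (s + d) else 0

lemma thp_deriv {d : ℝ} (hd : 0 < d) (s : ℝ) : HasDerivAt (thp d) (if 0 < s then 1 - d ^ 2 / (s + d) ^ 2 else 0) s := by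
  rcases lt_trichotomy s 0 with h | h | h
  · rw [if_neg (not_lt.2 h.le)]
    refine (hasDerivAt_const s (0:ℝ)).congr_of_eventuallyEq ?_
    filter_upwards [gt_mem_nhds h] with t ht
    simp [thp, not_lt.2 ht.le]
  · subst h
    rw [if_neg (lt_irrefl _), hasDerivAt_iff_isLittleO]
    simp only [thp, lt_irrefl, if_false, sub_zero, smul_zero]
    refine Asymptotics.IsBigO.trans_isLittleO (g := fun t : ℝ => t * t) ?_ ?_
    · refine Asymptotics.IsBigO.of_bound (1 / d) (Eventually.of_forall fun t => ?_)
      split_ifs with ht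
      · rw [Real.norm_eq_abs, Real.norm_eq_abs, abs_of_pos (by positivity), abs_of_pos (by positivity), div_eq_inv_mul, ← pow_two, one_div]
        gcongr; linarith
      · rw [norm_zero]; exact mul_nonneg (by positivity) (norm_nonneg _)
    · have : (fun t : ℝ => t) =o[𝓝 0] (fun _ => (1:ℝ)) := (Asymptotics.isLittleO_one_iff ℝ).2 tendsto_id
      simpa using this.mul_isBigO (Asymptotics.isBigO_refl (fun t : ℝ => t) (𝓝 0))
  · rw [if_pos h]
    have h1 : HasDerivAt (fun t : ℝ => t ^ 2 / (t + d)) (1 - d ^ 2 / (s + d) ^ 2) s := by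
      have hne : s + d ≠ 0 := by positivity
      refine (((hasDerivAt_id s).pow 2).div ((hasDerivAt_id s).add_const d) hne).congr_deriv ?_
      simp only [Nat.cast_ofNat, Pi.pow_apply, id, show (2-1:ℕ)=1 from rfl, pow_one]
      field_simp; ring
    refine h1.congr_of_eventuallyEq ?_
    filter_upwards [lt_mem_nhds h] with t ht
    simp [thp, ht]

lemma thp_le {d : ℝ} (hd : 0 < d) (s : ℝ) : 0 ≤ thp d s ∧ thp d s ≤ max s 0 := by
  unfold thp
  split_ifs with h
  · refine ⟨by positivity, ?_⟩
    rw [max_eq_left h.le, div_le_iff₀ (by positivity)]; nlinarith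
  · exact ⟨le_rfl, le_max_right _ _⟩

lemma thp_lim (s : ℝ) : Tendsto (fun n : ℕ => thp (1 / ((n:ℝ) + 1)) s) atTop (𝓝 (max s 0)) := by
  unfold thp
  split_ifs with h
  · rw [max_eq_left h.le]
    have : Tendsto (fun n : ℕ => s ^ 2 / (s + 1 / ((n:ℝ) + 1))) atTop (𝓝 (s ^ 2 / (s + 0))) :=
      tendsto_const_nhds.div (tendsto_const_nhds.add tendsto_one_div_add_atTop_nhds_zero_nat) (by simpa using h.ne')
    have e : s ^ 2 / (s + 0) = s := by field_simp; simp
    rwa [e] at this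
  · rw [max_eq_right (not_lt.1 h)]; exact tendsto_const_nhds

lemma thp_grad {u : E2 → ℝ} (hu : Differentiable ℝ u) {d : ℝ} (hd : 0 < d) (x : E2) :
    gradSq (fun y => thp d (u y)) x ≤ if 0 < u x then gradSq u x else 0 := by
  have := ((thp_deriv hd (u x)).comp_hasFDerivAt x (hu x).hasFDerivAt).fderiv
  unfold gradSq
  have e : fderiv ℝ (fun y => thp d (u y)) x = (if 0 < u x then 1 - d ^ 2 / (u x + d) ^ 2 else 0) • fderiv ℝ u x := this
  rw [e, norm_smul, mul_pow, Real.norm_eq_abs, sq_abs]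
  split_ifs with h
  · have h1 : d ^ 2 / (u x + d) ^ 2 ≤ 1 := by
      rw [div_le_one (by positivity)]; gcongr; linarith
    have h2 : 0 ≤ d ^ 2 / (u x + d) ^ 2 := by positivity
    refine mul_le_of_le_one_left (sq_nonneg _) (pow_le_one₀ (by linarith) (by linarith))
  · simp

lemma ind_eq (f u : E2 → ℝ) : (fun x => if 0 < u x then f x else 0) = Set.indicator {x | 0 < u x} f := by
  ext x; simp [Set.indicator]

lemma ind_int {f u : E2 → ℝ} (hu : Continuous u) (hf : Integrable f) : Integrable (fun x => if 0 < u x then f x else 0) := by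
  rw [ind_eq]
  exact hf.indicator (isOpen_lt continuous_const hu).measurableSet

lemma thp_InH {V u : E2 → ℝ} (hV0 : ∀ x, 0 ≤ V x) (hu : InH V u) {d : ℝ} (hd : 0 < d) : InH V (fun y => thp d (u y)) ∧
    (∫ x, gradSq (fun y => thp d (u y)) x) ≤ (∫ x, if 0 < u x then gradSq u x else 0) ∧
    (∫ x, V x * thp d (u x) ^ 2) ≤ ∫ x, if 0 < u x then V x * u x ^ 2 else 0 := by
  obtain ⟨⟨hdu, i2, ig, i4⟩, iV⟩ := hu
  have hdt : Differentiable ℝ (fun y => thp d (u y)) := fun x => ((thp_deriv hd (u x)).comp_hasFDerivAt x (hdu x).hasFDerivAt).differentiableAt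
  have hsq : ∀ x, thp d (u x) ^ 2 ≤ if 0 < u x then u x ^ 2 else 0 := by
    intro x
    have := thp_le hd (u x)
    split_ifs with h
    · rw [max_eq_left h.le] at this; exact pow_le_pow_left₀ this.1 this.2 2
    · simp [thp, h]
  have hsq' : ∀ x, thp d (u x) ^ 2 ≤ u x ^ 2 := fun x => (hsq x).trans (by split_ifs; exact le_rfl; positivity)
  have hV1 : ∀ x, V x * thp d (u x) ^ 2 ≤ if 0 < u x then V x * u x ^ 2 else 0 := by
    intro x
    have := mul_le_mul_of_nonneg_left (hsq x) (hV0 x)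
    split_ifs at this ⊢ with h
    · exact this
    · simpa using this
  have jg : Integrable (gradSq (fun y => thp d (u y))) := (ind_int hdu.continuous ig).mono' (gradSq_meas _).aestronglyMeasurable
    (Eventually.of_forall fun x => by rw [Real.norm_eq_abs, abs_of_nonneg (gradSq_nn _ _)]; exact thp_grad hdu hd x)
  have jV : Integrable (fun x => V x * thp d (u x) ^ 2) := by
    refine (ind_int hdu.continuous iV).mono' ?_ (Eventually.of_forall fun x => by rw [Real.norm_eq_abs, abs_of_nonneg (mul_nonneg (hV0 x) (sq_nonneg _))]; exact hV1 x)
    have : (fun x => V x * thp d (u x) ^ 2) = fun x => (V x * u x ^ 2) * (thp d (u x) ^ 2 / u x ^ 2) := by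
      ext x
      by_cases h : u x = 0
      · simp [h, thp]
      · field_simp
    rw [this]
    refine iV.aestronglyMeasurable.mul ?_
    exact ((hdt.continuous.measurable.pow_const 2).div (hdu.continuous.measurable.pow_const 2)).aestronglyMeasurable
  refine ⟨⟨⟨hdt, ?_, jg, ?_⟩, jV⟩, integral_mono jg (ind_int hdu.continuous ig) (thp_grad hdu hd), integral_mono jV (ind_int hdu.continuous iV) hV1⟩
  · refine i2.mono' (hdt.continuous.pow 2).aestronglyMeasurable (Eventually.of_forall fun x => ?_)
    rw [Real.norm_eq_abs, abs_of_nonneg (by positivity)]; exact hsq' x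
  · refine i4.mono' (hdt.continuous.pow 4).aestronglyMeasurable (Eventually.of_forall fun x => ?_)
    rw [Real.norm_eq_abs, abs_of_nonneg (by positivity)]
    have := pow_le_pow_left₀ (sq_nonneg _) (hsq' x) 2
    calc _ = (thp d (u x) ^ 2) ^ 2 := by ring
      _ ≤ _ := this
      _ = _ := by ring

lemma thp_int_lim {u : E2 → ℝ} (hu : Continuous u) (k : ℕ) (hk : k ≠ 0) (i : Integrable fun x => u x ^ k) (hev : Even k) :
    Tendsto (fun n : ℕ => ∫ x, thp (1 / ((n:ℝ) + 1)) (u x) ^ k) atTop (𝓝 (∫ x, if 0 < u x then u x ^ k else 0)) := by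
  have hp : ∀ n : ℕ, (0:ℝ) < 1 / ((n:ℝ) + 1) := fun n => by positivity
  refine tendsto_integral_of_dominated_convergence (fun x => u x ^ k) (fun n => ?_) i (fun n => Eventually.of_forall fun x => ?_) (Eventually.of_forall fun x => ?_)
  · have : Continuous (thp (1 / ((n:ℝ) + 1))) := continuous_iff_continuousAt.2 fun s => (thp_deriv (hp n) s).continuousAt
    exact ((this.comp hu).pow k).aestronglyMeasurable
  · have := thp_le (hp n) (u x)
    rw [Real.norm_eq_abs, abs_of_nonneg (pow_nonneg this.1 _), ← hev.pow_abs (u x)]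
    refine pow_le_pow_left₀ this.1 (this.2.trans (max_le (le_abs_self _) (abs_nonneg _))) k
  · have := (thp_lim (u x)).pow k
    split_ifs with h
    · rwa [max_eq_left h.le] at this
    · rwa [max_eq_right (not_lt.1 h), zero_pow hk] at this

/-- energy inequality for the positive part -/
lemma pos_ineq {V u u' : E2 → ℝ} {a : ℝ} (hV0 : ∀ x, 0 ≤ V x) (hu : IsMinimizer V a u) (hu' : InH V u') :
    Ea V a u * (∫ x, if 0 < u' x then u' x ^ 2 else 0) ^ 2 ≤
     ((∫ x, if 0 < u' x then gradSq u' x else 0) + (∫ x, if 0 < u' x then V x * u' x ^ 2 else 0)) * (∫ x, if 0 < u' x then u' x ^ 2 else 0)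
      - a / 2 * (∫ x, if 0 < u' x then u' x ^ 4 else 0) := by
  have hc := hu'.1.1.continuous
  have l2 := thp_int_lim hc 2 two_ne_zero hu'.1.2.1 (by decide)
  have l4 := thp_int_lim hc 4 four_ne_zero hu'.1.2.2.2 (by decide)
  refine le_of_tendsto_of_tendsto ((l2.pow 2).const_mul _) ((l2.const_mul _).sub (l4.const_mul _)) (Eventually.of_forall fun n => ?_)
  obtain ⟨h1, h2, h3⟩ := thp_InH hV0 hu' (d := 1 / ((n:ℝ) + 1)) (by positivity)
  refine (min_ineq hV0 hu h1).trans ?_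
  have hN : 0 ≤ ∫ x, thp (1 / ((n:ℝ) + 1)) (u' x) ^ 2 := integral_nonneg fun x => sq_nonneg _
  have := mul_le_mul_of_nonneg_right (add_le_add h2 h3) hN
  linarith

lemma InH_neg {V v : E2 → ℝ} (hv : InH V v) : InH V (fun y => - v y) := by
  have := InH_const_mul hv (-1)
  simpa using this

lemma gradSq_neg (v : E2 → ℝ) (x : E2) : gradSq (fun y => - v y) x = gradSq v x := by
  unfold gradSq
  rw [show (fun y => - v y) = -v from rfl, fderiv_neg, norm_neg]

lemma split_int {f u : E2 → ℝ} (hu : Continuous u) (hf : Integrable f) (h0 : ∀ x, 0 ≤ f x) :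
    (∫ x, if 0 < u x then f x else 0) + (∫ x, if 0 < -u x then f x else 0) ≤ ∫ x, f x := by
  rw [← integral_add (ind_int hu hf) (ind_int (u := fun x => -u x) hu.neg hf)]
  refine integral_mono ((ind_int hu hf).add (ind_int (u := fun x => -u x) hu.neg hf)) hf fun x => ?_
  have := h0 x
  simp only
  split_ifs <;> linarith

lemma split_eq {f u : E2 → ℝ} (hu : Continuous u) (hf : Integrable f) (h0 : ∀ x, u x = 0 → f x = 0) :
    (∫ x, if 0 < u x then f x else 0) + (∫ x, if 0 < -u x then f x else 0) = ∫ x, f x := by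
  rw [← integral_add (ind_int hu hf) (ind_int (u := fun x => -u x) hu.neg hf)]
  congr 1; ext x
  rcases lt_trichotomy (u x) 0 with h | h | h
  · rw [if_neg (by linarith), if_pos (by linarith)]; ring
  · simp [h, h0 x h]
  · rw [if_pos h, if_neg (by linarith)]; ring

lemma ind_pos {u : E2 → ℝ} (hu : Continuous u) {k : ℕ} (i : Integrable fun x => u x ^ k) {x0 : E2} (hx : 0 < u x0) :
    0 < ∫ x, if 0 < u x then u x ^ k else 0 := by
  refine (integral_pos_iff_support_of_nonneg (fun x => ?_) (ind_int hu i)).2 ?_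
  · change (0:ℝ) ≤ if 0 < u x then u x ^ k else 0
    split_ifs <;> positivity
  · have ho : IsOpen {x | 0 < u x} := isOpen_lt continuous_const hu
    have : {x | 0 < u x} ⊆ Function.support (fun x => if 0 < u x then u x ^ k else 0) := by
      intro x (hx : 0 < u x)
      simp [hx, (pow_pos hx k).ne']
    exact (ho.measure_pos volume ⟨x0, hx⟩).trans_le (measure_mono this)

lemma nosign {V u : E2 → ℝ} {a : ℝ} (ha : 0 < a) (hV0 : ∀ x, 0 ≤ V x) (hu : IsMinimizer V a u) {x0 : E2} (hx0 : 0 < u x0) : ∀ x, 0 ≤ u x := by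
  by_contra! hcon
  obtain ⟨x1, hx1⟩ := hcon
  have hc := hu.1.1.1.continuous
  obtain ⟨⟨hd, i2, ig, i4⟩, iV⟩ := hu.1
  have hn := InH_neg hu.1
  have p1 := pos_ineq hV0 hu hu.1
  have p2 := pos_ineq hV0 hu hn
  simp only [gradSq_neg, Even.neg_pow (show Even 2 by decide), Even.neg_pow (show Even 4 by decide)] at p2
  have s2 := split_eq hc i2 (fun x h => by simp [h])
  have s4 := split_eq hc i4 (fun x h => by simp [h])
  have sg := split_int hc ig (gradSq_nn u)
  have sV := split_int hc iV (fun x => mul_nonneg (hV0 x) (sq_nonneg _))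
  have q1 := ind_pos hc i2 hx0
  have q2 := ind_pos hc i4 hx0
  have q3 := ind_pos hn.1.1.continuous hn.1.2.1 (x0 := x1) (by linarith)
  have q4 := ind_pos hn.1.1.continuous hn.1.2.2.2 (x0 := x1) (by linarith)
  simp only [Even.neg_pow (show Even 2 by decide), Even.neg_pow (show Even 4 by decide)] at q3 q4
  rw [hu.2.1] at s2
  have hE : Ea V a u = (∫ x, gradSq u x) + (∫ x, V x * u x ^ 2) - a / 2 * (∫ x, u x ^ 4) := rfl
  generalize Ea V a u = e at *
  generalize (∫ x, gradSq u x) = G at *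
  generalize (∫ x, V x * u x ^ 2) = P at *
  generalize (∫ x, u x ^ 4) = F at *
  generalize (∫ x, if 0 < u x then u x ^ 2 else 0) = m1 at *
  generalize (∫ x, if 0 < -u x then u x ^ 2 else 0) = m2 at *
  generalize (∫ x, if 0 < u x then u x ^ 4 else 0) = F1 at *
  generalize (∫ x, if 0 < -u x then u x ^ 4 else 0) = F2 at *
  generalize (∫ x, if 0 < u x then gradSq u x else 0) = G1 at *
  generalize (∫ x, if 0 < -u x then gradSq u x else 0) = G2 at *
  generalize (∫ x, if 0 < u x then V x * u x ^ 2 else 0) = P1 at *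
  generalize (∫ x, if 0 < -u x then V x * u x ^ 2 else 0) = P2 at *
  have r1 : e * m1 + a / 2 * (F1 / m1) ≤ G1 + P1 := by
    have : (e * m1 + a / 2 * (F1 / m1)) * m1 ≤ (G1 + P1) * m1 := by
      have : (e * m1 + a / 2 * (F1 / m1)) * m1 = e * m1 ^ 2 + a / 2 * F1 := by field_simp
      linarith
    exact le_of_mul_le_mul_right this q1
  have r2 : e * m2 + a / 2 * (F2 / m2) ≤ G2 + P2 := by
    have : (e * m2 + a / 2 * (F2 / m2)) * m2 ≤ (G2 + P2) * m2 := by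
      have : (e * m2 + a / 2 * (F2 / m2)) * m2 = e * m2 ^ 2 + a / 2 * F2 := by field_simp
      linarith
    exact le_of_mul_le_mul_right this q3
  have t1 : F1 < F1 / m1 := by rw [lt_div_iff₀ q1]; nlinarith
  have t2 : F2 < F2 / m2 := by rw [lt_div_iff₀ q3]; nlinarith
  have w1 := mul_lt_mul_of_pos_left (add_lt_add t1 t2) (half_pos ha)
  have : e * m1 + e * m2 = e := by rw [← mul_add, s2, mul_one]
  rw [s4] at w1
  linarith
end

noncomputable section
open MeasureTheory Real Filter
open scoped Pointwise ENNReal NNReal Topology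
set_option linter.all false
set_option linter.deprecated false

/-- partial derivative -/
def pd (u : E2 → ℝ) (i : Fin 2) (x : E2) : ℝ := fderiv ℝ u x (EuclideanSpace.single i 1)

lemma gradSq_pd (u : E2 → ℝ) (x : E2) : gradSq u x = pd u 0 x ^ 2 + pd u 1 x ^ 2 := by
  unfold gradSq pd
  generalize fderiv ℝ u x = L
  obtain ⟨z, rfl⟩ := (InnerProductSpace.toDual ℝ E2).surjective L
  rw [LinearIsometryEquiv.norm_map, EuclideanSpace.norm_sq_eq]
  simp [InnerProductSpace.toDual_apply_apply, EuclideanSpace.inner_single_right]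

lemma pd_meas (u : E2 → ℝ) (i : Fin 2) : Measurable (pd u i) := measurable_fderiv_apply_const ℝ u _

lemma pd_abs (u : E2 → ℝ) (i : Fin 2) (x : E2) : pd u i x ^ 2 ≤ gradSq u x := by
  rw [gradSq_pd]
  fin_cases i
  · simp; positivity
  · simp; positivity

/-- gradient inner product -/
def gin (u v : E2 → ℝ) (x : E2) : ℝ := pd u 0 x * pd v 0 x + pd u 1 x * pd v 1 x

lemma gin_int {u v : E2 → ℝ} (hu : Integrable (gradSq u)) (hv : Integrable (gradSq v)) : Integrable (gin u v) := by
  refine (hu.add hv).mono' (((pd_meas u 0).mul (pd_meas v 0)).add ((pd_meas u 1).mul (pd_meas v 1))).aestronglyMeasurable (Eventually.of_forall fun x => ?_)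
  simp only [Pi.add_apply, gradSq_pd, gin, Real.norm_eq_abs]
  rw [abs_le]
  constructor <;> nlinarith [sq_nonneg (pd u 0 x - pd v 0 x), sq_nonneg (pd u 1 x - pd v 1 x), sq_nonneg (pd u 0 x + pd v 0 x), sq_nonneg (pd u 1 x + pd v 1 x), sq_nonneg (pd u 0 x), sq_nonneg (pd u 1 x), sq_nonneg (pd v 0 x), sq_nonneg (pd v 1 x)]

lemma pd_add {u v : E2 → ℝ} (hu : Differentiable ℝ u) (hv : Differentiable ℝ v) (t : ℝ) (i : Fin 2) (x : E2) : pd (fun y => u y + t * v y) i x = pd u i x + t * pd v i x := by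
  unfold pd
  have := ((hu x).hasFDerivAt.add ((hv x).hasFDerivAt.const_mul t)).fderiv
  have e : fderiv ℝ (fun y => u y + t * v y) x = fderiv ℝ u x + t • fderiv ℝ v x := this
  rw [e]; simp

lemma gradSq_add {u v : E2 → ℝ} (hu : Differentiable ℝ u) (hv : Differentiable ℝ v) (t : ℝ) (x : E2) :
    gradSq (fun y => u y + t * v y) x = gradSq u x + 2 * t * gin u v x + t ^ 2 * gradSq v x := by
  simp only [gradSq_pd, pd_add hu hv, gin]; ring

lemma quad_int {f g k : E2 → ℝ} (hf : Integrable f) (hg : Integrable g) (hk : Integrable k) (s t : ℝ) :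
    Integrable (fun x => f x + s * g x + t * k x) ∧ ∫ x, (f x + s * g x + t * k x) = (∫ x, f x) + s * (∫ x, g x) + t * ∫ x, k x := by
  have i1 : Integrable (fun x => f x + s * g x) := hf.add (hg.const_mul s)
  have i2 : Integrable (fun x => t * k x) := hk.const_mul t
  refine ⟨i1.add i2, ?_⟩
  rw [integral_add i1 i2, integral_add hf (hg.const_mul s), integral_const_mul, integral_const_mul]

lemma prod_int {u v : E2 → ℝ} (hu : Continuous u) (hv : Continuous v) (iu : Integrable fun x => u x ^ 2) (iv : Integrable fun x => v x ^ 2) : Integrable fun x => u x * v x := by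
  refine (iu.add iv).mono' (hu.mul hv).aestronglyMeasurable (Eventually.of_forall fun x => ?_)
  simp only [Pi.add_apply, Real.norm_eq_abs]
  rw [abs_le]
  constructor <;> nlinarith [sq_nonneg (u x - v x), sq_nonneg (u x + v x), sq_nonneg (u x), sq_nonneg (v x)]

lemma four_int {u v : E2 → ℝ} (hu : Continuous u) (hv : Continuous v) (iu : Integrable fun x => u x ^ 4) (iv : Integrable fun x => v x ^ 4) (t : ℝ) : Integrable fun x => (u x + t * v x) ^ 4 := by
  refine ((iu.const_mul 8).add (iv.const_mul (8 * t ^ 4))).mono' ((hu.add (hv.const_mul t)).pow 4).aestronglyMeasurable (Eventually.of_forall fun x => ?_)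
  simp only [Pi.add_apply, Real.norm_eq_abs]
  rw [abs_of_nonneg (by positivity)]
  have h1 : (u x + t * v x) ^ 2 ≤ 2 * (u x ^ 2 + (t * v x) ^ 2) := by nlinarith [sq_nonneg (u x - t * v x)]
  have h2 := pow_le_pow_left₀ (sq_nonneg _) h1 2
  nlinarith [sq_nonneg (u x ^ 2 - (t * v x) ^ 2)]

lemma lin_nonneg {c d1 d2 d3 : ℝ} (h : ∀ t : ℝ, 0 < t → 0 ≤ c * t + d1 * t ^ 2 + d2 * t ^ 3 + d3 * t ^ 4) : 0 ≤ c := by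
  have hl : Tendsto (fun t : ℝ => c + d1 * t + d2 * t ^ 2 + d3 * t ^ 3) (𝓝[>] 0) (𝓝 c) := by
    have : Continuous fun t : ℝ => c + d1 * t + d2 * t ^ 2 + d3 * t ^ 3 := by fun_prop
    have := (this.tendsto 0).mono_left (nhdsWithin_le_nhds (s := Set.Ioi 0))
    simpa using this
  refine ge_of_tendsto hl ?_
  filter_upwards [self_mem_nhdsWithin] with t ht
  have ht : 0 < t := ht
  have := h t ht
  have e : c * t + d1 * t ^ 2 + d2 * t ^ 3 + d3 * t ^ 4 = (c + d1 * t + d2 * t ^ 2 + d3 * t ^ 3) * t := by ring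
  rw [e] at this
  exact nonneg_of_mul_nonneg_left this ht

/-- Euler-Lagrange inequality -/
lemma EL {V u v : E2 → ℝ} {a : ℝ} (ha : 0 ≤ a) (hV0 : ∀ x, 0 ≤ V x) (hu : IsMinimizer V a u) (hu0 : ∀ x, 0 ≤ u x) (hv : InH V v) (hv0 : ∀ x, 0 ≤ v x)
    (hVi : Integrable fun x => V x * (u x * v x)) :
    (2 * Ea V a u - ((∫ x, gradSq u x) + ∫ x, V x * u x ^ 2)) * (∫ x, u x * v x) ≤ (∫ x, gin u v x) + ∫ x, V x * (u x * v x) := by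
  obtain ⟨⟨hdu, u2, ug, u4⟩, uV⟩ := hu.1
  obtain ⟨⟨hdv, v2, vg, v4⟩, vV⟩ := hv
  have iuv := prod_int hdu.continuous hdv.continuous u2 v2
  have key : ∀ t : ℝ, 0 < t → Ea V a u * (1 + 2 * t * (∫ x, u x * v x) + t ^ 2 * ∫ x, v x ^ 2) ^ 2 ≤
      (((∫ x, gradSq u x) + 2 * t * (∫ x, gin u v x) + t ^ 2 * ∫ x, gradSq v x) + ((∫ x, V x * u x ^ 2) + 2 * t * (∫ x, V x * (u x * v x)) + t ^ 2 * ∫ x, V x * v x ^ 2)) *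
       (1 + 2 * t * (∫ x, u x * v x) + t ^ 2 * ∫ x, v x ^ 2) - a / 2 * ∫ x, u x ^ 4 := by
    intro t ht
    have qN := quad_int u2 iuv v2 (2 * t) (t ^ 2)
    have qG := quad_int ug (gin_int ug vg) vg (2 * t) (t ^ 2)
    have qV := quad_int uV hVi vV (2 * t) (t ^ 2)
    have eN : (fun x => u x ^ 2 + 2 * t * (u x * v x) + t ^ 2 * v x ^ 2) = fun x => (u x + t * v x) ^ 2 := by ext x; ring
    have eV : (fun x => V x * u x ^ 2 + 2 * t * (V x * (u x * v x)) + t ^ 2 * (V x * v x ^ 2)) = fun x => V x * (u x + t * v x) ^ 2 := by ext x; ring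
    have eG : (fun x => gradSq u x + 2 * t * gin u v x + t ^ 2 * gradSq v x) = gradSq (fun y => u y + t * v y) := by ext x; exact (gradSq_add hdu hdv t x).symm
    rw [eN] at qN; rw [eV] at qV; rw [eG] at qG
    have i4 := four_int hdu.continuous hdv.continuous u4 v4 t
    have hI : InH V (fun y => u y + t * v y) := ⟨⟨hdu.add (hdv.const_mul t), qN.1, qG.1, i4⟩, qV.1⟩
    have := min_ineq hV0 hu hI
    rw [qN.2, qV.2, qG.2, hu.2.1] at this
    refine this.trans ?_
    have h4 : ∫ x, u x ^ 4 ≤ ∫ x, (u x + t * v x) ^ 4 := by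
      refine integral_mono u4 i4 fun x => ?_
      exact pow_le_pow_left₀ (hu0 x) (by have := mul_nonneg ht.le (hv0 x); linarith) 4
    have := mul_le_mul_of_nonneg_left h4 (by positivity : 0 ≤ a / 2)
    linarith
  have hE : Ea V a u = (∫ x, gradSq u x) + (∫ x, V x * u x ^ 2) - a / 2 * (∫ x, u x ^ 4) := rfl
  generalize Ea V a u = e at *
  generalize (∫ x, gradSq u x) = G at *
  generalize (∫ x, V x * u x ^ 2) = P at *
  generalize (∫ x, u x ^ 4) = F at *
  generalize (∫ x, u x * v x) = n1 at *
  generalize (∫ x, v x ^ 2) = n2 at *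
  generalize (∫ x, gin u v x) = B at *
  generalize (∫ x, V x * (u x * v x)) = B' at *
  generalize (∫ x, gradSq v x) = G2 at *
  generalize (∫ x, V x * v x ^ 2) = P2 at *
  have := lin_nonneg (c := 2 * (B + B') + 2 * (G + P) * n1 - 4 * e * n1) (d1 := (G2 + P2) + 4 * (B + B') * n1 + (G + P) * n2 - e * (4 * n1 ^ 2 + 2 * n2))
    (d2 := 2 * (B + B') * n2 + 2 * (G2 + P2) * n1 - e * (4 * n1 * n2)) (d3 := (G2 + P2) * n2 - e * n2 ^ 2) (fun t ht => by
      have h := key t ht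
      have hF : a / 2 * F = G + P - e := by linarith
      rw [hF] at h
      nlinarith [h])
  linarith
end

noncomputable section
open MeasureTheory Real Filter
open scoped Pointwise ENNReal NNReal Topology
set_option linter.all false
set_option linter.deprecated false

/-- Hopf barrier -/
def bw (κ α ρ : ℝ) (y x : E2) : ℝ := κ * (exp (-α * ‖x - y‖ ^ 2) - exp (-α * ρ ^ 2))

lemma bw_exp (α : ℝ) (y x : E2) : HasFDerivAt (fun z : E2 => exp (-α * ‖z - y‖ ^ 2)) ((exp (-α * ‖x - y‖ ^ 2) * (-α)) • (2 • innerSL ℝ (x - y))) x := by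
  have h1 : HasFDerivAt (fun z : E2 => ‖z - y‖ ^ 2) (2 • innerSL ℝ (x - y)) x := by
    have := ((hasFDerivAt_id x).sub_const y).norm_sq
    simpa using this
  have := (h1.const_mul (-α)).exp
  rw [smul_smul] at this
  exact this

lemma bw_d (κ α ρ : ℝ) (y x : E2) : HasFDerivAt (bw κ α ρ y) (κ • ((exp (-α * ‖x - y‖ ^ 2) * (-α)) • (2 • innerSL ℝ (x - y)))) x :=
  ((bw_exp α y x).sub_const _).const_mul κ

lemma inner_single (z : E2) (i : Fin 2) : inner ℝ z (EuclideanSpace.single i (1:ℝ)) = z i := by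
  simp [EuclideanSpace.inner_single_right]

lemma bw_pd (κ α ρ : ℝ) (y x : E2) (i : Fin 2) : pd (bw κ α ρ y) i x = -2 * α * κ * exp (-α * ‖x - y‖ ^ 2) * (x i - y i) := by
  unfold pd
  rw [(bw_d κ α ρ y x).fderiv]
  simp only [ContinuousLinearMap.smul_apply, innerSL_apply_apply, inner_single, smul_eq_mul, nsmul_eq_mul, PiLp.sub_apply]
  push_cast; ring

lemma bw_pd_d (κ α ρ : ℝ) (y x : E2) (i : Fin 2) : Differentiable ℝ (pd (bw κ α ρ y) i) ∧
    pd (pd (bw κ α ρ y) i) i x = κ * exp (-α * ‖x - y‖ ^ 2) * (4 * α ^ 2 * (x i - y i) ^ 2 - 2 * α) := by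
  have e : pd (bw κ α ρ y) i = fun x => (-2 * α * κ) * (exp (-α * ‖x - y‖ ^ 2) * (x i - y i)) := by
    ext z; rw [bw_pd]; ring
  have hp : ∀ x : E2, HasFDerivAt (fun z : E2 => z i - y i) (EuclideanSpace.proj i : E2 →L[ℝ] ℝ) x := fun x =>
    ((EuclideanSpace.proj i : E2 →L[ℝ] ℝ).hasFDerivAt).sub_const (y i)
  have h : ∀ x, HasFDerivAt (pd (bw κ α ρ y) i) _ x := fun x => by
    rw [e]; exact (((bw_exp α y x).mul (hp x)).const_mul (-2 * α * κ))
  refine ⟨fun x => (h x).differentiableAt, ?_⟩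
  unfold pd at h ⊢
  rw [(h x).fderiv]
  simp only [ContinuousLinearMap.smul_apply, ContinuousLinearMap.add_apply, innerSL_apply_apply, inner_single, smul_eq_mul, nsmul_eq_mul, PiLp.sub_apply]
  have e1 : (EuclideanSpace.proj i : E2 →L[ℝ] ℝ) (EuclideanSpace.single i 1) = 1 := by simp
  rw [e1]
  push_cast; ring

lemma norm_sq2 (z : E2) : ‖z‖ ^ 2 = z 0 ^ 2 + z 1 ^ 2 := by
  rw [EuclideanSpace.norm_sq_eq]; simp

lemma bw_cont (κ α ρ : ℝ) (y : E2) : Continuous (bw κ α ρ y) := by unfold bw; fun_prop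

lemma bw_pd_cont (κ α ρ : ℝ) (y : E2) (i : Fin 2) : Continuous (pd (bw κ α ρ y) i) := (bw_pd_d κ α ρ y y i).1.continuous

lemma bw_ibp (κ α ρ : ℝ) (y : E2) {f : E2 → ℝ} (hf : Differentiable ℝ f) (hc : HasCompactSupport f) (h1 : ∀ i, Integrable fun x => pd (bw κ α ρ y) i x * pd f i x) :
    ∫ x, gin (bw κ α ρ y) f x = - ∫ x, κ * exp (-α * ‖x - y‖ ^ 2) * (4 * α ^ 2 * ‖x - y‖ ^ 2 - 4 * α) * f x := by
  have hcc : ∀ i, Continuous (pd (pd (bw κ α ρ y) i) i) := fun i => by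
    have : pd (pd (bw κ α ρ y) i) i = fun x => κ * exp (-α * ‖x - y‖ ^ 2) * (4 * α ^ 2 * (x i - y i) ^ 2 - 2 * α) := by
      ext x; exact (bw_pd_d κ α ρ y x i).2
    rw [this]; fun_prop
  have i2 : ∀ i, Integrable fun x => pd (pd (bw κ α ρ y) i) i x * f x := fun i =>
    ((hcc i).mul hf.continuous).integrable_of_hasCompactSupport hc.mul_left
  have hI : ∀ i, ∫ x, pd (bw κ α ρ y) i x * pd f i x = - ∫ x, pd (pd (bw κ α ρ y) i) i x * f x := fun i =>
    integral_mul_fderiv_eq_neg_fderiv_mul_of_integrable (i2 i) (h1 i)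
      (((bw_pd_cont κ α ρ y i).mul hf.continuous).integrable_of_hasCompactSupport hc.mul_left) (fun x _ => (bw_pd_d κ α ρ y y i).1 x) (fun x _ => hf x)
  unfold gin
  rw [integral_add (h1 0) (h1 1), hI, hI, ← neg_add, ← integral_add (i2 0) (i2 1)]
  congr 2; ext x
  rw [(bw_pd_d κ α ρ y x 0).2, (bw_pd_d κ α ρ y x 1).2, norm_sq2 (x - y)]
  simp only [PiLp.sub_apply]
  ring

lemma sqpos_deriv (s : ℝ) : HasDerivAt (fun t : ℝ => (max t 0) ^ 2) (2 * max s 0) s := by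
  rcases lt_trichotomy s 0 with h | h | h
  · rw [max_eq_right h.le, mul_zero]
    refine (hasDerivAt_const s (0:ℝ)).congr_of_eventuallyEq ?_
    filter_upwards [gt_mem_nhds h] with t ht
    simp [max_eq_right ht.le]
  · subst h
    rw [max_self, mul_zero, hasDerivAt_iff_isLittleO]
    simp only [sub_zero, smul_zero, max_self]
    refine Asymptotics.IsBigO.trans_isLittleO (g := fun t : ℝ => t * t) ?_ ?_
    · refine Asymptotics.IsBigO.of_bound 1 (Eventually.of_forall fun t => ?_)
      rw [one_mul, Real.norm_eq_abs, Real.norm_eq_abs]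
      rcases le_total t 0 with h | h
      · rw [max_eq_right h]; simp; exact mul_self_nonneg t
      · rw [max_eq_left h]; simp [pow_two]
    · have : (fun t : ℝ => t) =o[𝓝 0] (fun _ => (1:ℝ)) := (Asymptotics.isLittleO_one_iff ℝ).2 tendsto_id
      simpa using this.mul_isBigO (Asymptotics.isBigO_refl (fun t : ℝ => t) (𝓝 0))
  · rw [max_eq_left h.le]
    have h1 : HasDerivAt (fun t : ℝ => t ^ 2) (2 * s) s := by simpa using hasDerivAt_pow 2 s
    refine h1.congr_of_eventuallyEq ?_
    filter_upwards [lt_mem_nhds h] with t ht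
    simp [max_eq_left ht.le]

/-- truncated difference -/
def tm (w u : E2 → ℝ) (δ : ℝ) (x : E2) : ℝ := max (w x - u x - δ) 0
def ts (w u : E2 → ℝ) (δ : ℝ) (x : E2) : ℝ := tm w u δ x ^ 2

lemma ts_d {w u : E2 → ℝ} (hw : Differentiable ℝ w) (hu : Differentiable ℝ u) (δ : ℝ) : Differentiable ℝ (ts w u δ) ∧
    ∀ i x, pd (ts w u δ) i x = 2 * tm w u δ x * (pd w i x - pd u i x) := by
  have h : ∀ x, HasFDerivAt (ts w u δ) ((2 * tm w u δ x) • (fderiv ℝ w x - fderiv ℝ u x)) x := fun x => by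
    have h1 : HasFDerivAt (fun z => w z - u z - δ) (fderiv ℝ w x - fderiv ℝ u x) x := ((hw x).hasFDerivAt.sub (hu x).hasFDerivAt).sub_const δ
    exact (sqpos_deriv (w x - u x - δ)).comp_hasFDerivAt x h1
  refine ⟨fun x => (h x).differentiableAt, fun i x => ?_⟩
  unfold pd
  rw [(h x).fderiv]; simp
end

noncomputable section
open MeasureTheory Real Filter
open scoped Pointwise ENNReal NNReal Topology
set_option linter.all false
set_option linter.deprecated false

structure Bar (κ α ρ δ : ℝ) (y : E2) (u : E2 → ℝ) : Prop where
  kp : 0 < κ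
  ap : 0 < α
  rp : 0 < ρ
  dp : 0 < δ
  ud : Differentiable ℝ u
  u0 : ∀ x, 0 ≤ u x
  ug : Integrable (gradSq u)
  uin : ∀ x, ‖x - y‖ ≤ ρ / 2 → κ ≤ u x

namespace Bar
variable {κ α ρ δ : ℝ} {y : E2} {u : E2 → ℝ}

lemma w_le (h : Bar κ α ρ δ y u) (x : E2) : bw κ α ρ y x ≤ κ := by
  unfold bw
  have h1 : exp (-α * ‖x - y‖ ^ 2) ≤ 1 := Real.exp_le_one_iff.2 (by have := mul_nonneg h.ap.le (sq_nonneg ‖x - y‖); linarith)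
  have h2 := Real.exp_pos (-α * ρ ^ 2)
  have := h.kp
  nlinarith

lemma w_out (h : Bar κ α ρ δ y u) {x : E2} (hx : ρ ≤ ‖x - y‖) : bw κ α ρ y x ≤ 0 := by
  unfold bw
  have h1 : exp (-α * ‖x - y‖ ^ 2) ≤ exp (-α * ρ ^ 2) := by
    rw [Real.exp_le_exp]
    have := mul_le_mul_of_nonneg_left (pow_le_pow_left₀ h.rp.le hx 2) h.ap.le
    linarith
  exact mul_nonpos_of_nonneg_of_nonpos h.kp.le (by linarith)

lemma tm_nn (x : E2) : 0 ≤ tm (bw κ α ρ y) u δ x := le_max_right _ _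

lemma tm_le (h : Bar κ α ρ δ y u) (x : E2) : tm (bw κ α ρ y) u δ x ≤ κ := by
  refine max_le ?_ h.kp.le
  have := h.w_le x; have := h.u0 x; have := h.dp
  linarith

lemma tm_supp (h : Bar κ α ρ δ y u) {x : E2} (hx : tm (bw κ α ρ y) u δ x ≠ 0) : ρ / 2 < ‖x - y‖ ∧ ‖x - y‖ < ρ ∧ u x + δ < bw κ α ρ y x := by
  have h1 : 0 < bw κ α ρ y x - u x - δ := by
    by_contra hc
    exact hx (max_eq_right (not_lt.1 hc))
  have hd := h.dp
  have hu := h.u0 x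
  refine ⟨?_, ?_, by linarith⟩
  · by_contra hc
    have := h.uin x (not_lt.1 hc)
    have := h.w_le x
    linarith
  · by_contra hc
    have := h.w_out (not_lt.1 hc)
    linarith

lemma tm_cs (h : Bar κ α ρ δ y u) : HasCompactSupport (tm (bw κ α ρ y) u δ) := by
  refine HasCompactSupport.intro (isCompact_closedBall y ρ) fun x hx => ?_
  by_contra hc
  have := (h.tm_supp hc).2.1
  rw [mem_closedBall_iff_norm] at hx
  exact hx this.le

lemma tm_cont (h : Bar κ α ρ δ y u) : Continuous (tm (bw κ α ρ y) u δ) :=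
  (((bw_cont κ α ρ y).sub h.ud.continuous).sub continuous_const).max continuous_const

lemma ts_cs (h : Bar κ α ρ δ y u) : HasCompactSupport (ts (bw κ α ρ y) u δ) := cs_pow h.tm_cs 2 two_ne_zero

lemma wd : Differentiable ℝ (bw κ α ρ y) := fun x => (bw_d κ α ρ y x).differentiableAt

lemma tsd (h : Bar κ α ρ δ y u) : Differentiable ℝ (ts (bw κ α ρ y) u δ) := (ts_d wd h.ud δ).1

lemma int_tm (h : Bar κ α ρ δ y u) {f : E2 → ℝ} (hf : Continuous f) : Integrable fun x => tm (bw κ α ρ y) u δ x * f x :=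
  (h.tm_cont.mul hf).integrable_of_hasCompactSupport h.tm_cs.mul_right

lemma int_ts (h : Bar κ α ρ δ y u) {f : E2 → ℝ} (hf : Continuous f) : Integrable fun x => f x * ts (bw κ α ρ y) u δ x :=
  (hf.mul h.tsd.continuous).integrable_of_hasCompactSupport h.ts_cs.mul_left

lemma int_pp (h : Bar κ α ρ δ y u) (i : Fin 2) : Integrable fun x => pd (bw κ α ρ y) i x * pd (ts (bw κ α ρ y) u δ) i x := by
  set w := bw κ α ρ y
  have hc := bw_pd_cont κ α ρ y i
  have i1 := h.int_tm (f := fun x => 2 * pd w i x ^ 2 + tm w u δ x * pd w i x ^ 2) ((continuous_const.mul (hc.pow 2)).add (h.tm_cont.mul (hc.pow 2)))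
  refine (i1.add h.ug).mono' ((pd_meas _ _).mul (pd_meas _ _)).aestronglyMeasurable (Eventually.of_forall fun x => ?_)
  simp only [Pi.add_apply]
  have h1 := pd_abs u i x
  rw [(ts_d wd h.ud δ).2 i x, Real.norm_eq_abs, abs_le]
  have h0 : 0 ≤ tm w u δ x := tm_nn x
  change -(tm w u δ x * (2 * pd w i x ^ 2 + tm w u δ x * pd w i x ^ 2) + gradSq u x) ≤ pd w i x * (2 * tm w u δ x * (pd w i x - pd u i x)) ∧
    pd w i x * (2 * tm w u δ x * (pd w i x - pd u i x)) ≤ tm w u δ x * (2 * pd w i x ^ 2 + tm w u δ x * pd w i x ^ 2) + gradSq u x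
  have hm := mul_nonneg h0 (sq_nonneg (pd w i x))
  constructor
  · nlinarith [sq_nonneg (tm w u δ x * pd w i x - pd u i x)]
  · nlinarith [sq_nonneg (tm w u δ x * pd w i x + pd u i x)]

lemma ts_grad (h : Bar κ α ρ δ y u) : Integrable (gradSq (ts (bw κ α ρ y) u δ)) := by
  set w := bw κ α ρ y
  have hc := fun i => bw_pd_cont κ α ρ y i
  have i1 := h.int_tm (f := fun x => tm w u δ x * (8 * (pd w 0 x ^ 2 + pd w 1 x ^ 2))) (h.tm_cont.mul (continuous_const.mul (((hc 0).pow 2).add ((hc 1).pow 2))))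
  refine (i1.add (h.ug.const_mul (8 * κ ^ 2))).mono' (gradSq_meas _).aestronglyMeasurable (Eventually.of_forall fun x => ?_)
  simp only [Pi.add_apply]
  rw [Real.norm_eq_abs, abs_of_nonneg (gradSq_nn _ _), gradSq_pd, gradSq_pd u, (ts_d wd h.ud δ).2 0 x, (ts_d wd h.ud δ).2 1 x]
  have h0 : 0 ≤ tm w u δ x := tm_nn x
  have h1 : tm w u δ x ^ 2 ≤ κ ^ 2 := pow_le_pow_left₀ h0 (h.tm_le x) 2
  have h2 := mul_le_mul_of_nonneg_right h1 (add_nonneg (sq_nonneg (pd u 0 x)) (sq_nonneg (pd u 1 x)))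
  change (2 * tm w u δ x * (pd w 0 x - pd u 0 x)) ^ 2 + (2 * tm w u δ x * (pd w 1 x - pd u 1 x)) ^ 2 ≤ _
  have h3 := mul_nonneg (sq_nonneg (tm w u δ x)) (add_nonneg (sq_nonneg (pd w 0 x + pd u 0 x)) (sq_nonneg (pd w 1 x + pd u 1 x)))
  nlinarith

lemma lap_ge (h : Bar κ α ρ δ y u) {K : ℝ} (hK : 0 < K) (hα : K ≤ α ^ 2 * ρ ^ 2 - 4 * α) (x : E2) :
    K * (u x + δ) * ts (bw κ α ρ y) u δ x ≤ κ * exp (-α * ‖x - y‖ ^ 2) * (4 * α ^ 2 * ‖x - y‖ ^ 2 - 4 * α) * ts (bw κ α ρ y) u δ x := by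
  by_cases hx : tm (bw κ α ρ y) u δ x = 0
  · simp [ts, hx]
  obtain ⟨h1, h2, h3⟩ := h.tm_supp hx
  have h4 : 0 ≤ ts (bw κ α ρ y) u δ x := sq_nonneg _
  refine mul_le_mul_of_nonneg_right ?_ h4
  have h5 : bw κ α ρ y x ≤ κ * exp (-α * ‖x - y‖ ^ 2) := by
    unfold bw; have := mul_pos h.kp (Real.exp_pos (-α * ρ ^ 2)); linarith
  have h6 : 0 < κ * exp (-α * ‖x - y‖ ^ 2) := mul_pos h.kp (Real.exp_pos _)
  have h7 : K ≤ 4 * α ^ 2 * ‖x - y‖ ^ 2 - 4 * α := by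
    have := pow_le_pow_left₀ (by have := h.rp; positivity) h1.le 2
    have := mul_le_mul_of_nonneg_left this (sq_nonneg α)
    linarith
  calc K * (u x + δ) ≤ K * (κ * exp (-α * ‖x - y‖ ^ 2)) := by gcongr; linarith
    _ = κ * exp (-α * ‖x - y‖ ^ 2) * K := by ring
    _ ≤ _ := by gcongr

lemma compare (h : Bar κ α ρ δ y u) {K : ℝ} (hK : 0 < K) (hα : K ≤ α ^ 2 * ρ ^ 2 - 4 * α)
    (hEL : -(K * ∫ x, u x * ts (bw κ α ρ y) u δ x) ≤ ∫ x, gin u (ts (bw κ α ρ y) u δ) x) (x : E2) : bw κ α ρ y x ≤ u x + δ := by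
  have igw : Integrable (gin (bw κ α ρ y) (ts (bw κ α ρ y) u δ)) := (h.int_pp 0).add (h.int_pp 1)
  have igu := gin_int h.ug h.ts_grad
  have e1 : ∫ x, gin u (ts (bw κ α ρ y) u δ) x ≤ ∫ x, gin (bw κ α ρ y) (ts (bw κ α ρ y) u δ) x := by
    refine integral_mono igu igw fun x => ?_
    have h0 : 0 ≤ tm (bw κ α ρ y) u δ x := tm_nn x
    unfold gin
    rw [(ts_d wd h.ud δ).2 0 x, (ts_d wd h.ud δ).2 1 x]
    have := mul_nonneg h0 (add_nonneg (sq_nonneg (pd (bw κ α ρ y) 0 x - pd u 0 x)) (sq_nonneg (pd (bw κ α ρ y) 1 x - pd u 1 x)))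
    nlinarith
  rw [bw_ibp κ α ρ y h.tsd h.ts_cs h.int_pp] at e1
  have hcu := h.ud.continuous
  have j1 := h.int_ts (f := fun x => K * (u x + δ)) (by fun_prop)
  have j2 := h.int_ts (f := fun x => κ * exp (-α * ‖x - y‖ ^ 2) * (4 * α ^ 2 * ‖x - y‖ ^ 2 - 4 * α)) (by fun_prop)
  have e2 := integral_mono j1 j2 (h.lap_ge hK hα)
  have j3 := h.int_ts (f := u) hcu
  have j4 : Integrable (ts (bw κ α ρ y) u δ) := h.tsd.continuous.integrable_of_hasCompactSupport h.ts_cs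
  have e3 : ∫ x, K * (u x + δ) * ts (bw κ α ρ y) u δ x = K * (∫ x, u x * ts (bw κ α ρ y) u δ x) + K * δ * ∫ x, ts (bw κ α ρ y) u δ x := by
    rw [← integral_const_mul, ← integral_const_mul, ← integral_add (j3.const_mul _) (j4.const_mul _)]
    congr 1; ext x; ring
  have hle : ∫ x, ts (bw κ α ρ y) u δ x ≤ 0 := by
    have : K * δ * ∫ x, ts (bw κ α ρ y) u δ x ≤ 0 := by
      rw [e3] at e2; linarith
    by_contra hc
    have := mul_pos (mul_pos hK h.dp) (not_le.1 hc)
    linarith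
  have h0 : 0 ≤ ts (bw κ α ρ y) u δ := fun x => sq_nonneg _
  have hz := (integral_eq_zero_iff_of_nonneg h0 j4).1 (le_antisymm hle (integral_nonneg h0))
  have hz2 := (h.tsd.continuous.ae_eq_iff_eq (μ := volume) continuous_zero).1 hz
  have hx : ts (bw κ α ρ y) u δ x = 0 := congrFun hz2 x
  have hx2 : tm (bw κ α ρ y) u δ x = 0 := pow_eq_zero_iff two_ne_zero |>.1 hx
  have := le_max_left (bw κ α ρ y x - u x - δ) 0
  unfold tm at hx2
  linarith
end Bar
end

noncomputable section
open MeasureTheory Real Filter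
open scoped Pointwise ENNReal NNReal Topology
set_option linter.all false
set_option linter.deprecated false

namespace Bar
variable {κ α ρ δ : ℝ} {y : E2} {u V : E2 → ℝ} {B : ℝ}

lemma ts_V (h : Bar κ α ρ δ y u) (hV0 : ∀ x, 0 ≤ V x) (iV : Integrable fun x => V x * u x ^ 2) (hB : ∀ x, ‖x - y‖ ≤ ρ → V x ≤ B) (hpos : ∀ x, ‖x - y‖ < ρ → 0 < u x)
    {f : E2 → ℝ} (hf : Continuous f) (hf0 : ∀ x, 0 ≤ f x) : Integrable fun x => V x * (f x * ts (bw κ α ρ y) u δ x) := by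
  have hz : ∀ x, ts (bw κ α ρ y) u δ x ≠ 0 → ‖x - y‖ < ρ := fun x hx => (h.tm_supp (fun hc => hx (by simp [ts, hc]))).2.1
  refine ((h.int_ts hf).const_mul B).mono' ?_ (Eventually.of_forall fun x => ?_)
  · have : (fun x => V x * (f x * ts (bw κ α ρ y) u δ x)) = fun x => (V x * u x ^ 2) * ((f x * ts (bw κ α ρ y) u δ x) / u x ^ 2) := by
      ext x
      by_cases hx : ts (bw κ α ρ y) u δ x = 0
      · simp [hx]
      · have := (hpos x (hz x hx)).ne'
        field_simp
    rw [this]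
    refine iV.aestronglyMeasurable.mul ?_
    exact ((hf.measurable.mul h.tsd.continuous.measurable).div (h.ud.continuous.measurable.pow_const 2)).aestronglyMeasurable
  · have h1 : 0 ≤ f x * ts (bw κ α ρ y) u δ x := mul_nonneg (hf0 x) (sq_nonneg _)
    rw [Real.norm_eq_abs, abs_of_nonneg (mul_nonneg (hV0 x) h1)]
    by_cases hx : ts (bw κ α ρ y) u δ x = 0
    · simp [hx]
    · exact mul_le_mul_of_nonneg_right (hB x (hz x hx).le) h1

lemma ts_InH (h : Bar κ α ρ δ y u) (hV0 : ∀ x, 0 ≤ V x) (iV : Integrable fun x => V x * u x ^ 2) (hB : ∀ x, ‖x - y‖ ≤ ρ → V x ≤ B) (hpos : ∀ x, ‖x - y‖ < ρ → 0 < u x) :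
    InH V (ts (bw κ α ρ y) u δ) := by
  refine ⟨⟨h.tsd, cs_int_pow h.tsd.continuous h.ts_cs 2 two_ne_zero, h.ts_grad, cs_int_pow h.tsd.continuous h.ts_cs 4 four_ne_zero⟩, ?_⟩
  have := h.ts_V hV0 iV hB hpos h.tsd.continuous (fun x => sq_nonneg _)
  simpa only [pow_two] using this
end Bar

lemma exists_alpha {K ρ : ℝ} (hK : 0 < K) (hρ : 0 < ρ) : ∃ α : ℝ, 0 < α ∧ K ≤ α ^ 2 * ρ ^ 2 - 4 * α := by
  refine ⟨(4 + K) / ρ ^ 2 + 1, by positivity, ?_⟩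
  have e : ((4 + K) / ρ ^ 2 + 1) ^ 2 * ρ ^ 2 - 4 * ((4 + K) / ρ ^ 2 + 1) = ((4 + K) / ρ ^ 2 + 1) * (K + ρ ^ 2) := by
    field_simp; ring
  rw [e]
  have h1 : 0 < (4 + K) / ρ ^ 2 := by positivity
  nlinarith [sq_nonneg ρ, mul_pos h1 hK]

lemma u_pos {V u : E2 → ℝ} {a : ℝ} (ha : 0 < a) (hV0 : ∀ x, 0 ≤ V x) (hVb : ∀ (y : E2) (R : ℝ), ∃ B, ∀ x, ‖x - y‖ ≤ R → V x ≤ B) (hu : IsMinimizer V a u)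
    (hu0 : ∀ x, 0 ≤ u x) {y : E2} (hy : 0 < u y) : ∀ x, 0 < u x := by
  by_contra! hcon
  obtain ⟨z, hz⟩ := hcon
  have hc := hu.1.1.1.continuous
  set Z : Set E2 := {x | u x = 0}
  have hZc : IsClosed Z := isClosed_eq hc continuous_const
  have hZn : Z.Nonempty := ⟨z, le_antisymm hz (hu0 z)⟩
  obtain ⟨x0, hx0, hd⟩ := hZc.exists_infDist_eq_dist hZn y
  set ρ := ‖x0 - y‖ with hρd
  have hρ' : Metric.infDist y Z = ρ := by rw [hd, dist_comm, dist_eq_norm]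
  have hρ : 0 < ρ := by
    refine norm_pos_iff.2 (sub_ne_zero.2 fun h => ?_)
    rw [h] at hx0; exact hy.ne' hx0
  have hpos : ∀ x, ‖x - y‖ < ρ → 0 < u x := by
    intro x hx
    refine (hu0 x).lt_of_ne fun h => ?_
    have := Metric.infDist_le_dist_of_mem (x := y) (show x ∈ Z from h.symm)
    rw [hρ', dist_comm, dist_eq_norm] at this
    linarith
  obtain ⟨κ, hκ, hκu⟩ : ∃ κ : ℝ, 0 < κ ∧ ∀ x, ‖x - y‖ ≤ ρ / 2 → κ ≤ u x := by
    obtain ⟨m, hm, hmin⟩ := (isCompact_closedBall y (ρ / 2)).exists_isMinOn ⟨y, Metric.mem_closedBall_self (by positivity)⟩ hc.continuousOn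
    rw [mem_closedBall_iff_norm] at hm
    exact ⟨u m, hpos m (by linarith), fun x hx => hmin (by rwa [mem_closedBall_iff_norm])⟩
  obtain ⟨B, hB⟩ := hVb y ρ
  set μ := 2 * Ea V a u - ((∫ x, gradSq u x) + ∫ x, V x * u x ^ 2) with hμ
  set K := |B| + |μ| + 1 with hK
  have hK0 : 0 < K := by positivity
  obtain ⟨α, hα0, hα⟩ := exists_alpha hK0 hρ
  have hle : ∀ x, bw κ α ρ y x ≤ u x := by
    intro x
    refine le_of_forall_pos_le_add fun δ hδ => ?_
    have hb : Bar κ α ρ δ y u := ⟨hκ, hα0, hρ, hδ, hu.1.1.1, hu0, hu.1.1.2.2.1, hκu⟩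
    refine hb.compare hK0 hα ?_ x
    have iVt := hb.ts_V hV0 hu.1.2 hB hpos hc hu0
    have := EL ha.le hV0 hu hu0 (hb.ts_InH hV0 hu.1.2 hB hpos) (fun x => sq_nonneg _) iVt
    rw [← hμ] at this
    have it := hb.int_ts (f := u) hc
    have h2 : ∫ x, V x * (u x * ts (bw κ α ρ y) u δ x) ≤ |B| * ∫ x, u x * ts (bw κ α ρ y) u δ x := by
      rw [← integral_const_mul]
      refine integral_mono iVt (it.const_mul _) fun x => ?_
      have hn : 0 ≤ u x * ts (bw κ α ρ y) u δ x := mul_nonneg (hu0 x) (sq_nonneg _)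
      change V x * (u x * ts (bw κ α ρ y) u δ x) ≤ |B| * (u x * ts (bw κ α ρ y) u δ x)
      by_cases hx : tm (bw κ α ρ y) u δ x = 0
      · simp [ts, hx]
      · exact mul_le_mul_of_nonneg_right ((hB x (hb.tm_supp hx).2.1.le).trans (le_abs_self _)) hn
    have hn : 0 ≤ ∫ x, u x * ts (bw κ α ρ y) u δ x := integral_nonneg fun x => mul_nonneg (hu0 x) (sq_nonneg _)
    have h3 := mul_le_mul_of_nonneg_right (neg_abs_le μ) hn
    rw [hK]
    linarith
  have hx0 : u x0 = 0 := hx0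
  have d1 : fderiv ℝ u x0 = 0 := by
    refine IsLocalMin.fderiv_eq_zero (Eventually.of_forall fun x => ?_)
    rw [hx0]; exact hu0 x
  have hw0 : bw κ α ρ y x0 = 0 := by unfold bw; rw [← hρd]; simp
  have d2 : fderiv ℝ (fun x => u x - bw κ α ρ y x) x0 = 0 := by
    refine IsLocalMin.fderiv_eq_zero (Eventually.of_forall fun x => ?_)
    change u x0 - bw κ α ρ y x0 ≤ u x - bw κ α ρ y x
    rw [hx0, hw0]; have := hle x; linarith
  have d3 := ((hu.1.1.1 x0).hasFDerivAt.sub (bw_d κ α ρ y x0)).fderiv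
  have d4 : fderiv ℝ (fun x => u x - bw κ α ρ y x) x0 = _ := d3
  rw [d2, d1, zero_sub] at d4
  have d5 := congrArg (fun L : E2 →L[ℝ] ℝ => L (x0 - y)) d4
  simp only [ContinuousLinearMap.zero_apply, ContinuousLinearMap.neg_apply, ContinuousLinearMap.smul_apply, innerSL_apply_apply, smul_eq_mul, nsmul_eq_mul, real_inner_self_eq_norm_sq] at d5
  rw [← hρd] at d5
  have : 0 < κ * (exp (-α * ρ ^ 2) * α * (2 * ρ ^ 2)) := by positivity
  push_cast at d5
  linarith

lemma IsMin_neg {V u : E2 → ℝ} {a : ℝ} (hu : IsMinimizer V a u) : IsMinimizer V a (fun x => - u x) := by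
  have e : Ea V a (fun x => - u x) = Ea V a u := by
    unfold Ea
    simp only [gradSq_neg, Even.neg_pow (show Even 2 by decide), Even.neg_pow (show Even 4 by decide)]
  refine ⟨InH_neg hu.1, ?_, fun v hv hv1 => e ▸ hu.2.2 v hv hv1⟩
  simp only [Even.neg_pow (show Even 2 by decide)]; exact hu.2.1

lemma V_meas {V u : E2 → ℝ} {a : ℝ} (ha : 0 < a) (hV0 : ∀ x, 0 ≤ V x) (hVb : ∀ (y : E2) (R : ℝ), ∃ B, ∀ x, ‖x - y‖ ≤ R → V x ≤ B) (hu : IsMinimizer V a u) :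
    AEStronglyMeasurable V volume := by
  have hne : ∀ x, u x ≠ 0 := by
    obtain ⟨y, hy⟩ : ∃ y, u y ≠ 0 := by
      by_contra! hc
      have := hu.2.1
      simp [hc] at this
    rcases lt_or_gt_of_ne hy with h | h
    · have hu' := IsMin_neg hu
      have hp : 0 < -u y := by linarith
      have := u_pos ha hV0 hVb hu' (nosign ha hV0 hu' hp) hp
      intro x; have := this x; intro h; rw [h] at this; simp at this
    · have := u_pos ha hV0 hVb hu (nosign ha hV0 hu h) h
      exact fun x => (this x).ne'
  have e : V = fun x => (V x * u x ^ 2) * (u x ^ 2)⁻¹ := by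
    ext x; have := hne x; field_simp
  rw [e]
  exact hu.1.2.aestronglyMeasurable.mul (hu.1.1.1.continuous.measurable.pow_const 2).inv.aestronglyMeasurable
end

noncomputable section
open MeasureTheory Real Filter
open scoped Pointwise ENNReal NNReal Topology
set_option linter.all false
set_option linter.deprecated false

lemma exists_sep {n : ℕ} (hn : 0 < n) (pts : Fin n → E2) (hpts : Function.Injective pts) : ∃ d : ℝ, 0 < d ∧ d ≤ 1 ∧ ∀ i j, i ≠ j → 2 * d ≤ ‖pts i - pts j‖ := by
  haveI : Nonempty (Fin n) := ⟨⟨0, hn⟩⟩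
  obtain ⟨k, hk⟩ := Finite.exists_min (fun k : Fin n × Fin n => if k.1 = k.2 then (2:ℝ) else min 2 ‖pts k.1 - pts k.2‖)
  refine ⟨(if k.1 = k.2 then (2:ℝ) else min 2 ‖pts k.1 - pts k.2‖) / 2, ?_, ?_, fun i j hij => ?_⟩
  · split_ifs with h
    · norm_num
    · have : 0 < ‖pts k.1 - pts k.2‖ := norm_pos_iff.2 (sub_ne_zero.2 fun h' => h (hpts h'))
      have : 0 < min 2 ‖pts k.1 - pts k.2‖ := lt_min two_pos this
      linarith
  · split_ifs with h
    · norm_num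
    · have : min 2 ‖pts k.1 - pts k.2‖ ≤ 2 := min_le_left _ _
      linarith
  · have := hk (i, j)
    simp only [if_neg hij] at this
    have h2 : min 2 ‖pts i - pts j‖ ≤ ‖pts i - pts j‖ := min_le_right _ _
    linarith

lemma W_lower {n : ℕ} (hn : 0 < n) (pts : Fin n → E2) (hpts : Function.Injective pts) (pe : Fin n → ℝ) (hpe : ∀ i, 0 < pe i) {p : ℝ} (hple : ∀ i, pe i ≤ p) {L : ℝ} (hL : 0 < L) :
    ∃ c : ℝ, 0 < c ∧ ∀ x : E2, ∏ i, ‖x - pts i‖ ^ pe i ≤ L → ∃ i, c * ‖x - pts i‖ ^ p ≤ ∏ i, ‖x - pts i‖ ^ pe i := by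
  haveI : Nonempty (Fin n) := ⟨⟨0, hn⟩⟩
  obtain ⟨d, hd0, hd1, hd⟩ := exists_sep hn pts hpts
  set S := ∑ i, pe i
  set L' := L / d ^ S
  have hL' : 0 < L' := by positivity
  obtain ⟨R0, hR0⟩ : ∃ R : ℝ, ∀ i, L' ^ (1 / pe i) ≤ R := by
    obtain ⟨D, hD⟩ := (Set.finite_range fun i => L' ^ (1 / pe i)).bddAbove
    exact ⟨D, fun i => hD ⟨i, rfl⟩⟩
  set R := max R0 1
  have hR1 : 1 ≤ R := le_max_right _ _
  have hRp : 0 < R := by linarith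
  refine ⟨d ^ S / R ^ p, by positivity, fun x hx => ?_⟩
  obtain ⟨i, hi⟩ := Finite.exists_min (fun i => ‖x - pts i‖)
  refine ⟨i, ?_⟩
  set r := ‖x - pts i‖ with hr
  have hr0 : 0 ≤ r := norm_nonneg _
  have hprod : r ^ pe i * d ^ S ≤ ∏ i, ‖x - pts i‖ ^ pe i := by
    have hj : ∀ j ∈ Finset.univ, (if j = i then r ^ pe i else 1) * d ^ pe j ≤ ‖x - pts j‖ ^ pe j := by
      intro j _
      split_ifs with hji
      · subst hji
        exact mul_le_of_le_one_right (by positivity) (Real.rpow_le_one hd0.le hd1 (hpe j).le)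
      · rw [one_mul]
        refine Real.rpow_le_rpow hd0.le ?_ (hpe j).le
        have h1 := hd j i hji
        have h2 := hi j
        have h3 : ‖pts j - pts i‖ ≤ ‖x - pts i‖ + ‖x - pts j‖ := by
          have := norm_sub_le (x - pts i) (x - pts j)
          rwa [sub_sub_sub_cancel_left] at this
        linarith
    refine le_trans (le_of_eq ?_) (Finset.prod_le_prod (fun j _ => ?_) hj)
    · rw [Finset.prod_mul_distrib, Finset.prod_ite_eq', if_pos (Finset.mem_univ _), ← Real.rpow_sum_of_pos hd0]
    · split_ifs <;> positivity
  have hrL : r ^ pe i ≤ L' := by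
    rw [le_div_iff₀ (by positivity)]; linarith
  have hrR : r ≤ R := by
    have := Real.rpow_le_rpow (by positivity) hrL (by have := hpe i; positivity : 0 ≤ 1 / pe i)
    rw [← Real.rpow_mul hr0, mul_one_div_cancel (hpe i).ne', Real.rpow_one] at this
    exact this.trans ((hR0 i).trans (le_max_left _ _))
  have hrp : r ^ p ≤ r ^ pe i * R ^ p := by
    have e : r ^ p = r ^ pe i * r ^ (p - pe i) := by
      rw [← Real.rpow_add_of_nonneg hr0 (hpe i).le (by linarith [hple i])]; congr 1; ring
    rw [e]
    refine mul_le_mul_of_nonneg_left ?_ (by positivity)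
    exact (Real.rpow_le_rpow hr0 hrR (by linarith [hple i])).trans (Real.rpow_le_rpow_of_exponent_le hR1 (by linarith [hpe i]))
  refine le_trans ?_ hprod
  rw [div_mul_eq_mul_div, div_le_iff₀ (by positivity)]
  have := mul_le_mul_of_nonneg_left hrp (by positivity : 0 ≤ d ^ S)
  linarith

lemma vol_closedBall (x : E2) {r : ℝ} (hr : 0 ≤ r) : volume (Metric.closedBall x r) = ENNReal.ofReal (π * r ^ 2) := by
  rw [EuclideanSpace.volume_closedBall_fin_two, ENNReal.ofReal_mul Real.pi_pos.le, ENNReal.ofReal_pow hr]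
  rw [mul_comm]

lemma W_vol {n : ℕ} (hn : 0 < n) (pts : Fin n → E2) (hpts : Function.Injective pts) (pe : Fin n → ℝ) (hpe : ∀ i, 0 < pe i) {p : ℝ} (hp : 0 < p) (hple : ∀ i, pe i ≤ p) {L : ℝ} (hL : 0 < L) :
    ∃ B : ℝ, 0 < B ∧ ∀ l : ℝ, 0 < l → l ≤ L → volume {x : E2 | ∏ i, ‖x - pts i‖ ^ pe i < l} ≤ ENNReal.ofReal (B * l ^ (2 / p)) := by
  obtain ⟨c, hc, h⟩ := W_lower hn pts hpts pe hpe hple hL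
  refine ⟨n * π * (c⁻¹) ^ (2 / p), by positivity, fun l hl hlL => ?_⟩
  set r := (c⁻¹ * l) ^ (1 / p) with hr
  have hr0 : 0 ≤ r := by positivity
  have hsub : {x : E2 | ∏ i, ‖x - pts i‖ ^ pe i < l} ⊆ ⋃ i, Metric.closedBall (pts i) r := by
    intro x (hx : ∏ i, ‖x - pts i‖ ^ pe i < l)
    obtain ⟨i, hi⟩ := h x (hx.le.trans hlL)
    refine Set.mem_iUnion.2 ⟨i, ?_⟩
    rw [mem_closedBall_iff_norm]
    have h1 : ‖x - pts i‖ ^ p ≤ c⁻¹ * l := by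
      rw [inv_mul_eq_div, le_div_iff₀ hc]; linarith
    have := Real.rpow_le_rpow (by positivity) h1 (by positivity : 0 ≤ 1 / p)
    rwa [← Real.rpow_mul (norm_nonneg _), mul_one_div_cancel hp.ne', Real.rpow_one] at this
  refine (measure_mono hsub).trans ((measure_iUnion_fintype_le _ _).trans ?_)
  simp only [vol_closedBall _ hr0]
  rw [Finset.sum_const, Finset.card_univ, Fintype.card_fin, nsmul_eq_mul, ← ENNReal.ofReal_natCast, ← ENNReal.ofReal_mul (by positivity)]
  refine ENNReal.ofReal_le_ofReal (le_of_eq ?_)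
  rw [hr, ← Real.rpow_natCast, ← Real.rpow_mul (by positivity), show 1 / p * ((2:ℕ):ℝ) = 2 / p by push_cast; ring, Real.mul_rpow (by positivity) (by positivity)]
  ring

lemma conc {u V W : E2 → ℝ} {l B : ℝ} (hl : 0 < l) (hB : 0 < B) (hW : Measurable W) (hWV : ∀ x, W x ≤ V x) (hV0 : ∀ x, 0 ≤ V x) (i2 : Integrable fun x => u x ^ 2) (i4 : Integrable fun x => u x ^ 4)
    (iV : Integrable fun x => V x * u x ^ 2) (h1 : ∫ x, u x ^ 2 = 1) (hP : 2 * ∫ x, V x * u x ^ 2 ≤ l) (hvol : volume {x | W x < l} ≤ ENNReal.ofReal B) : 1 / (4 * B) ≤ ∫ x, u x ^ 4 := by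
  set S := {x | W x < l}
  have hS : MeasurableSet S := measurableSet_lt hW measurable_const
  have hfin : volume S ≠ ⊤ := (hvol.trans_lt ENNReal.ofReal_lt_top).ne
  have hSr : volume.real S ≤ B := ENNReal.toReal_le_of_le_ofReal hB.le hvol
  have e := integral_add_compl hS i2
  have c1 : ∫ x in Sᶜ, u x ^ 2 ≤ 1 / 2 := by
    have : ∫ x in Sᶜ, u x ^ 2 ≤ ∫ x in Sᶜ, l⁻¹ * (V x * u x ^ 2) := by
      refine setIntegral_mono_on i2.integrableOn (iV.const_mul _).integrableOn hS.compl fun x hx => ?_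
      have hx' : l ≤ W x := not_lt.1 hx
      rw [← mul_assoc]
      refine le_mul_of_one_le_left (sq_nonneg _) ?_
      rw [inv_mul_eq_div, one_le_div hl]; exact hx'.trans (hWV x)
    refine this.trans ((setIntegral_le_integral (iV.const_mul _) (Eventually.of_forall fun x => ?_)).trans ?_)
    · have := mul_nonneg (hV0 x) (sq_nonneg (u x))
      change 0 ≤ l⁻¹ * (V x * u x ^ 2)
      positivity
    · rw [integral_const_mul, inv_mul_eq_div, div_le_iff₀ hl]; linarith
  have c2 : ∫ x in S, u x ^ 2 ≤ B * (∫ x, u x ^ 4) + 1 / 4 := by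
    have ic : IntegrableOn (fun x : E2 => 1 / (4 * B)) S := integrableOn_const hfin
    have : ∫ x in S, u x ^ 2 ≤ ∫ x in S, (B * u x ^ 4 + 1 / (4 * B)) := by
      refine integral_mono i2.integrableOn ((i4.const_mul B).integrableOn.add ic) fun x => ?_
      have e : B * u x ^ 4 + 1 / (4 * B) - u x ^ 2 = B * (u x ^ 2 - 1 / (2 * B)) ^ 2 := by field_simp; ring
      have : 0 ≤ B * (u x ^ 2 - 1 / (2 * B)) ^ 2 := by positivity
      simp only; linarith
    rw [integral_add (i4.const_mul B).integrableOn ic] at this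
    have t1 : ∫ x in S, B * u x ^ 4 ≤ B * ∫ x, u x ^ 4 := by
      rw [← integral_const_mul]
      exact setIntegral_le_integral (i4.const_mul _) (Eventually.of_forall fun x => by change 0 ≤ B * u x ^ 4; positivity)
    have t2 : ∫ x in S, 1 / (4 * B) ≤ 1 / 4 := by
      rw [setIntegral_const, smul_eq_mul, mul_one_div, div_le_iff₀ (by positivity)]; linarith
    linarith
  rw [div_le_iff₀ (by positivity)]
  linarith

lemma e_bound {Q : E2 → ℝ} (hQ : IsGroundState Q) {n : ℕ} (pts : Fin n → E2) (pe : Fin n → ℝ) (hpe : ∀ i, 0 < pe i) {C : ℝ} (hC : 0 < C)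
    {V : E2 → ℝ} (hV0 : ∀ x, 0 ≤ V x) (hV1 : ∀ x, V x ≤ C * ∏ i, ‖x - pts i‖ ^ pe i) {p : ℝ} (hp : ∃ i, pe i = p) :
    ∃ M : ℝ, 0 < M ∧ ∀ a : ℝ, ∀ u, 0 ≤ a → a < (∫ x : E2, Q x ^ 2) → IsMinimizer V a u → Ea V a u ≤ M * ((∫ x : E2, Q x ^ 2) - a) ^ (p / (p + 2)) := by
  have hA := GS_apos hQ
  by_cases hVm : AEStronglyMeasurable V volume
  · obtain ⟨M, hM, h⟩ := trial hQ pts pe hpe hC hVm hV0 hV1 hp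
    refine ⟨M, hM, fun a u ha ha' hu => ?_⟩
    obtain ⟨v, hv, hv1, hE⟩ := h a ha ha'
    exact (hu.2.2 v hv hv1).trans hE
  · have hWc : Continuous fun x : E2 => C * ∏ i, ‖x - pts i‖ ^ pe i :=
      continuous_const.mul (continuous_finset_prod _ fun i _ => ((continuous_id.sub continuous_const).norm).rpow_const fun x => Or.inr (hpe i).le)
    have hVb : ∀ (y : E2) (R : ℝ), ∃ B, ∀ x, ‖x - y‖ ≤ R → V x ≤ B := by
      intro y R
      obtain ⟨B, hB⟩ := (isCompact_closedBall y R).bddAbove_image hWc.continuousOn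
      exact ⟨B, fun x hx => (hV1 x).trans (hB ⟨x, by rwa [mem_closedBall_iff_norm], rfl⟩)⟩
    have ha0 : ∀ a u, 0 ≤ a → IsMinimizer V a u → a = 0 := by
      intro a u ha hu
      by_contra hne
      exact hVm (V_meas (lt_of_le_of_ne ha (Ne.symm hne)) hV0 hVb hu)
    by_cases hex : ∃ u0, IsMinimizer V 0 u0
    · obtain ⟨u0, hu0⟩ := hex
      refine ⟨(|Ea V 0 u0| + 1) / (∫ x : E2, Q x ^ 2) ^ (p / (p + 2)), by positivity, fun a u ha ha' hu => ?_⟩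
      obtain rfl := ha0 a u ha hu
      rw [sub_zero, div_mul_cancel₀ _ (by positivity)]
      have := hu.2.2 u0 hu0.1 hu0.2.1
      have := le_abs_self (Ea V 0 u0)
      linarith
    · refine ⟨1, one_pos, fun a u ha ha' hu => ?_⟩
      obtain rfl := ha0 a u ha hu
      exact absurd ⟨u, hu⟩ hex

end


theorem stmt14 (Q : E2 → ℝ) (hQ : IsGroundState Q) (n : ℕ) (hn : 0 < n)
    (pts : Fin n → E2) (hpts : Function.Injective pts)
    (pe : Fin n → ℝ) (hpe : ∀ i, 0 < pe i)
    (h : E2 → ℝ) (C : ℝ) (hC : 0 < C) (hh : ∀ x, C < h x ∧ h x < 1 / C)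
    (V : E2 → ℝ) (hV : ∀ x, V x = h x * ∏ i, ‖x - pts i‖ ^ pe i)
    (p : ℝ) (hple : ∀ i, pe i ≤ p) (hpmax : ∃ i, pe i = p) :
    ∃ K : ℝ, 0 < K ∧ ∀ a : ℝ, ∀ u : E2 → ℝ,
      0 ≤ a → a < (∫ x : E2, Q x ^ 2) → IsMinimizer V a u →
      K * ((∫ x : E2, Q x ^ 2) - a) ^ (-(2 / (p + 2))) ≤ (∫ x : E2, u x ^ 4) ∧
      (∫ x : E2, u x ^ 4) ≤ K⁻¹ * ((∫ x : E2, Q x ^ 2) - a) ^ (-(2 / (p + 2))) := by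
  have hw0 : ∀ x : E2, 0 ≤ ∏ i, ‖x - pts i‖ ^ pe i := fun x => Finset.prod_nonneg fun i _ => by positivity
  have hV0 : ∀ x, 0 ≤ V x := fun x => by rw [hV x]; exact mul_nonneg (hC.trans (hh x).1).le (hw0 x)
  have hV1 : ∀ x, V x ≤ 1 / C * ∏ i, ‖x - pts i‖ ^ pe i := fun x => by rw [hV x]; exact mul_le_mul_of_nonneg_right (hh x).2.le (hw0 x)
  have hV2 : ∀ x, C * ∏ i, ‖x - pts i‖ ^ pe i ≤ V x := fun x => by rw [hV x]; exact mul_le_mul_of_nonneg_right (hh x).1.le (hw0 x)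
  have hp : 0 < p := by obtain ⟨i, hi⟩ := hpmax; exact hi ▸ hpe i
  have hWc : Continuous fun x : E2 => C * ∏ i, ‖x - pts i‖ ^ pe i :=
    continuous_const.mul (continuous_finset_prod _ fun i _ => ((continuous_id.sub continuous_const).norm).rpow_const fun x => Or.inr (hpe i).le)
  have hA := GS_apos hQ
  obtain ⟨M, hM, hMb⟩ := e_bound hQ pts pe hpe (C := 1 / C) (by positivity) hV0 hV1 hpmax
  set A := ∫ x : E2, Q x ^ 2 with hAd
  set q := p / (p + 2) with hq
  have hq0 : 0 < q := by positivity
  obtain ⟨B, hB, hvol⟩ := W_vol hn pts hpts pe hpe hp hple (L := 2 * M * A ^ q / C) (by positivity)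
  set B' := 4 * (B * (2 * M / C) ^ (2 / p)) with hB'
  have hB'0 : 0 < B' := by positivity
  refine ⟨min (1 / B') (1 / (2 * M)), lt_min (by positivity) (by positivity), fun a u ha ha' hu => ?_⟩
  have he : 0 < A - a := by linarith
  have hE := hMb a u ha ha' hu
  obtain ⟨⟨hd, i2, ig, i4⟩, iV⟩ := hu.1
  have hGN := GN hQ hu.1.1
  rw [hu.2.1, mul_one, ← hAd] at hGN
  have hF0 : 0 ≤ ∫ x, u x ^ 4 := integral_nonneg fun x => by positivity
  have hP0 : 0 ≤ ∫ x, V x * u x ^ 2 := integral_nonneg fun x => mul_nonneg (hV0 x) (sq_nonneg _)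
  have hEd : Ea V a u = (∫ x, gradSq u x) + (∫ x, V x * u x ^ 2) - a / 2 * (∫ x, u x ^ 4) := rfl
  have hx : (A - a) ^ q = (A - a) ^ (-(2 / (p + 2))) * (A - a) := by
    nth_rw 3 [← Real.rpow_one (A - a)]
    rw [← Real.rpow_add he]; congr 1; rw [hq]; field_simp; ring
  have hX : 0 < (A - a) ^ (-(2 / (p + 2))) := by positivity
  constructor
  · have hP : 2 * ∫ x, V x * u x ^ 2 ≤ 2 * M * (A - a) ^ q := by
      have : 0 ≤ (A - a) * ∫ x, u x ^ 4 := by positivity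
      linarith
    have hlA : (A - a) ^ q ≤ A ^ q := Real.rpow_le_rpow he.le (by linarith) hq0.le
    have hv := hvol (2 * M * (A - a) ^ q / C) (by positivity) (by gcongr)
    have hset : {x : E2 | ∏ i, ‖x - pts i‖ ^ pe i < 2 * M * (A - a) ^ q / C} = {x : E2 | C * ∏ i, ‖x - pts i‖ ^ pe i < 2 * M * (A - a) ^ q} := by
      ext x; simp only [Set.mem_setOf_eq]; rw [lt_div_iff₀ hC, mul_comm]
    rw [hset] at hv
    have hc := conc (by positivity) (by positivity) hWc.measurable hV2 hV0 i2 i4 iV hu.2.1 hP hv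
    refine le_trans ?_ hc
    have e1 : (2 * M * (A - a) ^ q / C) ^ (2 / p) = (2 * M / C) ^ (2 / p) * ((A - a) ^ (-(2 / (p + 2))))⁻¹ := by
      rw [show 2 * M * (A - a) ^ q / C = 2 * M / C * (A - a) ^ q by ring, Real.mul_rpow (by positivity) (by positivity), ← Real.rpow_mul he.le, Real.rpow_neg he.le, inv_inv]
      congr 2; rw [hq]; field_simp
    rw [e1]
    have e2 : 1 / (4 * (B * ((2 * M / C) ^ (2 / p) * ((A - a) ^ (-(2 / (p + 2))))⁻¹))) = 1 / B' * (A - a) ^ (-(2 / (p + 2))) := by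
      rw [hB']; field_simp
    rw [e2]
    exact mul_le_mul_of_nonneg_right (min_le_left _ _) hX.le
  · have h1 : (A - a) * ∫ x, u x ^ 4 ≤ 2 * M * (A - a) ^ q := by linarith
    rw [hx, ← mul_assoc, mul_comm] at h1
    have h2 := le_of_mul_le_mul_right h1 he
    refine h2.trans (mul_le_mul_of_nonneg_right ?_ hX.le)
    rw [le_inv_comm₀ (by positivity) (lt_min (by positivity) (by positivity)), ← one_div]
    exact min_le_right _ _
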